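/- arXiv:1209.1050 — 4 statements merged into one kernel-verified Lean document; each statement's English description precedes it below -/
import Mathlib

section
/- Let G be a k-critical graph (k ≥ 4), and let A, B be disjoint vertex subsets such that at least one of A, B is independent, every vertex of A has degree k−1 in G, every vertex of B has degree k in G, and A ∪ B is nonempty. Then either some vertex a ∈ A has at most one neighbor in B, or some vertex b ∈ B has at most three neighbors in A. -/
/-- A graph is `k`-critical if its chromatic number is `k` but every proper
subgraph is `(k−1)`-colorable. -/
def IsCritical {V : Type*} (G : SimpleGraph V) (k : ℕ) : Prop :=
  G.chromaticNumber = (k : ℕ∞) ∧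
    ∀ H : SimpleGraph V, H ≤ G → H ≠ G → H.chromaticNumber ≤ ((k - 1 : ℕ) : ℕ∞)

theorem kernel_aux {V : Type*} [DecidableEq V] (G : SimpleGraph V) (arc : V → V → Prop)
    (I : Finset V) (h1 : ∀ u ∈ I, ∀ v ∈ I, ¬ G.Adj u v)
    (h2 : ∀ u v, u ∉ I → v ∉ I → arc u v) (h3 : ∀ u v, arc u v ∨ arc v u) :
    ∀ (n : ℕ) (T : Finset V), T.card ≤ n → ∃ K ⊆ T, (∀ u ∈ K, ∀ v ∈ K, ¬ G.Adj u v) ∧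
      ∀ v ∈ T, v ∉ K → ∃ w ∈ K, G.Adj v w ∧ arc v w := by
  classical
  intro n
  induction n with
  | zero =>
    intro T hT
    have : T = ∅ := by simpa using hT
    subst this
    exact ⟨∅, by simp⟩
  | succ n ih =>
    intro T hT
    by_cases h : ∀ v ∈ T, v ∉ I → ∃ w ∈ T ∩ I, G.Adj v w ∧ arc v w
    · refine ⟨T ∩ I, Finset.inter_subset_left, ?_, ?_⟩
      · intro u hu v hv
        exact h1 u (Finset.mem_inter.1 hu).2 v (Finset.mem_inter.1 hv).2
      · intro v hv hvK
        exact h v hv (fun hI => hvK (Finset.mem_inter.2 ⟨hv, hI⟩))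
    · push Not at h
      obtain ⟨v, hvT, hvI, hv⟩ := h
      have hin : ∀ w ∈ T, G.Adj w v → arc w v := by
        intro w hw hadj
        by_cases hwI : w ∈ I
        · exact (h3 w v).resolve_right (hv w (Finset.mem_inter.2 ⟨hw, hwI⟩) hadj.symm)
        · exact h2 w v hwI hvI
      obtain ⟨K, hKT, hK1, hK2⟩ := ih (T.filter (fun w => w ≠ v ∧ ¬ G.Adj w v)) (by
        have : (T.filter (fun w => w ≠ v ∧ ¬ G.Adj w v)).card < T.card := by
          apply Finset.card_lt_card
          refine Finset.ssubset_iff_subset_ne.2 ⟨Finset.filter_subset _ _, fun he => ?_⟩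
          rw [← he] at hvT
          simp at hvT
        omega)
      have hKn : ∀ u ∈ K, ¬ G.Adj u v := fun u hu => (Finset.mem_filter.1 (hKT hu)).2.2
      refine ⟨insert v K, ?_, ?_, ?_⟩
      · intro u hu
        rcases Finset.mem_insert.1 hu with rfl | hu
        · exact hvT
        · exact (Finset.mem_filter.1 (hKT hu)).1
      · intro x hx y hy hxy
        rcases Finset.mem_insert.1 hx with hx' | hx' <;> rcases Finset.mem_insert.1 hy with hy' | hy'
        · rw [hx', hy'] at hxy
          exact G.loopless.irrefl _ hxy
        · rw [hx'] at hxy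
          exact hKn y hy' hxy.symm
        · rw [hy'] at hxy
          exact hKn x hx' hxy
        · exact hK1 x hx' y hy' hxy
      · intro x hx hxK
        rw [Finset.mem_insert, not_or] at hxK
        by_cases hxv : G.Adj x v
        · exact ⟨v, Finset.mem_insert_self _ _, hxv, hin x hx hxv⟩
        · obtain ⟨w, hw, hw'⟩ := hK2 x (Finset.mem_filter.2 ⟨hx, hxK.1, hxv⟩) hxK.2
          exact ⟨w, Finset.mem_insert_of_mem hw, hw'⟩

open Classical in
theorem list_aux {V C : Type*} [Inhabited C] (G : SimpleGraph V) (arc : V → V → Prop)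
    (I : Finset V) (h1 : ∀ u ∈ I, ∀ v ∈ I, ¬ G.Adj u v)
    (h2 : ∀ u v, u ∉ I → v ∉ I → arc u v) (h3 : ∀ u v, arc u v ∨ arc v u) :
    ∀ (n : ℕ) (S : Finset V) (L : V → Finset C), S.card ≤ n →
      (∀ u ∈ S, (S.filter (fun v => G.Adj u v ∧ arc u v)).card < (L u).card) →
      ∃ c : V → C, (∀ u ∈ S, c u ∈ L u) ∧ ∀ u ∈ S, ∀ v ∈ S, G.Adj u v → c u ≠ c v := by
  intro n
  induction n with
  | zero =>
    intro S L hS _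
    have : S = ∅ := by simpa using hS
    subst this
    exact ⟨fun _ => default, by simp⟩
  | succ n ih =>
    intro S L hS hL
    rcases S.eq_empty_or_nonempty with rfl | ⟨u0, hu0⟩
    · exact ⟨fun _ => default, by simp⟩
    obtain ⟨α, hα⟩ : (L u0).Nonempty := Finset.card_pos.1 (lt_of_le_of_lt (Nat.zero_le _) (hL u0 hu0))
    obtain ⟨K, hKT, hK1, hK2⟩ := kernel_aux G arc I h1 h2 h3 _
      (S.filter (fun v => α ∈ L v)) le_rfl
    have hKS : ∀ u ∈ K, u ∈ S ∧ α ∈ L u := fun u hu => Finset.mem_filter.1 (hKT hu)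
    have hKne : K.Nonempty := by
      by_cases h : u0 ∈ K
      · exact ⟨_, h⟩
      · obtain ⟨w, hw, _⟩ := hK2 u0 (Finset.mem_filter.2 ⟨hu0, hα⟩) h
        exact ⟨w, hw⟩
    obtain ⟨c, hc1, hc2⟩ := ih (S \ K) (fun v => (L v).erase α) (by
        have : (S \ K).card < S.card := by
          apply Finset.card_lt_card
          obtain ⟨w, hw⟩ := hKne
          refine Finset.ssubset_iff_subset_ne.2 ⟨Finset.sdiff_subset, fun he => ?_⟩
          have := (hKS w hw).1
          rw [← he] at this
          exact (Finset.mem_sdiff.1 this).2 hw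
        omega) (by
        intro u hu
        obtain ⟨huS, huK⟩ := Finset.mem_sdiff.1 hu
        have hlt := hL u huS
        have hsub : (S \ K).filter (fun v => G.Adj u v ∧ arc u v) ⊆
            S.filter (fun v => G.Adj u v ∧ arc u v) :=
          Finset.filter_subset_filter _ Finset.sdiff_subset
        by_cases hαu : α ∈ L u
        · rw [Finset.card_erase_of_mem hαu]
          obtain ⟨w, hw, hw'⟩ := hK2 u (Finset.mem_filter.2 ⟨huS, hαu⟩) huK
          have : ((S \ K).filter (fun v => G.Adj u v ∧ arc u v)).card <
              (S.filter (fun v => G.Adj u v ∧ arc u v)).card := by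
            apply Finset.card_lt_card
            refine Finset.ssubset_iff_subset_ne.2 ⟨hsub, fun he => ?_⟩
            have : w ∈ S.filter (fun v => G.Adj u v ∧ arc u v) :=
              Finset.mem_filter.2 ⟨(hKS w hw).1, hw'⟩
            rw [← he] at this
            exact (Finset.mem_sdiff.1 (Finset.mem_filter.1 this).1).2 hw
          omega
        · rw [Finset.erase_eq_of_notMem hαu]
          exact lt_of_le_of_lt (Finset.card_le_card hsub) hlt)
    refine ⟨fun v => if v ∈ K then α else c v, ?_, ?_⟩
    · intro u hu
      by_cases h : u ∈ K
      · simpa [h] using (hKS u h).2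
      · simpa [h] using Finset.mem_of_mem_erase (hc1 u (Finset.mem_sdiff.2 ⟨hu, h⟩))
    · intro u hu v hv huv
      by_cases h : u ∈ K <;> by_cases h' : v ∈ K
      · exact absurd huv (hK1 u h v h')
      · simpa [h, h'] using (Finset.ne_of_mem_erase (hc1 v (Finset.mem_sdiff.2 ⟨hv, h'⟩))).symm
      · simpa [h, h'] using (Finset.ne_of_mem_erase (hc1 u (Finset.mem_sdiff.2 ⟨hu, h⟩)))
      · simpa [h, h'] using hc2 u (Finset.mem_sdiff.2 ⟨hu, h⟩) v (Finset.mem_sdiff.2 ⟨hv, h'⟩) huv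

theorem hall_aux {V : Type*} [DecidableEq V] (G : SimpleGraph V) [DecidableRel G.Adj]
    (A B : Finset V)
    (hA : ∀ a ∈ A, 2 ≤ (B.filter (fun b => G.Adj a b)).card)
    (hB : ∀ b ∈ B, 4 ≤ (A.filter (fun a => G.Adj b a)).card) :
    ∃ g : V → V, (∀ a ∈ A, g a ∈ B ∧ G.Adj a (g a)) ∧
      ∀ b ∈ B, 2 ≤ (A.filter (fun a => G.Adj b a ∧ g a ≠ b)).card := by
  classical
  let t : {a // a ∈ A} ⊕ ({b // b ∈ B} × Fin 2) → Finset (V × V) := fun i =>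
    match i with
    | Sum.inl a => {a.1} ×ˢ (B.filter (fun b => G.Adj a b))
    | Sum.inr (b, _) => (A.filter (fun a => G.Adj b a)) ×ˢ {b.1}
  have hall : ∀ s : Finset ({a // a ∈ A} ⊕ ({b // b ∈ B} × Fin 2)), s.card ≤ (s.biUnion t).card := by
    intro s
    have hs : s.toLeft.card + s.toRight.card = s.card := Finset.card_toLeft_add_card_toRight
    have hX : s.toLeft.card * 2 ≤ (s.biUnion t).card := by
      calc s.toLeft.card * 2 ≤ ∑ a ∈ s.toLeft, (t (Sum.inl a)).card := by
            rw [← smul_eq_mul]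
            apply Finset.card_nsmul_le_sum
            intro a _
            simpa [t] using hA a.1 a.2
        _ = (s.toLeft.biUnion (fun a => t (Sum.inl a))).card := by
            rw [Finset.card_biUnion]
            intro x _ y _ hxy
            refine Finset.disjoint_left.2 ?_
            rintro ⟨p, q⟩ hp hq
            simp only [t, Finset.mem_product, Finset.mem_singleton] at hp hq
            exact hxy (Subtype.ext (hp.1.symm.trans hq.1))
        _ ≤ _ := by
            apply Finset.card_le_card
            intro e he
            obtain ⟨a, ha, he⟩ := Finset.mem_biUnion.1 he
            exact Finset.mem_biUnion.2 ⟨_, Finset.mem_toLeft.1 ha, he⟩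
    have hY : (s.toRight.image Prod.fst).card * 4 ≤ (s.biUnion t).card := by
      calc (s.toRight.image Prod.fst).card * 4
          ≤ ∑ b ∈ s.toRight.image Prod.fst, (t (Sum.inr (b, 0))).card := by
            rw [← smul_eq_mul]
            apply Finset.card_nsmul_le_sum
            intro b _
            simpa [t] using hB b.1 b.2
        _ = ((s.toRight.image Prod.fst).biUnion (fun b => t (Sum.inr (b, 0)))).card := by
            rw [Finset.card_biUnion]
            intro x _ y _ hxy
            refine Finset.disjoint_left.2 ?_
            rintro ⟨p, q⟩ hp hq
            simp only [t, Finset.mem_product, Finset.mem_singleton] at hp hq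
            exact hxy (Subtype.ext (hp.2.symm.trans hq.2))
        _ ≤ _ := by
            apply Finset.card_le_card
            intro e he
            obtain ⟨b, hb, he⟩ := Finset.mem_biUnion.1 he
            obtain ⟨⟨b', i⟩, hb', rfl⟩ := Finset.mem_image.1 hb
            exact Finset.mem_biUnion.2 ⟨_, Finset.mem_toRight.1 hb', he⟩
    have hR : s.toRight.card ≤ (s.toRight.image Prod.fst).card * 2 := by
      have : s.toRight ⊆ (s.toRight.image Prod.fst) ×ˢ (Finset.univ : Finset (Fin 2)) := by
        intro p hp
        exact Finset.mem_product.2 ⟨Finset.mem_image_of_mem _ hp, Finset.mem_univ _⟩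
      simpa using Finset.card_le_card this
    omega
  obtain ⟨f, hf, hft⟩ := (Finset.all_card_le_biUnion_card_iff_exists_injective t).1 hall
  refine ⟨fun a => if h : a ∈ A then (f (Sum.inl ⟨a, h⟩)).2 else a, ?_, ?_⟩
  · intro a ha
    have := hft (Sum.inl ⟨a, ha⟩)
    simp only [t, Finset.mem_product, Finset.mem_singleton, Finset.mem_filter] at this
    simpa [ha] using this.2
  · intro b hb
    have key : ∀ i : Fin 2, (f (Sum.inr (⟨b, hb⟩, i))).1 ∈ A ∧ G.Adj b (f (Sum.inr (⟨b, hb⟩, i))).1 ∧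
        (f (Sum.inr (⟨b, hb⟩, i))).2 = b := by
      intro i
      have := hft (Sum.inr (⟨b, hb⟩, i))
      simp only [t, Finset.mem_product, Finset.mem_singleton, Finset.mem_filter] at this
      exact ⟨this.1.1, this.1.2, this.2⟩
    have h2 : (Finset.univ.image (fun i : Fin 2 => (f (Sum.inr (⟨b, hb⟩, i))).1)).card = 2 := by
      rw [Finset.card_image_of_injective]
      · simp
      · intro i j hij
        have := hf (Prod.ext hij ((key i).2.2.trans (key j).2.2.symm))
        simpa using this
    refine h2.symm.le.trans (Finset.card_le_card ?_)
    intro a ha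
    obtain ⟨i, _, rfl⟩ := Finset.mem_image.1 ha
    obtain ⟨k1, k2, k3⟩ := key i
    refine Finset.mem_filter.2 ⟨k1, k2, ?_⟩
    intro he
    simp only [k1, dite_true] at he
    have h4 := hft (Sum.inl ⟨_, k1⟩)
    simp only [t, Finset.mem_product, Finset.mem_singleton, Finset.mem_filter] at h4
    have := hf (Prod.ext h4.1 (he.trans k3.symm))
    simp at this

/-- In a `k`-critical graph (`k ≥ 4`), with `A`, `B` as before,
either some `a ∈ A` has at most one neighbor in `B`, or some `b ∈ B` has at
most three neighbors in `A`. -/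
theorem bipartite_one_or_three {V : Type*} [Fintype V] [DecidableEq V]
    (G : SimpleGraph V) [DecidableRel G.Adj] (k : ℕ) (hk : 4 ≤ k)
    (hcrit : IsCritical G k) (A B : Finset V) (hdisj : Disjoint A B)
    (hind : (∀ u ∈ A, ∀ v ∈ A, ¬ G.Adj u v) ∨ (∀ u ∈ B, ∀ v ∈ B, ¬ G.Adj u v))
    (hA : ∀ a ∈ A, G.degree a = k - 1) (hB : ∀ b ∈ B, G.degree b = k)
    (hne : (A ∪ B).Nonempty) :
    (∃ a ∈ A, (B.filter (fun b => G.Adj a b)).card ≤ 1) ∨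
      (∃ b ∈ B, (A.filter (fun a => G.Adj b a)).card ≤ 3) := by
  classical
  by_contra hcon
  push Not at hcon
  obtain ⟨hA2, hB4⟩ := hcon
  obtain ⟨g, hg1, hg2⟩ := hall_aux G A B hA2 hB4
  have hAB : ∀ x, x ∈ A → x ∈ B → False := fun x h h' => Finset.disjoint_left.1 hdisj h h'
  let arc : V → V → Prop := fun u v => (u ∈ A → v ∈ B → g u ≠ v) ∧ (u ∈ B → v ∈ A → g v = u)
  have h3 : ∀ u v, arc u v ∨ arc v u := by
    intro u v
    have := hAB u
    have := hAB v
    simp only [arc]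
    tauto
  obtain ⟨I, hI1, hI2⟩ : ∃ I : Finset V, (∀ u ∈ I, ∀ v ∈ I, ¬ G.Adj u v) ∧
      ∀ u v, u ∉ I → v ∉ I → arc u v := by
    rcases hind with h | h
    · exact ⟨A, h, fun u v hu hv => ⟨fun h => absurd h hu, fun _ h => absurd h hv⟩⟩
    · exact ⟨B, h, fun u v hu hv => ⟨fun _ h => absurd h hv, fun h => absurd h hu⟩⟩
  obtain ⟨hχ, hsub⟩ := hcrit
  set S := A ∪ B with hS
  -- the graph with the edges at S removed
  let H : SimpleGraph V :=
    { Adj := fun u v => G.Adj u v ∧ u ∉ S ∧ v ∉ S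
      symm := ⟨fun u v h => ⟨h.1.symm, h.2.2, h.2.1⟩⟩
      loopless := ⟨fun u h => G.loopless.irrefl u h.1⟩ }
  have hHcol : H.Colorable (k - 1) := by
    rw [← SimpleGraph.chromaticNumber_le_iff_colorable]
    apply hsub H (fun u v h => h.1)
    intro he
    obtain ⟨x, hx⟩ := hne
    have hpos : 0 < G.degree x := by
      rcases Finset.mem_union.1 hx with h | h
      · rw [hA x h]; omega
      · rw [hB x h]; omega
    obtain ⟨y, hy⟩ := (G.degree_pos_iff_exists_adj x).1 hpos
    rw [← he] at hy
    exact hy.2.1 hx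
  obtain ⟨c0⟩ := hHcol
  have : Inhabited (Fin (k - 1)) := ⟨⟨0, by omega⟩⟩
  let L : V → Finset (Fin (k - 1)) := fun u =>
    Finset.univ \ (((Finset.univ \ S).filter (fun v => G.Adj u v)).image c0)
  have hdeg : ∀ u, (S.filter (fun v => G.Adj u v)).card +
      ((Finset.univ \ S).filter (fun v => G.Adj u v)).card = G.degree u := by
    intro u
    rw [← SimpleGraph.card_neighborFinset_eq_degree, ← Finset.card_union_of_disjoint]
    · congr 1
      ext v
      simp only [Finset.mem_union, Finset.mem_filter, Finset.mem_sdiff, Finset.mem_univ, true_and,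
        SimpleGraph.mem_neighborFinset]
      tauto
    · exact Finset.disjoint_filter_filter Finset.disjoint_sdiff
  have hLcard : ∀ u, k - 1 ≤
      (L u).card + ((Finset.univ \ S).filter (fun v => G.Adj u v)).card := by
    intro u
    have e1 := Finset.le_card_sdiff
      (((Finset.univ \ S).filter (fun v => G.Adj u v)).image c0) (Finset.univ : Finset (Fin (k-1)))
    have e2 := Finset.card_image_le (s := (Finset.univ \ S).filter (fun v => G.Adj u v)) (f := c0)
    rw [Finset.card_univ, Fintype.card_fin] at e1
    simp only [L]
    omega
  have hsplit : ∀ u, (S.filter (fun v => G.Adj u v ∧ arc u v)).card +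
      (S.filter (fun v => G.Adj u v ∧ ¬ arc u v)).card = (S.filter (fun v => G.Adj u v)).card := by
    intro u
    rw [← Finset.card_filter_add_card_filter_not (s := S.filter (fun v => G.Adj u v))
      (fun v => arc u v), Finset.filter_filter, Finset.filter_filter]
  obtain ⟨c, hc1, hc2⟩ := list_aux G arc I hI1 hI2 h3 S.card S L le_rfl (by
    intro u hu
    have e1 := hdeg u
    have e2 := hLcard u
    have e3 := hsplit u
    suffices hh : G.degree u + 1 < k - 1 + 1 + (S.filter (fun v => G.Adj u v ∧ ¬ arc u v)).card by
      convert (show (S.filter (fun v => G.Adj u v ∧ arc u v)).card < (L u).card by omega)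
    rcases Finset.mem_union.1 hu with h | h
    · have : 0 < (S.filter (fun v => G.Adj u v ∧ ¬ arc u v)).card := by
        refine Finset.card_pos.2 ⟨g u, Finset.mem_filter.2
          ⟨Finset.mem_union_right _ (hg1 u h).1, (hg1 u h).2, fun ha => ?_⟩⟩
        exact ha.1 h (hg1 u h).1 rfl
      rw [hA u h]; omega
    · have : 2 ≤ (S.filter (fun v => G.Adj u v ∧ ¬ arc u v)).card := by
        refine (hg2 u h).trans (Finset.card_le_card ?_)
        intro a ha
        obtain ⟨ha1, ha2, ha3⟩ := Finset.mem_filter.1 ha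
        exact Finset.mem_filter.2 ⟨Finset.mem_union_left _ ha1, ha2, fun h' => ha3 (h'.2 h ha1)⟩
      rw [hB u h]; omega)
  have hLout : ∀ u ∈ S, ∀ v, v ∉ S → G.Adj u v → c u ≠ c0 v := by
    intro u hu v hv huv he
    have := (Finset.mem_sdiff.1 (hc1 u hu)).2
    rw [he] at this
    exact this (Finset.mem_image_of_mem _ (by simp [hv, huv]))
  have hcol : G.Colorable (k - 1) := by
    refine ⟨SimpleGraph.Coloring.mk (fun v => if v ∈ S then c v else c0 v) ?_⟩
    intro u v huv
    by_cases h : u ∈ S <;> by_cases h' : v ∈ S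
    · simpa only [h, h', if_true] using hc2 u h v h' huv
    · simpa only [h, h', if_true, if_false] using hLout u h v h' huv
    · simpa only [h, h', if_true, if_false] using (hLout v h' u h huv.symm).symm
    · simpa only [h, h', if_false] using c0.valid (show H.Adj u v from ⟨huv, h, h'⟩)
  have := SimpleGraph.chromaticNumber_le_iff_colorable.2 hcol
  rw [hχ] at this
  have : k ≤ k - 1 := by exact_mod_cast this
  omega
end

section
/- Let G be a k-critical graph (k ≥ 4), and let A, B be disjoint vertex subsets such that at least one of A, B is independent, every vertex of A has degree k−1 in G, every vertex of B has degree k in G, and |A|+|B| ≥ 3. Then the number of edges of G between A and B is at most 2(|A|+|B|) − 4. -/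
lemma kernel_color {V C : Type*} [DecidableEq V] [DecidableEq C] [Nonempty C] (G : SimpleGraph V)
    (D : V → V → Prop) [DecidableRel D] (P : Finset V)
    (hker : ∀ S ⊆ P, ∃ K ⊆ S, (∀ u ∈ K, ∀ v ∈ K, ¬ G.Adj u v) ∧
      ∀ v ∈ S, v ∉ K → ∃ u ∈ K, D v u) :
    ∀ (n : ℕ) (W : Finset V) (_ : W.card ≤ n) (_ : W ⊆ P) (L : V → Finset C),
      (∀ v ∈ W, (W.filter (fun u => D v u)).card < (L v).card) →
      ∃ c : V → C, (∀ v ∈ W, c v ∈ L v) ∧ ∀ u ∈ W, ∀ v ∈ W, G.Adj u v → c u ≠ c v := by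
  intro n
  induction n with
  | zero =>
    intro W hW hWP L hL
    have : W = ∅ := by simpa using hW
    subst this
    exact ⟨fun _ => Classical.arbitrary C, by simp, by simp⟩
  | succ n ih =>
    intro W hW hWP L hL
    rcases W.eq_empty_or_nonempty with rfl | ⟨v0, hv0⟩
    · exact ⟨fun _ => Classical.arbitrary C, by simp, by simp⟩
    obtain ⟨x, hx⟩ : (L v0).Nonempty := by
      rw [← Finset.card_pos]; exact lt_of_le_of_lt (Nat.zero_le _) (hL v0 hv0)
    obtain ⟨K, hKS, hKi, hKa⟩ := hker (W.filter (fun v => x ∈ L v))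
      ((Finset.filter_subset _ _).trans hWP)
    have hKW : K ⊆ W := hKS.trans (Finset.filter_subset _ _)
    have hKx : ∀ v ∈ K, x ∈ L v := fun v hv => (Finset.mem_filter.1 (hKS hv)).2
    have hKne : K.Nonempty := by
      by_cases h : v0 ∈ K
      · exact ⟨_, h⟩
      · obtain ⟨u, hu, _⟩ := hKa v0 (Finset.mem_filter.2 ⟨hv0, hx⟩) h
        exact ⟨u, hu⟩
    have hcard : (W \ K).card ≤ n := by
      rw [Finset.card_sdiff_of_subset hKW]
      have := hKne.card_pos
      omega
    obtain ⟨c, hc1, hc2⟩ := ih (W \ K) hcard (Finset.sdiff_subset.trans hWP)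
      (fun v => (L v).erase x) (by
        intro v hv
        obtain ⟨hvW, hvK⟩ := Finset.mem_sdiff.1 hv
        have h1 := hL v hvW
        by_cases hxv : x ∈ L v
        · obtain ⟨u, hu, hD⟩ := hKa v (Finset.mem_filter.2 ⟨hvW, hxv⟩) hvK
          have h2 : ((W \ K).filter (fun u => D v u)).card < (W.filter (fun u => D v u)).card := by
            apply Finset.card_lt_card
            rw [Finset.ssubset_iff_of_subset]
            · exact ⟨u, Finset.mem_filter.2 ⟨hKW hu, hD⟩, by simp [hu]⟩
            · exact Finset.filter_subset_filter _ Finset.sdiff_subset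
          rw [Finset.card_erase_of_mem hxv]
          omega
        · rw [Finset.erase_eq_of_notMem hxv]
          exact lt_of_le_of_lt (Finset.card_le_card
            (Finset.filter_subset_filter _ Finset.sdiff_subset)) h1)
    refine ⟨fun v => if v ∈ K then x else c v, ?_, ?_⟩
    · intro v hv
      by_cases h : v ∈ K
      · simpa [h] using hKx v h
      · simpa [h] using Finset.mem_of_mem_erase (hc1 v (Finset.mem_sdiff.2 ⟨hv, h⟩))
    · intro u hu v hv huv
      by_cases h : u ∈ K <;> by_cases h' : v ∈ K
      · exact absurd huv (hKi u h v h')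
      · simpa [h, h'] using (Finset.ne_of_mem_erase (hc1 v (Finset.mem_sdiff.2 ⟨hv, h'⟩))).symm
      · simpa [h, h'] using (Finset.ne_of_mem_erase (hc1 u (Finset.mem_sdiff.2 ⟨hu, h⟩)))
      · simpa [h, h'] using hc2 u (Finset.mem_sdiff.2 ⟨hu, h⟩) v (Finset.mem_sdiff.2 ⟨hv, h'⟩) huv

/-- Kernel perfectness: `I` independent, arcs bidirected outside `I`. -/
lemma kernel_exists {V : Type*} [DecidableEq V] (G : SimpleGraph V)
    (D : V → V → Prop) (I J : Finset V)
    (hI : ∀ u ∈ I, ∀ v ∈ I, ¬ G.Adj u v)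
    (hJ : ∀ u ∈ J, ∀ v ∈ J, G.Adj u v → D u v)
    (hIJ : ∀ u ∈ I, ∀ v ∈ J, G.Adj u v → D u v ∨ D v u) :
    ∀ (n : ℕ) (S : Finset V) (_ : S.card ≤ n) (_ : S ⊆ I ∪ J),
      ∃ K ⊆ S, (∀ u ∈ K, ∀ v ∈ K, ¬ G.Adj u v) ∧ ∀ v ∈ S, v ∉ K → ∃ u ∈ K, D v u := by
  classical
  intro n
  induction n with
  | zero =>
    intro S hS _
    have : S = ∅ := by simpa using hS
    subst this
    exact ⟨∅, by simp, by simp, by simp⟩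
  | succ n ih =>
    intro S hS hSP
    by_cases h : ∃ v ∈ S, v ∈ J ∧ v ∉ I ∧ ∀ u ∈ S, u ∈ I → ¬ D v u
    · obtain ⟨v, hvS, hvJ, hvI, hv⟩ := h
      have hin : ∀ u ∈ S, G.Adj u v → D u v := by
        intro u hu huv
        rcases Finset.mem_union.1 (hSP hu) with h1 | h1
        · exact (hIJ u h1 v hvJ huv).resolve_right (hv u hu h1)
        · exact hJ u h1 v hvJ huv
      obtain ⟨K, hKS, hKi, hKa⟩ := ih (S.filter (fun u => u ≠ v ∧ ¬ G.Adj u v)) (by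
          have : (S.filter (fun u => u ≠ v ∧ ¬ G.Adj u v)).card < S.card :=
            Finset.card_lt_card (Finset.filter_ssubset.2 ⟨v, hvS, by simp⟩)
          omega) ((Finset.filter_subset _ _).trans hSP)
      have hK : ∀ u ∈ K, u ∈ S ∧ u ≠ v ∧ ¬ G.Adj u v := fun u hu => by
        simpa using hKS hu
      refine ⟨insert v K, ?_, ?_, ?_⟩
      · intro u hu
        rcases Finset.mem_insert.1 hu with rfl | hu
        · exact hvS
        · exact (hK u hu).1
      · intro u hu w hw huw
        rcases Finset.mem_insert.1 hu with h1 | h1 <;> rcases Finset.mem_insert.1 hw with h2 | h2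
        · rw [h1, h2] at huw; exact G.irrefl huw
        · rw [h1] at huw; exact (hK w h2).2.2 huw.symm
        · rw [h2] at huw; exact (hK u h1).2.2 huw
        · exact hKi u h1 w h2 huw
      · intro u hu huK
        simp only [Finset.mem_insert, not_or] at huK
        by_cases ha : G.Adj u v
        · exact ⟨v, Finset.mem_insert_self _ _, hin u hu ha⟩
        · obtain ⟨w, hw, hD⟩ := hKa u (by simp [hu, huK.1, ha]) huK.2
          exact ⟨w, Finset.mem_insert_of_mem hw, hD⟩
    · push Not at h
      refine ⟨S.filter (· ∈ I), Finset.filter_subset _ _, ?_, ?_⟩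
      · intro u hu v hv
        exact hI u (Finset.mem_filter.1 hu).2 v (Finset.mem_filter.1 hv).2
      · intro v hv hvn
        have hvI : v ∉ I := fun h' => hvn (Finset.mem_filter.2 ⟨hv, h'⟩)
        have hvJ : v ∈ J := (Finset.mem_union.1 (hSP hv)).resolve_left hvI
        obtain ⟨u, hu, huI, hD⟩ := h v hv hvJ hvI
        exact ⟨u, Finset.mem_filter.2 ⟨hu, huI⟩, hD⟩

/-- Orientation from Hall. -/
lemma orient {V : Type*} [DecidableEq V] (E : Finset (V × V)) (A B : Finset V)
    (hall : ∀ Sa ⊆ A, ∀ Sb ⊆ B, Sa.card + 2 * Sb.card ≤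
      (E.filter (fun p => p.1 ∈ Sa ∨ p.2 ∈ Sb)).card) :
    ∃ M : V → V → Prop, (∀ a ∈ A, ∃ b, (a, b) ∈ E ∧ M a b) ∧
      (∀ b ∈ B, ∃ a a', a ≠ a' ∧ (a, b) ∈ E ∧ (a', b) ∈ E ∧ ¬ M a b ∧ ¬ M a' b) := by
  classical
  let X : Finset (V ⊕ V × Bool) := A.disjSum (B ×ˢ Finset.univ)
  let t : V ⊕ V × Bool → Finset (V × V) :=
    Sum.elim (fun a => E.filter (fun p => p.1 = a)) (fun b => E.filter (fun p => p.2 = b.1))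
  have key := (Finset.all_card_le_biUnion_card_iff_exists_injective (fun i : X => t i.1)).1 (by
    intro T
    let Sa := A.filter (fun a => Sum.inl a ∈ T.map ⟨Subtype.val, Subtype.val_injective⟩)
    let Sb := B.filter (fun b => ∃ i, Sum.inr (b, i) ∈ T.map ⟨Subtype.val, Subtype.val_injective⟩)
    have h1 : T.card ≤ Sa.card + 2 * Sb.card := by
      have : T.map ⟨Subtype.val, Subtype.val_injective⟩ ⊆ Sa.disjSum (Sb ×ˢ Finset.univ) := by
        intro s hs
        obtain ⟨⟨s', hX⟩, hT, rfl⟩ := Finset.mem_map.1 hs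
        rcases s' with a | ⟨b, i⟩
        · have ha : a ∈ A := by simpa [X] using hX
          exact Finset.inl_mem_disjSum.2 (Finset.mem_filter.2 ⟨ha, hs⟩)
        · have hb : b ∈ B := by simpa [X] using hX
          exact Finset.inr_mem_disjSum.2 (Finset.mem_product.2
            ⟨Finset.mem_filter.2 ⟨hb, i, hs⟩, Finset.mem_univ _⟩)
      have h := Finset.card_le_card this
      rw [Finset.card_map, Finset.card_disjSum, Finset.card_product] at h
      simp only [Finset.card_univ, Fintype.card_bool] at h
      omega
    refine h1.trans ((hall Sa (Finset.filter_subset _ _) Sb (Finset.filter_subset _ _)).trans ?_)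
    apply Finset.card_le_card
    intro p hp
    obtain ⟨hpE, hp⟩ := Finset.mem_filter.1 hp
    rw [Finset.mem_biUnion]
    rcases hp with hp | hp
    · obtain ⟨s, hs, hse⟩ := Finset.mem_map.1 (Finset.mem_filter.1 hp).2
      refine ⟨s, hs, ?_⟩
      have : s.1 = Sum.inl p.1 := hse
      rw [this]
      simp [t, hpE]
    · obtain ⟨i, hi⟩ := (Finset.mem_filter.1 hp).2
      obtain ⟨s, hs, hse⟩ := Finset.mem_map.1 hi
      refine ⟨s, hs, ?_⟩
      have : s.1 = Sum.inr (p.2, i) := hse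
      rw [this]
      simp [t, hpE])
  obtain ⟨f, hf, hft⟩ := key
  refine ⟨fun a b => ∃ (h : Sum.inl a ∈ X), f ⟨Sum.inl a, h⟩ = (a, b), ?_, ?_⟩
  · intro a ha
    have hX : Sum.inl a ∈ X := Finset.inl_mem_disjSum.2 ha
    have h := hft ⟨_, hX⟩
    simp only [t, Sum.elim_inl, Finset.mem_filter] at h
    refine ⟨(f ⟨_, hX⟩).2, ?_, hX, ?_⟩
    · have h2 : (a, (f ⟨_, hX⟩).2) = f ⟨_, hX⟩ := Prod.ext h.2.symm rfl
      rw [h2]; exact h.1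
    · exact Prod.ext h.2 rfl
  · intro b hb
    have hX : ∀ i, Sum.inr (b, i) ∈ X := fun i =>
      Finset.inr_mem_disjSum.2 (Finset.mem_product.2 ⟨hb, Finset.mem_univ _⟩)
    have h : ∀ i, f ⟨_, hX i⟩ ∈ E ∧ (f ⟨_, hX i⟩).2 = b := fun i => by
      have h := hft ⟨_, hX i⟩
      simpa only [t, Sum.elim_inr, Finset.mem_filter] using h
    have h2 : ∀ i, ((f ⟨_, hX i⟩).1, b) = f ⟨_, hX i⟩ := fun i => Prod.ext rfl (h i).2.symm
    have h3 : ∀ i, ¬ ∃ (h : Sum.inl (f ⟨_, hX i⟩).1 ∈ X),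
        f ⟨Sum.inl (f ⟨_, hX i⟩).1, h⟩ = ((f ⟨_, hX i⟩).1, b) := by
      rintro i ⟨h, he⟩
      rw [h2] at he
      have := congrArg Subtype.val (hf he)
      simp at this
    refine ⟨(f ⟨_, hX true⟩).1, (f ⟨_, hX false⟩).1, ?_, ?_, ?_, h3 _, h3 _⟩
    · intro he
      have : f ⟨_, hX true⟩ = f ⟨_, hX false⟩ := by rw [← h2 true, ← h2 false, he]
      have := congrArg Subtype.val (hf this)
      simp at this
    · rw [h2]; exact (h _).1
    · rw [h2]; exact (h _).1

/-- No such orientation in a critical graph. -/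
lemma no_orient {V : Type*} [Fintype V] [DecidableEq V]
    (G : SimpleGraph V) [DecidableRel G.Adj] (k : ℕ) (hk : 4 ≤ k)
    (hcrit : IsCritical G k) (A B : Finset V) (hdisj : Disjoint A B)
    (hind : (∀ u ∈ A, ∀ v ∈ A, ¬ G.Adj u v) ∨ (∀ u ∈ B, ∀ v ∈ B, ¬ G.Adj u v))
    (hA : ∀ a ∈ A, G.degree a = k - 1) (hB : ∀ b ∈ B, G.degree b = k)
    (hne : A.Nonempty) (M : V → V → Prop)
    (hMA : ∀ a ∈ A, ∃ b ∈ B, G.Adj a b ∧ M a b)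
    (hMB : ∀ b ∈ B, ∃ a ∈ A, ∃ a' ∈ A, a ≠ a' ∧ G.Adj a b ∧ G.Adj a' b ∧ ¬ M a b ∧ ¬ M a' b) :
    False := by
  classical
  have hAB : ∀ v, v ∈ A → v ∉ B := fun v h h' => Finset.disjoint_left.1 hdisj h h'
  -- colour the rest
  let H : SimpleGraph V :=
    { Adj := fun u v => G.Adj u v ∧ u ∉ A ∪ B ∧ v ∉ A ∪ B
      symm := ⟨fun u v h => ⟨h.1.symm, h.2.2, h.2.1⟩⟩
      loopless := ⟨fun u h => G.irrefl h.1⟩ }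
  have hHG : H ≤ G := fun u v h => h.1
  have hHne : H ≠ G := by
    intro he
    obtain ⟨a, ha⟩ := hne
    obtain ⟨b, hb, hab, _⟩ := hMA a ha
    rw [← he] at hab
    exact hab.2.1 (Finset.mem_union_left _ ha)
  have hcol : H.Colorable (k - 1) := SimpleGraph.chromaticNumber_le_iff_colorable.1 (hcrit.2 H hHG hHne)
  obtain ⟨col⟩ := hcol
  have : Nonempty (Fin (k - 1)) := ⟨⟨0, by omega⟩⟩
  let D : V → V → Prop := fun u v => G.Adj u v ∧
    (u ∈ A → v ∈ B → ¬ M u v) ∧ (u ∈ B → v ∈ A → M v u)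
  let P := A ∪ B
  have hker : ∀ S ⊆ P, ∃ K ⊆ S, (∀ u ∈ K, ∀ v ∈ K, ¬ G.Adj u v) ∧
      ∀ v ∈ S, v ∉ K → ∃ u ∈ K, D v u := by
    intro S hS
    have hAA : ∀ u ∈ A, ∀ v ∈ A, G.Adj u v → D u v := fun u hu v hv h =>
      ⟨h, fun _ h' => absurd h' (hAB v hv), fun h' => absurd h' (hAB u hu)⟩
    have hBB : ∀ u ∈ B, ∀ v ∈ B, G.Adj u v → D u v := fun u hu v hv h =>
      ⟨h, fun h' => absurd hu (hAB u h'), fun _ h' => absurd hv (hAB v h')⟩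
    have hABD : ∀ u ∈ A, ∀ v ∈ B, G.Adj u v → D u v ∨ D v u := fun u hu v hv h => by
      by_cases hM : M u v
      · right
        exact ⟨h.symm, fun h' => absurd hv (hAB v h'), fun _ _ => hM⟩
      · left
        exact ⟨h, fun _ _ => hM, fun h' => absurd h' (hAB u hu)⟩
    rcases hind with hi | hi
    · exact kernel_exists G D A B hi hBB hABD _ S le_rfl hS
    · exact kernel_exists G D B A hi hAA (fun u hu v hv h => (hABD v hv u hu h.symm).symm) _ S le_rfl
        (by rw [Finset.union_comm]; exact hS)
  let L : V → Finset (Fin (k - 1)) := fun v =>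
    Finset.univ \ ((G.neighborFinset v).filter (· ∉ P)).image col
  have hL : ∀ v, k - 1 + ((G.neighborFinset v).filter (· ∈ P)).card ≤ (L v).card + G.degree v := by
    intro v
    have h1 : (L v).card = (k - 1) - (((G.neighborFinset v).filter (· ∉ P)).image col).card := by
      simp only [L]
      rw [Finset.card_sdiff_of_subset (Finset.subset_univ _), Finset.card_univ, Fintype.card_fin]
    have h2 : (((G.neighborFinset v).filter (· ∉ P)).image col).card ≤
      ((G.neighborFinset v).filter (· ∉ P)).card := Finset.card_image_le
    have h3 := Finset.card_filter_add_card_filter_not (s := G.neighborFinset v) (· ∈ P)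
    rw [G.card_neighborFinset_eq_degree] at h3
    omega
  have hsub : ∀ v, P.filter (fun u => D v u) ⊆ (G.neighborFinset v).filter (· ∈ P) := by
    intro v u hu
    obtain ⟨h1, h2⟩ := Finset.mem_filter.1 hu
    exact Finset.mem_filter.2 ⟨by simpa using h2.1, h1⟩
  obtain ⟨c, hc1, hc2⟩ := kernel_color G D P hker _ P le_rfl subset_rfl L (by
    intro v hv
    have h0 := hL v
    rcases Finset.mem_union.1 hv with hvA | hvB
    · obtain ⟨b, hb, hab, hM⟩ := hMA v hvA
      have h1 : insert b (P.filter (fun u => D v u)) ⊆ (G.neighborFinset v).filter (· ∈ P) := by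
        refine Finset.insert_subset ?_ (hsub v)
        exact Finset.mem_filter.2 ⟨by simpa using hab, Finset.mem_union_right _ hb⟩
      have h2 := Finset.card_le_card h1
      rw [Finset.card_insert_of_notMem (fun h => (Finset.mem_filter.1 h).2.2.1 hvA hb hM)] at h2
      have := hA v hvA
      omega
    · obtain ⟨a, ha, a', ha', hne', hab, hab', hM, hM'⟩ := hMB v hvB
      have h1 : insert a (insert a' (P.filter (fun u => D v u))) ⊆
          (G.neighborFinset v).filter (· ∈ P) := by
        refine Finset.insert_subset ?_ (Finset.insert_subset ?_ (hsub v))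
        · exact Finset.mem_filter.2 ⟨by simpa using hab.symm, Finset.mem_union_left _ ha⟩
        · exact Finset.mem_filter.2 ⟨by simpa using hab'.symm, Finset.mem_union_left _ ha'⟩
      have h2 := Finset.card_le_card h1
      rw [Finset.card_insert_of_notMem, Finset.card_insert_of_notMem] at h2
      · have := hB v hvB
        omega
      · exact fun h => hM' ((Finset.mem_filter.1 h).2.2.2 hvB ha')
      · intro h
        rcases Finset.mem_insert.1 h with h | h
        · exact hne' h
        · exact hM ((Finset.mem_filter.1 h).2.2.2 hvB ha))
  have hcross : ∀ u ∈ P, ∀ v, v ∉ P → G.Adj u v → c u ≠ col v := by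
    intro u hu v hv huv he
    have := hc1 u hu
    simp only [L, Finset.mem_sdiff, Finset.mem_image, not_exists] at this
    exact this.2 v ⟨Finset.mem_filter.2 ⟨by simpa using huv, hv⟩, he.symm⟩
  have hfin : G.Colorable (k - 1) := ⟨SimpleGraph.Coloring.mk
    (fun v => if v ∈ P then c v else col v) (by
      intro u v huv
      by_cases hu : u ∈ P <;> by_cases hv : v ∈ P
      · simpa [hu, hv] using hc2 u hu v hv huv
      · simpa [hu, hv] using hcross u hu v hv huv
      · simpa [hu, hv] using (hcross v hv u hu huv.symm).symm
      · simpa [hu, hv] using col.valid (show H.Adj u v from ⟨huv, hu, hv⟩))⟩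
  have h1 := SimpleGraph.chromaticNumber_le_iff_colorable.2 hfin
  rw [hcrit.1] at h1
  have h2 : k ≤ k - 1 := by exact_mod_cast h1
  omega

lemma edge_bound_aux {V : Type*} [Fintype V] [DecidableEq V]
    (G : SimpleGraph V) [DecidableRel G.Adj] (k : ℕ) (hk : 4 ≤ k)
    (hcrit : IsCritical G k) : ∀ (n : ℕ) (A B : Finset V) (_ : A.card + B.card ≤ n)
    (_ : Disjoint A B)
    (_ : (∀ u ∈ A, ∀ v ∈ A, ¬ G.Adj u v) ∨ (∀ u ∈ B, ∀ v ∈ B, ¬ G.Adj u v))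
    (_ : ∀ a ∈ A, G.degree a = k - 1) (_ : ∀ b ∈ B, G.degree b = k)
    (_ : 3 ≤ A.card + B.card),
    ((A ×ˢ B).filter (fun p => G.Adj p.1 p.2)).card + 4 ≤ 2 * (A.card + B.card) := by
  intro n
  induction n with
  | zero => intro A B h1 _ _ _ _ h2; omega
  | succ n ih =>
    intro A B hn hdisj hind hA hB hcard
    by_contra hcon
    push Not at hcon
    have hle : ∀ A B : Finset V, ((A ×ˢ B).filter (fun p => G.Adj p.1 p.2)).card ≤
        A.card * B.card := fun A B => by
      rw [← Finset.card_product]; exact Finset.card_filter_le _ _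
    have hA3 : 3 ≤ A.card := by
      by_contra hlt
      have h := hle A B
      have : A.card = 0 ∨ A.card = 1 ∨ A.card = 2 := by omega
      rcases this with h' | h' | h' <;> rw [h'] at h hcon hcard <;> omega
    obtain ⟨M, hMA, hMB⟩ := orient ((A ×ˢ B).filter (fun p => G.Adj p.1 p.2)) A B (by
      intro Sa hSa Sb hSb
      have hsplit : ((A ×ˢ B).filter (fun p => G.Adj p.1 p.2)).card ≤
          (((A ×ˢ B).filter (fun p => G.Adj p.1 p.2)).filter
            (fun p => p.1 ∈ Sa ∨ p.2 ∈ Sb)).card +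
          (((A \ Sa) ×ˢ (B \ Sb)).filter (fun p => G.Adj p.1 p.2)).card := by
        rw [← Finset.card_filter_add_card_filter_not
          (s := (A ×ˢ B).filter (fun p => G.Adj p.1 p.2)) (fun p => p.1 ∈ Sa ∨ p.2 ∈ Sb)]
        gcongr
        intro p hp
        simp only [Finset.mem_filter, Finset.mem_product, Finset.mem_sdiff, not_or] at hp ⊢
        tauto
      have ca := Finset.card_sdiff_add_card_eq_card hSa
      have cb := Finset.card_sdiff_add_card_eq_card hSb
      by_cases h3 : 3 ≤ (A \ Sa).card + (B \ Sb).card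
      · by_cases h0 : Sa.card + Sb.card = 0
        · omega
        have := ih (A \ Sa) (B \ Sb) (by omega)
          (hdisj.mono Finset.sdiff_subset Finset.sdiff_subset)
          (hind.imp
            (fun h u hu v hv => h u (Finset.sdiff_subset hu) v (Finset.sdiff_subset hv))
            (fun h u hu v hv => h u (Finset.sdiff_subset hu) v (Finset.sdiff_subset hv)))
          (fun a ha => hA a (Finset.sdiff_subset ha)) (fun b hb => hB b (Finset.sdiff_subset hb)) h3
        omega
      · have h := hle (A \ Sa) (B \ Sb)
        have : (A \ Sa).card = 0 ∨ (A \ Sa).card = 1 ∨ (A \ Sa).card = 2 := by omega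
        rcases this with h' | h' | h' <;> rw [h'] at h h3 ca <;> omega)
    refine no_orient G k hk hcrit A B hdisj hind hA hB (Finset.card_pos.1 (by omega)) M ?_ ?_
    · intro a ha
      obtain ⟨b, hE, hM⟩ := hMA a ha
      simp only [Finset.mem_filter, Finset.mem_product] at hE
      exact ⟨b, hE.1.2, hE.2, hM⟩
    · intro b hb
      obtain ⟨a, a', hne, hE, hE', hM, hM'⟩ := hMB b hb
      simp only [Finset.mem_filter, Finset.mem_product] at hE hE'
      exact ⟨a, hE.1.1, a', hE'.1.1, hne, hE.2, hE'.2, hM, hM'⟩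

/-- In a `k`-critical graph (`k ≥ 4`), with `A`, `B` as before
and `|A| + |B| ≥ 3`, the number of edges between `A` and `B` is at most
`2(|A|+|B|) − 4`. -/
theorem bipartite_edge_bound_one {V : Type*} [Fintype V] [DecidableEq V]
    (G : SimpleGraph V) [DecidableRel G.Adj] (k : ℕ) (hk : 4 ≤ k)
    (hcrit : IsCritical G k) (A B : Finset V) (hdisj : Disjoint A B)
    (hind : (∀ u ∈ A, ∀ v ∈ A, ¬ G.Adj u v) ∨ (∀ u ∈ B, ∀ v ∈ B, ¬ G.Adj u v))
    (hA : ∀ a ∈ A, G.degree a = k - 1) (hB : ∀ b ∈ B, G.degree b = k)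
    (hcard : 3 ≤ A.card + B.card) :
    (∑ a ∈ A, (B.filter (fun b => G.Adj a b)).card) + 4 ≤
      2 * (A.card + B.card) := by
  have h := edge_bound_aux G k hk hcrit _ A B le_rfl hdisj hind hA hB hcard
  have he : ((A ×ˢ B).filter (fun p => G.Adj p.1 p.2)).card =
      ∑ a ∈ A, (B.filter (fun b => G.Adj a b)).card := by
    simp only [Finset.card_filter, Finset.sum_product]
  rw [← he]
  exact h
end

section
/- Let G be a k-critical graph (k ≥ 4), and let A, B be disjoint vertex subsets such that at least one of A, B is independent, every vertex of A has degree k−1 in G, every vertex of B has degree k in G, and |A|+|B| ≥ 3. Then the number of edges of G between A and B is at most |A| + 3|B| − 3. -/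
open Classical in
theorem aux_kernel {V : Type*} [Fintype V] (G : SimpleGraph V) (D : V → V → Prop)
    (I : Finset V) (hI : ∀ u ∈ I, ∀ v ∈ I, ¬ G.Adj u v)
    (hD : ∀ u v, G.Adj u v → D u v ∨ D v u) :
    ∀ (n : ℕ) (X : Finset V), X.card ≤ n →
    (∀ u ∈ X, ∀ v ∈ X, u ∉ I → v ∉ I → G.Adj u v → D u v) →
    ∃ K ⊆ X, (∀ u ∈ K, ∀ v ∈ K, ¬ G.Adj u v) ∧ ∀ x ∈ X, x ∉ K → ∃ y ∈ K, D x y := by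
  intro n
  induction n with
  | zero =>
    intro X hX _
    have : X = ∅ := by simpa using hX
    subst this
    exact ⟨∅, by simp, by simp, by simp⟩
  | succ n ih =>
    intro X hX hs
    by_cases h : ∀ q ∈ X, q ∉ I → ∃ y ∈ X, y ∈ I ∧ D q y
    · refine ⟨X.filter (· ∈ I), Finset.filter_subset _ _, ?_, ?_⟩
      · intro u hu v hv
        exact hI u (Finset.mem_filter.1 hu).2 v (Finset.mem_filter.1 hv).2
      · intro x hx hxK
        have hxI : x ∉ I := fun hi => hxK (Finset.mem_filter.2 ⟨hx, hi⟩)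
        obtain ⟨y, hy, hyI, hd⟩ := h x hx hxI
        exact ⟨y, Finset.mem_filter.2 ⟨hy, hyI⟩, hd⟩
    · push Not at h
      obtain ⟨q, hq, hqI, hno⟩ := h
      have hin : ∀ x ∈ X, G.Adj x q → D x q := by
        intro x hx hadj
        by_cases hxI : x ∈ I
        · rcases hD x q hadj with h | h
          · exact h
          · exact absurd h (hno x hx hxI)
        · exact hs x hx q hq hxI hqI hadj
      obtain ⟨K, hK, hKi, hKa⟩ := ih (X.filter (fun x => x ≠ q ∧ ¬ G.Adj x q)) (by
        have : X.filter (fun x => x ≠ q ∧ ¬ G.Adj x q) ⊂ X := by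
          refine Finset.filter_ssubset.2 ⟨q, hq, by simp⟩
        have := Finset.card_lt_card this
        omega) (by
        intro u hu v hv
        exact hs u (Finset.mem_filter.1 hu).1 v (Finset.mem_filter.1 hv).1)
      refine ⟨insert q K, ?_, ?_, ?_⟩
      · intro x hx
        rcases Finset.mem_insert.1 hx with rfl | hx
        · exact hq
        · exact (Finset.mem_filter.1 (hK hx)).1
      · intro u hu v hv
        rcases Finset.mem_insert.1 hu with rfl | hu1
        · rcases Finset.mem_insert.1 hv with rfl | hv
          · exact G.irrefl
          · exact fun h => (Finset.mem_filter.1 (hK hv)).2.2 h.symm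
        · rcases Finset.mem_insert.1 hv with rfl | hv1
          · exact (Finset.mem_filter.1 (hK hu1)).2.2
          · exact hKi u hu1 v hv1
      · intro x hx hxK
        rw [Finset.mem_insert, not_or] at hxK
        by_cases hadj : G.Adj x q
        · exact ⟨q, Finset.mem_insert_self _ _, hin x hx hadj⟩
        · obtain ⟨y, hy, hd⟩ := hKa x (Finset.mem_filter.2 ⟨hx, hxK.1, hadj⟩) hxK.2
          exact ⟨y, Finset.mem_insert_of_mem hy, hd⟩

open Classical in
theorem aux_list {V C : Type*} [Fintype V] [Inhabited C] (G : SimpleGraph V) (D : V → V → Prop)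
    (S : Finset V)
    (hker : ∀ X ⊆ S, ∃ K ⊆ X, (∀ u ∈ K, ∀ v ∈ K, ¬ G.Adj u v) ∧
      ∀ x ∈ X, x ∉ K → ∃ y ∈ K, D x y) :
    ∀ (n : ℕ) (W : Finset V), W.card ≤ n → W ⊆ S → ∀ L : V → Finset C,
      (∀ v ∈ W, (W.filter (fun w => D v w)).card < (L v).card) →
      ∃ c : V → C, (∀ v ∈ W, c v ∈ L v) ∧ ∀ u ∈ W, ∀ v ∈ W, G.Adj u v → c u ≠ c v := by
  intro n
  induction n with
  | zero =>
    intro W hW _ L _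
    have : W = ∅ := by simpa using hW
    subst this
    exact ⟨fun _ => default, by simp, by simp⟩
  | succ n ih =>
    intro W hW hWS L hL
    rcases W.eq_empty_or_nonempty with rfl | ⟨v, hv⟩
    · exact ⟨fun _ => default, by simp, by simp⟩
    have hpos : 0 < (L v).card := lt_of_le_of_lt (Nat.zero_le _) (hL v hv)
    obtain ⟨α, hα⟩ := Finset.card_pos.1 hpos
    obtain ⟨K, hKX, hKi, hKa⟩ := hker (W.filter (fun w => α ∈ L w))
      ((Finset.filter_subset _ _).trans hWS)
    have hKW : K ⊆ W := hKX.trans (Finset.filter_subset _ _)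
    have hKne : K.Nonempty := by
      by_cases hvK : v ∈ K
      · exact ⟨v, hvK⟩
      · obtain ⟨y, hy, _⟩ := hKa v (Finset.mem_filter.2 ⟨hv, hα⟩) hvK
        exact ⟨y, hy⟩
    obtain ⟨c, hc1, hc2⟩ := ih (W \ K) (by
        have := Finset.card_sdiff_add_card_eq_card hKW
        have := Finset.card_pos.2 hKne
        omega) (Finset.sdiff_subset.trans hWS) (fun w => (L w).erase α) (by
        intro w hw
        rw [Finset.mem_sdiff] at hw
        have h1 := hL w hw.1
        by_cases hwα : α ∈ L w
        · obtain ⟨y, hy, hd⟩ := hKa w (Finset.mem_filter.2 ⟨hw.1, hwα⟩) hw.2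
          have h2 : (W \ K).filter (fun x => D w x) ⊂ W.filter (fun x => D w x) := by
            refine (Finset.ssubset_iff_of_subset
              (Finset.filter_subset_filter _ Finset.sdiff_subset)).2
              ⟨y, Finset.mem_filter.2 ⟨hKW hy, hd⟩, ?_⟩
            simp [hy]
          have h3 := Finset.card_lt_card h2
          have h4 := Finset.card_erase_of_mem hwα
          omega
        · have h2 := Finset.card_le_card
            (Finset.filter_subset_filter (fun x => D w x) (Finset.sdiff_subset (s := W) (t := K)))
          rw [Finset.erase_eq_of_notMem hwα]
          omega)
    refine ⟨fun w => if w ∈ K then α else c w, ?_, ?_⟩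
    · intro w hw
      by_cases hwK : w ∈ K
      · simpa [hwK] using (Finset.mem_filter.1 (hKX hwK)).2
      · simpa [hwK] using (Finset.mem_erase.1 (hc1 w (Finset.mem_sdiff.2 ⟨hw, hwK⟩))).2
    · intro u hu w hw hadj
      by_cases huK : u ∈ K <;> by_cases hwK : w ∈ K
      · exact absurd hadj (hKi u huK w hwK)
      · simpa [huK, hwK] using
          (Finset.mem_erase.1 (hc1 w (Finset.mem_sdiff.2 ⟨hw, hwK⟩))).1.symm
      · simpa [huK, hwK] using
          (Finset.mem_erase.1 (hc1 u (Finset.mem_sdiff.2 ⟨hu, huK⟩))).1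
      · simpa [huK, hwK] using hc2 u (Finset.mem_sdiff.2 ⟨hu, huK⟩) w
          (Finset.mem_sdiff.2 ⟨hw, hwK⟩) hadj

open Classical in
theorem aux_hall {V : Type*} [Fintype V] (G : SimpleGraph V) (A B : Finset V)
    (hmin : ∀ A' ⊆ A, ∀ B' ⊆ B, A'.card + B'.card < A.card + B.card →
      ((A' ×ˢ B').filter (fun p => G.Adj p.1 p.2)).card ≤ A'.card + 2 * B'.card)
    (hE : A.card + 2 * B.card ≤ ((A ×ˢ B).filter (fun p => G.Adj p.1 p.2)).card) :
    ∃ f : {p : V × Bool // p.1 ∈ A ∧ p.2 = false ∨ p.1 ∈ B} → V × V,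
      Function.Injective f ∧ ∀ p, f p ∈ ((A ×ˢ B).filter (fun p => G.Adj p.1 p.2)).filter
        (fun e => e.1 = p.1.1 ∨ e.2 = p.1.1) := by
  refine (Finset.all_card_le_biUnion_card_iff_exists_injective _).1 ?_
  intro s
  rcases s.eq_empty_or_nonempty with rfl | ⟨p0, hp0⟩
  · simp
  set A1 := A.filter (fun a => ∃ p ∈ s, p.1.1 = a) with hA1
  set B1 := B.filter (fun a => ∃ p ∈ s, p.1.1 = a) with hB1
  have h1 : s.card ≤ A1.card + 2 * B1.card := by
    have : s.card ≤ (A1 ×ˢ {false} ∪ B1 ×ˢ (Finset.univ : Finset Bool)).card := by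
      refine Finset.card_le_card_of_injOn (fun p => p.1) ?_ (Subtype.val_injective.injOn)
      intro p hp
      simp only [Finset.coe_union, Finset.coe_product, Set.mem_union, Set.mem_prod]
      rcases p.2 with h | h
      · left
        exact ⟨Finset.mem_coe.2 (Finset.mem_filter.2 ⟨h.1, p, hp, rfl⟩), by simp [h.2]⟩
      · right
        exact ⟨Finset.mem_coe.2 (Finset.mem_filter.2 ⟨h, p, hp, rfl⟩), by simp⟩
    refine this.trans ((Finset.card_union_le _ _).trans ?_)
    simp [Finset.card_product]
    omega
  have hA1s : A1 ⊆ A := Finset.filter_subset _ _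
  have hB1s : B1 ⊆ B := Finset.filter_subset _ _
  have ca := Finset.card_sdiff_add_card_eq_card hA1s
  have cb := Finset.card_sdiff_add_card_eq_card hB1s
  have hpos : 0 < A1.card + B1.card := by
    rcases p0.2 with h | h
    · have : 0 < A1.card := Finset.card_pos.2 ⟨_, Finset.mem_filter.2 ⟨h.1, p0, hp0, rfl⟩⟩
      omega
    · have : 0 < B1.card := Finset.card_pos.2 ⟨_, Finset.mem_filter.2 ⟨h, p0, hp0, rfl⟩⟩
      omega
  have h2 := hmin (A \ A1) Finset.sdiff_subset (B \ B1) Finset.sdiff_subset (by omega)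
  set U := s.biUnion fun p => ((A ×ˢ B).filter (fun p => G.Adj p.1 p.2)).filter
        (fun e => e.1 = p.1.1 ∨ e.2 = p.1.1) with hU
  have h3 : (A ×ˢ B).filter (fun p => G.Adj p.1 p.2) ⊆
      U ∪ ((A \ A1) ×ˢ (B \ B1)).filter (fun p => G.Adj p.1 p.2) := by
    rintro ⟨a, b⟩ hab
    have hab' := hab
    rw [Finset.mem_filter, Finset.mem_product] at hab'
    obtain ⟨⟨ha, hb⟩, hadj⟩ := hab'
    rw [Finset.mem_union]
    by_cases hx : ∃ p ∈ s, p.1.1 = a ∨ p.1.1 = b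
    · left
      obtain ⟨p, hp, hpe⟩ := hx
      refine Finset.mem_biUnion.2 ⟨p, hp, Finset.mem_filter.2 ⟨hab, ?_⟩⟩
      exact hpe.imp Eq.symm Eq.symm
    · right
      push Not at hx
      refine Finset.mem_filter.2 ⟨Finset.mem_product.2 ⟨Finset.mem_sdiff.2 ⟨ha, ?_⟩,
        Finset.mem_sdiff.2 ⟨hb, ?_⟩⟩, hadj⟩
      · intro h
        obtain ⟨p, hp, hpe⟩ := (Finset.mem_filter.1 h).2
        exact (hx p hp).1 hpe
      · intro h
        obtain ⟨p, hp, hpe⟩ := (Finset.mem_filter.1 h).2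
        exact (hx p hp).2 hpe
  have h4 := (Finset.card_le_card h3).trans (Finset.card_union_le _ _)
  omega

open Classical in
theorem aux_orient {V : Type*} [Fintype V] (G : SimpleGraph V) (A B : Finset V)
    (hdisj : Disjoint A B)
    (f : {p : V × Bool // p.1 ∈ A ∧ p.2 = false ∨ p.1 ∈ B} → V × V)
    (hinj : Function.Injective f)
    (hf : ∀ p, f p ∈ ((A ×ˢ B).filter (fun p => G.Adj p.1 p.2)).filter
        (fun e => e.1 = p.1.1 ∨ e.2 = p.1.1)) :
    ∃ D : V → V → Prop, (∀ u v, G.Adj u v → D u v ∨ D v u) ∧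
      (∀ u v, u ∈ A → v ∈ A → G.Adj u v → D u v) ∧
      (∀ u v, u ∈ B → v ∈ B → G.Adj u v → D u v) ∧
      (∀ a ∈ A, ((A ∪ B).filter (fun w => D a w)).card + 1 ≤
        ((A ∪ B).filter (fun w => G.Adj a w)).card) ∧
      (∀ b ∈ B, ((A ∪ B).filter (fun w => D b w)).card + 2 ≤
        ((A ∪ B).filter (fun w => G.Adj b w)).card) := by
  have hAB : ∀ x, x ∈ A → x ∈ B → False := fun x ha hb => Finset.disjoint_left.1 hdisj ha hb
  have hf' : ∀ p, (f p).1 ∈ A ∧ (f p).2 ∈ B ∧ G.Adj (f p).1 (f p).2 ∧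
      ((f p).1 = p.1.1 ∨ (f p).2 = p.1.1) := by
    intro p
    have := hf p
    simp only [Finset.mem_filter, Finset.mem_product] at this
    tauto
  let T : V → V → Prop := fun u v => ∃ p, p.1.1 = u ∧ (f p = (u, v) ∨ f p = (v, u))
  have key : ∀ u (N : Finset V), (∀ w ∈ N, w ∈ A ∪ B ∧ G.Adj u w ∧ T u w) →
      ((A ∪ B).filter (fun w => G.Adj u w ∧ ¬ T u w)).card + N.card ≤
        ((A ∪ B).filter (fun w => G.Adj u w)).card := by
    intro u N hN
    rw [← Finset.card_union_of_disjoint]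
    · refine Finset.card_le_card ?_
      intro w hw
      rcases Finset.mem_union.1 hw with h | h
      · rw [Finset.mem_filter] at h ⊢
        exact ⟨h.1, h.2.1⟩
      · exact Finset.mem_filter.2 ⟨(hN w h).1, (hN w h).2.1⟩
    · rw [Finset.disjoint_left]
      intro w hw hwN
      exact (Finset.mem_filter.1 hw).2.2 (hN w hwN).2.2
  refine ⟨fun u v => G.Adj u v ∧ ¬ T u v, ?_, ?_, ?_, ?_, ?_⟩
  · intro u v hadj
    by_contra hcon
    have h1 : T u v := by
      by_contra h; exact hcon (Or.inl ⟨hadj, h⟩)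
    have h2 : T v u := by
      by_contra h; exact hcon (Or.inr ⟨hadj.symm, h⟩)
    obtain ⟨p, hp, hfp⟩ := h1
    obtain ⟨q, hq, hfq⟩ := h2
    have hp' := hf' p
    have hq' := hf' q
    have : f p = f q := by
      rcases hfp with h | h <;> rcases hfq with h' | h' <;> rw [h] at hp' <;>
        rw [h'] at hq' <;> rw [h, h']
      · exact (hAB _ hp'.1 hq'.2.1).elim
      · exact (hAB _ hp'.1 hq'.2.1).elim
    have := hinj this
    subst this
    exact hadj.ne (hp.symm.trans hq)
  · intro u v hu hv hadj
    refine ⟨hadj, ?_⟩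
    rintro ⟨p, _, h | h⟩
    · have := hf' p; rw [h] at this; exact hAB _ hv this.2.1
    · have := hf' p; rw [h] at this; exact hAB _ hu this.2.1
  · intro u v hu hv hadj
    refine ⟨hadj, ?_⟩
    rintro ⟨p, _, h | h⟩
    · have := hf' p; rw [h] at this; exact hAB _ this.1 hu
    · have := hf' p; rw [h] at this; exact hAB _ this.1 hv
  · intro a ha
    have := hf' ⟨(a, false), Or.inl ⟨ha, rfl⟩⟩
    set p : {p : V × Bool // p.1 ∈ A ∧ p.2 = false ∨ p.1 ∈ B} := ⟨(a, false), Or.inl ⟨ha, rfl⟩⟩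
      with hp
    obtain ⟨h1, h2, h3, h4⟩ := this
    have h5 : (f p).1 = a := by
      rcases h4 with h | h
      · exact h
      · exact (hAB a ha (by rw [h] at h2; exact h2)).elim
    have := key a {(f p).2} (by
      intro w hw
      rw [Finset.mem_singleton] at hw
      subst hw
      refine ⟨Finset.mem_union_right _ h2, by rw [h5] at h3; exact h3, p, rfl, Or.inl ?_⟩
      exact Prod.ext h5 rfl)
    simpa using this
  · intro b hb
    have aux : ∀ i : Bool, ∃ p : {p : V × Bool // p.1 ∈ A ∧ p.2 = false ∨ p.1 ∈ B},
        p.1 = (b, i) ∧ (f p).2 = b ∧ (f p).1 ∈ A ∧ G.Adj b (f p).1 := by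
      intro i
      refine ⟨⟨(b, i), Or.inr hb⟩, rfl, ?_⟩
      obtain ⟨h1, h2, h3, h4⟩ := hf' ⟨(b, i), Or.inr hb⟩
      have h5 : (f ⟨(b, i), Or.inr hb⟩).2 = b := by
        rcases h4 with h | h
        · exact (hAB b (by rw [h] at h1; exact h1) hb).elim
        · exact h
      exact ⟨h5, h1, by rw [h5] at h3; exact h3.symm⟩
    obtain ⟨p, hp, p2, p1, pa⟩ := aux true
    obtain ⟨q, hq, q2, q1, qa⟩ := aux false
    have hne : (f p).1 ≠ (f q).1 := by
      intro h
      have : p = q := hinj (Prod.ext h (p2.trans q2.symm))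
      rw [this, hq] at hp
      simp at hp
    have := key b {(f p).1, (f q).1} (by
      intro w hw
      rw [Finset.mem_insert, Finset.mem_singleton] at hw
      rcases hw with rfl | rfl
      · exact ⟨Finset.mem_union_left _ p1, pa, p, by rw [hp], Or.inr (Prod.ext rfl p2)⟩
      · exact ⟨Finset.mem_union_left _ q1, qa, q, by rw [hq], Or.inr (Prod.ext rfl q2)⟩)
    rw [Finset.card_pair hne] at this
    convert this

open Classical in
theorem aux_main {V : Type*} [Fintype V]
    (G : SimpleGraph V) (k : ℕ) (hk : 4 ≤ k)
    (hcrit : IsCritical G k) : ∀ (n : ℕ) (A B : Finset V), A.card + B.card ≤ n → Disjoint A B →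
    ((∀ u ∈ A, ∀ v ∈ A, ¬ G.Adj u v) ∨ (∀ u ∈ B, ∀ v ∈ B, ¬ G.Adj u v)) →
    (∀ a ∈ A, G.degree a = k - 1) → (∀ b ∈ B, G.degree b = k) →
    (A ∪ B).Nonempty →
    ((A ×ˢ B).filter (fun p => G.Adj p.1 p.2)).card < A.card + 2 * B.card := by
  intro n
  induction n with
  | zero =>
    intro A B h _ _ _ _ hne
    have := Finset.card_pos.2 hne
    have := Finset.card_union_le A B
    omega
  | succ n ih =>
    intro A B hn hdisj hind hA hB hne
    by_contra hcon
    push Not at hcon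
    obtain ⟨f, hinj, hf⟩ := aux_hall G A B (by
      intro A' hA' B' hB' hlt
      rcases (A' ∪ B').eq_empty_or_nonempty with h | h
      · rw [Finset.union_eq_empty] at h
        simp [h.1, h.2]
      · refine (ih A' B' (by omega) (Finset.disjoint_of_subset_left hA'
          (Finset.disjoint_of_subset_right hB' hdisj)) ?_ (fun a ha => hA a (hA' ha))
          (fun b hb => hB b (hB' hb)) h).le
        exact hind.imp (fun h u hu v hv => h u (hA' hu) v (hA' hv))
          (fun h u hu v hv => h u (hB' hu) v (hB' hv))) hcon
    obtain ⟨D, hD1, hDA, hDB, hdA, hdB⟩ := aux_orient G A B hdisj f hinj hf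
    set S := A ∪ B with hS
    -- colour the rest
    let H : SimpleGraph V :=
      { Adj := fun u v => G.Adj u v ∧ u ∉ S ∧ v ∉ S
        symm := ⟨fun u v h => ⟨h.1.symm, h.2.2, h.2.1⟩⟩
        loopless := ⟨fun u h => G.irrefl h.1⟩ }
    have hHG : H ≤ G := fun u v h => h.1
    have hHne : H ≠ G := by
      obtain ⟨x, hx⟩ := hne
      have hdeg : 0 < G.degree x := by
        rcases Finset.mem_union.1 hx with h | h
        · rw [hA x h]; omega
        · rw [hB x h]; omega
      obtain ⟨y, hy⟩ := (G.degree_pos_iff_exists_adj x).1 hdeg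
      intro h
      rw [← h] at hy
      exact hy.2.1 hx
    have hcol : H.Colorable (k - 1) :=
      SimpleGraph.chromaticNumber_le_iff_colorable.1 (hcrit.2 H hHG hHne)
    obtain ⟨φ⟩ := hcol
    have hinh : Inhabited (Fin (k - 1)) := ⟨⟨0, by omega⟩⟩
    let L : V → Finset (Fin (k - 1)) := fun v =>
      Finset.univ \ ((G.neighborFinset v).filter (fun w => w ∉ S)).image φ
    have hLc : ∀ v, k - 1 + (S.filter (fun w => G.Adj v w)).card ≤ (L v).card + G.degree v := by
      intro v
      have h1 : (L v).card = (k - 1) -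
          (((G.neighborFinset v).filter (fun w => w ∉ S)).image φ).card := by
        simp only [L]
        rw [Finset.card_sdiff_of_subset (Finset.subset_univ _)]
        simp
      have h2 : (((G.neighborFinset v).filter (fun w => w ∉ S)).image φ).card ≤
        ((G.neighborFinset v).filter (fun w => w ∉ S)).card := Finset.card_image_le
      have h3 : ((G.neighborFinset v).filter (fun w => w ∈ S)).card +
        ((G.neighborFinset v).filter (fun w => w ∉ S)).card = (G.neighborFinset v).card :=
        Finset.card_filter_add_card_filter_not _
      have h4 : (G.neighborFinset v).filter (fun w => w ∈ S) = S.filter (fun w => G.Adj v w) := by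
        ext w; simp [and_comm]
      rw [h4, G.card_neighborFinset_eq_degree] at h3
      omega
    have hker : ∀ X ⊆ S, ∃ K ⊆ X, (∀ u ∈ K, ∀ v ∈ K, ¬ G.Adj u v) ∧
        ∀ x ∈ X, x ∉ K → ∃ y ∈ K, D x y := by
      intro X hX
      rcases hind with hi | hi
      · refine aux_kernel G D A hi hD1 _ X le_rfl ?_
        intro u hu v hv hu' hv' hadj
        exact hDB u v ((Finset.mem_union.1 (hX hu)).resolve_left hu')
          ((Finset.mem_union.1 (hX hv)).resolve_left hv') hadj
      · refine aux_kernel G D B hi hD1 _ X le_rfl ?_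
        intro u hu v hv hu' hv' hadj
        exact hDA u v ((Finset.mem_union.1 (hX hu)).resolve_right hu')
          ((Finset.mem_union.1 (hX hv)).resolve_right hv') hadj
    obtain ⟨c, hc1, hc2⟩ := aux_list G D S hker _ S le_rfl (Finset.Subset.refl _) L (by
      intro v hv
      have h := hLc v
      rcases Finset.mem_union.1 hv with hv | hv
      · have := hdA v hv
        rw [hA v hv] at h
        omega
      · have := hdB v hv
        rw [hB v hv] at h
        omega)
    have hmix : ∀ u ∈ S, ∀ v, v ∉ S → G.Adj u v → c u ≠ φ v := by
      intro u hu v hv hadj heq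
      have := (Finset.mem_sdiff.1 (hc1 u hu)).2
      refine this (Finset.mem_image.2 ⟨v, Finset.mem_filter.2 ⟨by simpa using hadj, hv⟩, heq.symm⟩)
    have hG : G.Colorable (k - 1) := by
      refine ⟨SimpleGraph.Coloring.mk (fun v => if v ∈ S then c v else φ v) ?_⟩
      intro u v hadj
      by_cases hu : u ∈ S <;> by_cases hv : v ∈ S
      · simpa [hu, hv] using hc2 u hu v hv hadj
      · simpa [hu, hv] using hmix u hu v hv hadj
      · simpa [hu, hv] using (hmix v hv u hu hadj.symm).symm
      · simpa [hu, hv] using φ.valid (v := u) (w := v) ⟨hadj, hu, hv⟩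
    have h1 := hG.chromaticNumber_le
    rw [hcrit.1] at h1
    have h2 : k ≤ k - 1 := by exact_mod_cast h1
    omega

/-- In a `k`-critical graph (`k ≥ 4`), with `A`, `B` as before
and `|A| + |B| ≥ 3`, the number of edges between `A` and `B` is at most
`|A| + 3|B| − 3`. -/
theorem bipartite_edge_bound_two {V : Type*} [Fintype V] [DecidableEq V]
    (G : SimpleGraph V) [DecidableRel G.Adj] (k : ℕ) (hk : 4 ≤ k)
    (hcrit : IsCritical G k) (A B : Finset V) (hdisj : Disjoint A B)
    (hind : (∀ u ∈ A, ∀ v ∈ A, ¬ G.Adj u v) ∨ (∀ u ∈ B, ∀ v ∈ B, ¬ G.Adj u v))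
    (hA : ∀ a ∈ A, G.degree a = k - 1) (hB : ∀ b ∈ B, G.degree b = k)
    (hcard : 3 ≤ A.card + B.card) :
    (∑ a ∈ A, (B.filter (fun b => G.Adj a b)).card) + 3 ≤
      A.card + 3 * B.card := by
  have hle : (∑ a ∈ A, (B.filter (fun b => G.Adj a b)).card) ≤ A.card * B.card := by
    rw [← smul_eq_mul]
    exact Finset.sum_le_card_nsmul _ _ _ (fun a _ => Finset.card_filter_le _ _)
  have hne : (A ∪ B).Nonempty := by
    rw [← Finset.card_pos, Finset.card_union_of_disjoint hdisj]
    omega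
  have hmain := aux_main G k hk hcrit _ A B le_rfl hdisj hind
    (fun a ha => by rw [← hA a ha]; congr!) (fun b hb => by rw [← hB b hb]; congr!)
    (by convert hne)
  have heq : (∑ a ∈ A, (B.filter (fun b => G.Adj a b)).card) =
      ((A ×ˢ B).filter (fun p => G.Adj p.1 p.2)).card := by
    simp only [Finset.card_filter]
    rw [Finset.sum_product]
  have hmain' : ((A ×ˢ B).filter (fun p => G.Adj p.1 p.2)).card < A.card + 2 * B.card := by
    convert hmain
  rw [← heq] at hmain'
  have h3 : B.card = 0 ∨ B.card = 1 ∨ 2 ≤ B.card := by omega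
  rcases h3 with h | h | h
  · rw [h] at hle hcard ⊢; omega
  · rw [h] at hle hcard ⊢; omega
  · omega
end

section
/- Let d ≥ 4 and let G be a (d+1)-critical graph with n vertices in which every vertex has degree d or d+1, the set of vertices of degree d+1 is independent, and the number h of vertices of degree d+1 is positive. Then h ≥ ⌈((d−2)n − (d+1)(d−2)) / d⌉. -/
namespace HD
open Finset
set_option linter.unusedSectionVars false
variable {V : Type*} [Fintype V] [DecidableEq V]

open Classical in
noncomputable def nb (G : SimpleGraph V) (v : V) (S : Finset V) : Finset V :=
  S.filter (fun w => G.Adj v w)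

noncomputable def dg (G : SimpleGraph V) (v : V) : ℕ := (nb G v univ).card

def PC (G : SimpleGraph V) (k : ℕ) (S : Finset V) (c : V → ℕ) : Prop :=
  (∀ v ∈ S, c v < k) ∧ ∀ u ∈ S, ∀ v ∈ S, G.Adj u v → c u ≠ c v

def ColOn (G : SimpleGraph V) (k : ℕ) (S : Finset V) : Prop := ∃ c, PC G k S c

variable {G : SimpleGraph V}

@[simp] lemma mem_nb {v w : V} {S : Finset V} : w ∈ nb G v S ↔ w ∈ S ∧ G.Adj v w := by
  simp [nb]

lemma nb_mono {v : V} {S T : Finset V} (h : S ⊆ T) : nb G v S ⊆ nb G v T := by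
  intro w; simp only [mem_nb]; exact fun hw => ⟨h hw.1, hw.2⟩

lemma nb_card_le_dg {v : V} {S : Finset V} : (nb G v S).card ≤ dg G v :=
  card_le_card (nb_mono (subset_univ _))

lemma PC.mono {k : ℕ} {S T : Finset V} {c : V → ℕ} (h : PC G k T c) (hs : S ⊆ T) : PC G k S c :=
  ⟨fun v hv => h.1 v (hs hv), fun u hu v hv => h.2 u (hs hu) v (hs hv)⟩

lemma ColOn.mono {k : ℕ} {S T : Finset V} (h : ColOn G k T) (hs : S ⊆ T) : ColOn G k S := by
  obtain ⟨c, hc⟩ := h; exact ⟨c, hc.mono hs⟩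

lemma ext1 {k : ℕ} {W : Finset V} {c : V → ℕ} {v : V} (hc : PC G k W c)
    (hcard : ((nb G v W).image c).card < k) :
    ∃ a, PC G k (insert v W) (Function.update c v a) := by
  have : ∃ a ∈ range k, a ∉ (nb G v W).image c := by
    by_contra! hcon
    have := card_le_card (show range k ⊆ _ from hcon)
    simp at this; omega
  obtain ⟨a, ha, hna⟩ := this
  simp only [Finset.mem_range] at ha
  have hna' : ∀ w ∈ W, G.Adj v w → c w ≠ a := by
    intro w hw hvw h
    exact hna (mem_image.2 ⟨w, by simp [hw, hvw], h⟩)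
  refine ⟨a, ?_, ?_⟩
  · intro w hw
    by_cases h : w = v
    · subst h; simpa
    · have := hc.1 w (by simpa [h] using hw)
      simpa [Function.update_of_ne h]
  · intro u hu w hw huw
    by_cases h : u = v
    · subst h
      have h2 : w ≠ u := huw.ne'
      rw [Function.update_self, Function.update_of_ne h2]
      exact (hna' w (by simpa [h2] using hw) huw).symm
    · by_cases h' : w = v
      · subst h'
        rw [Function.update_self, Function.update_of_ne h]
        exact (hna' u (by simpa [h] using hu) huw.symm)
      · rw [Function.update_of_ne h, Function.update_of_ne h']
        exact hc.2 u (by simpa [h] using hu) w (by simpa [h'] using hw) huw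

lemma ext1' {k : ℕ} {W : Finset V} {c : V → ℕ} {v : V} (hc : PC G k W c) (hv : v ∉ W)
    (hcard : ((nb G v W).image c).card < k) :
    ∃ c', PC G k (insert v W) c' ∧ ∀ w ∈ W, c' w = c w := by
  obtain ⟨a, ha⟩ := ext1 hc hcard
  refine ⟨_, ha, fun w hw => Function.update_of_ne ?_ _ _⟩
  rintro rfl; exact hv hw

/-- put a prescribed colour -/
lemma ext_col {k : ℕ} {W : Finset V} {c : V → ℕ} {v : V} (a : ℕ) (hc : PC G k W c) (hv : v ∉ W)
    (ha : a < k) (hn : ∀ w ∈ W, G.Adj v w → c w ≠ a) :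
    ∃ c', PC G k (insert v W) c' ∧ (∀ w ∈ W, c' w = c w) ∧ c' v = a := by
  have hne : ∀ w ∈ W, w ≠ v := by rintro w hw rfl; exact hv hw
  refine ⟨Function.update c v a, ⟨?_, ?_⟩, fun w hw => Function.update_of_ne (hne w hw) _ _,
    Function.update_self _ _ _⟩
  · intro w hw
    rcases mem_insert.1 hw with rfl | hw
    · simpa
    · rw [Function.update_of_ne (hne w hw)]; exact hc.1 w hw
  · intro u hu w hw huw
    replace hu := mem_insert.1 hu
    replace hw := mem_insert.1 hw
    rcases hu with hu1 | hu <;> rcases hw with hw1 | hw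
    · exact absurd (hu1.trans hw1.symm) huw.ne
    · subst hu1
      rw [Function.update_self, Function.update_of_ne (hne w hw)]; exact (hn w hw huw).symm
    · subst hw1
      rw [Function.update_self, Function.update_of_ne (hne u hu)]; exact (hn u hu huw.symm)
    · rw [Function.update_of_ne (hne w hw), Function.update_of_ne (hne u hu)]
      exact hc.2 u hu w hw huw

lemma image_two {S : Finset V} {c : V → ℕ} {p q : V} (hp : p ∈ S) (hq : q ∈ S) (hpq : p ≠ q)
    (h : c p = c q) : (S.image c).card < S.card := by
  have : S.image c = (S.erase p).image c := by
    ext a; simp only [mem_image, mem_erase]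
    constructor
    · rintro ⟨x, hx, rfl⟩
      by_cases hxp : x = p
      · exact ⟨q, ⟨hpq.symm, hq⟩, by rw [hxp, h]⟩
      · exact ⟨x, ⟨hxp, hx⟩, rfl⟩
    · rintro ⟨x, hx, rfl⟩; exact ⟨x, hx.2, rfl⟩
  rw [this]
  exact lt_of_le_of_lt card_image_le (card_erase_lt_of_mem hp)

lemma ext_set {k : ℕ} {W : Finset V} {c : V → ℕ} (hc : PC G k W c) (Q : Finset V) :
    Disjoint W Q → (∀ v ∈ Q, dg G v ≤ k) →
    (∀ v ∈ Q, ∃ p ∈ W, ∃ q ∈ W, p ≠ q ∧ G.Adj v p ∧ G.Adj v q ∧ c p = c q) →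
    ∃ c', PC G k (W ∪ Q) c' ∧ ∀ w ∈ W, c' w = c w := by
  induction Q using Finset.induction_on with
  | empty => intros; exact ⟨c, by simpa using hc, fun _ _ => rfl⟩
  | insert v Q hv ih =>
    intro hd hdeg hpq
    obtain ⟨c1, h1, h2⟩ := ih (disjoint_of_subset_right (subset_insert _ _) hd)
      (fun v hv => hdeg v (by simp [hv])) (fun v hv => hpq v (by simp [hv]))
    obtain ⟨p, hp, q, hq, hne, hvp, hvq, he⟩ := hpq v (by simp)
    have hvW : v ∉ W := fun h => (disjoint_left.1 hd h) (by simp)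
    obtain ⟨c2, h3, h4⟩ := ext1' (v := v) h1 (by simp [hv, hvW])
      (lt_of_lt_of_le (image_two (p := p) (q := q) (by simp [hp, hvp]) (by simp [hq, hvq]) hne
        (by rw [h2 p hp, h2 q hq, he])) (nb_card_le_dg.trans (hdeg v (by simp))))
    refine ⟨c2, by rwa [union_insert], fun w hw => ?_⟩
    rw [h4 w (by simp [hw]), h2 w hw]

lemma path_color {r : ℕ} {T : Finset V} (hT : ∀ v ∈ T, (nb G v T).card ≤ r) {t : V} (ht : t ∈ T) :
    ∀ (l : List V) (W : Finset V) (c : V → ℕ), PC G r W c → l.Nodup → (∀ v ∈ l, v ∉ W) →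
    List.IsChain G.Adj (l ++ [t]) → t ∉ W → t ∉ l → W ⊆ T → (∀ v ∈ l, v ∈ T) →
    ∃ c', PC G r (W ∪ l.toFinset) c' ∧ ∀ w ∈ W, c' w = c w := by
  intro l
  induction l with
  | nil => intro W c hc _ _ _ _ _ _ _; exact ⟨c, by simpa using hc, fun _ _ => rfl⟩
  | cons x l ih =>
    intro W c hc hnd hdis hch htW htl hWT hlT
    have hy : ∃ y, G.Adj x y ∧ y ∈ T ∧ y ∉ W := by
      cases l with
      | nil => simp at hch; exact ⟨t, hch, ht, htW⟩
      | cons y l =>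
        simp only [List.cons_append, List.isChain_cons_cons] at hch
        exact ⟨y, hch.1, hlT y (by simp), hdis y (by simp)⟩
    obtain ⟨y, hxy, hyT, hyW⟩ := hy
    have hlt : (nb G x W).card < r := by
      refine lt_of_lt_of_le (card_lt_card ?_) (hT x (hlT x (by simp)))
      refine ⟨nb_mono hWT, fun h => hyW ?_⟩
      exact (mem_nb.1 (h (mem_nb.2 ⟨hyT, hxy⟩))).1
    obtain ⟨c1, h1, h2⟩ := ext1' (v := x) hc (hdis x (by simp)) (lt_of_le_of_lt card_image_le hlt)
    have hnd' := List.nodup_cons.1 hnd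
    obtain ⟨c2, h3, h4⟩ := ih (insert x W) c1 h1 hnd'.2 (by
      intro v hv; simp only [mem_insert, not_or]
      exact ⟨fun h => hnd'.1 (h ▸ hv), hdis v (by simp [hv])⟩)
      (by simpa using hch.tail) (by
        simp only [mem_insert, not_or]; exact ⟨fun h => htl (by simp [h]), htW⟩)
      (fun h => htl (by simp [h])) (by
        intro v hv; rcases mem_insert.1 hv with rfl | hv
        · exact hlT _ (by simp)
        · exact hWT hv) (fun v hv => hlT v (by simp [hv]))
    refine ⟨c2, ?_, fun w hw => by rw [h4 w (by simp [hw]), h2 w hw]⟩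
    refine h3.mono ?_
    intro v; simp only [mem_union, List.toFinset_cons, mem_insert]; tauto

lemma list_first {α : Type*} (Q : α → Prop) : ∀ l : List α, (∃ x ∈ l, Q x) →
    ∃ pre x post, l = pre ++ x :: post ∧ Q x ∧ ∀ y ∈ pre, ¬ Q y := by
  intro l
  induction l with
  | nil => simp
  | cons a l ih =>
    intro h
    by_cases ha : Q a
    · exact ⟨[], a, l, rfl, ha, by simp⟩
    · obtain ⟨pre, x, post, rfl, hx, hp⟩ := ih (by
        obtain ⟨x, hx, hq⟩ := h
        rcases List.mem_cons.1 hx with rfl | hx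
        · exact absurd hq ha
        · exact ⟨x, hx, hq⟩)
      exact ⟨a :: pre, x, post, rfl, hx, by simpa [ha] using hp⟩

lemma exists_min_noncol {k : ℕ} : ∀ (Z : Finset V), ¬ ColOn G k Z →
    ∃ W ⊆ Z, ¬ ColOn G k W ∧ ∀ W' ⊂ W, ColOn G k W' := by
  intro Z
  induction Z using Finset.strongInduction with
  | H Z ih =>
    intro h
    by_cases h' : ∀ W' ⊂ Z, ColOn G k W'
    · exact ⟨Z, Subset.rfl, h, h'⟩
    · push Not at h'
      obtain ⟨W', hW', hn⟩ := h'
      obtain ⟨W, hW, h1, h2⟩ := ih W' hW' hn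
      exact ⟨W, hW.trans hW'.1, h1, h2⟩

end HD

namespace HD
open Finset
set_option linter.unusedSectionVars false
variable {V : Type*} [Fintype V] [DecidableEq V] {G : SimpleGraph V}

lemma brooks {r : ℕ} (hr : 3 ≤ r) (Z : Finset V) (hZ : ∀ v ∈ Z, (nb G v Z).card ≤ r)
    (hn : ¬ ColOn G r Z) :
    ∃ K ⊆ Z, K.card = r + 1 ∧ ∀ u ∈ K, ∀ v ∈ K, u ≠ v → G.Adj u v := by
  obtain ⟨W, hWZ, hW, hmin⟩ := exists_min_noncol Z hn
  have hle : ∀ v ∈ W, (nb G v W).card ≤ r := fun v hv =>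
    (card_le_card (nb_mono hWZ)).trans (hZ v (hWZ hv))
  have hreg : ∀ v ∈ W, (nb G v W).card = r := by
    intro v hv
    by_contra hne
    have hlt : (nb G v W).card < r := lt_of_le_of_ne (hle v hv) hne
    obtain ⟨c, hc⟩ := hmin (W.erase v) (erase_ssubset hv)
    obtain ⟨a, ha⟩ := ext1 (v := v) hc (lt_of_le_of_lt card_image_le
      (lt_of_le_of_lt (card_le_card (nb_mono (erase_subset _ _))) hlt))
    rw [insert_erase hv] at ha
    exact hW ⟨_, ha⟩
  by_cases hall : ∀ v ∈ W, ∀ a ∈ nb G v W, ∀ b ∈ nb G v W, a ≠ b → G.Adj a b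
  · have hne : W.Nonempty := by
      by_contra h
      rw [not_nonempty_iff_eq_empty] at h
      exact hW ⟨fun _ => 0, by simp [h, PC]⟩
    obtain ⟨v, hv⟩ := hne
    refine ⟨insert v (nb G v W), ?_, ?_, ?_⟩
    · intro x hx
      rcases mem_insert.1 hx with rfl | hx
      · exact hWZ hv
      · exact hWZ (mem_nb.1 hx).1
    · rw [card_insert_of_notMem (by simp), hreg v hv]
    · intro a ha b hb hab
      rcases mem_insert.1 ha with ha1 | ha1 <;> rcases mem_insert.1 hb with hb1 | hb1
      · exact absurd (ha1.trans hb1.symm) hab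
      · rw [ha1]; exact (mem_nb.1 hb1).2
      · rw [hb1]; exact (mem_nb.1 ha1).2.symm
      · exact hall v hv a ha1 b hb1 hab
  exfalso
  push Not at hall
  obtain ⟨v2, hv2, v1, h1, v3, h3, h13, hna⟩ := hall
  rw [mem_nb] at h1 h3
  obtain ⟨hv1, h21⟩ := h1
  obtain ⟨hv3, h23⟩ := h3
  -- longest list
  let Pl : List V → Prop := fun l => (l ++ [v3, v2, v1]).Nodup ∧
    List.IsChain G.Adj (l ++ [v3, v2, v1]) ∧ ∀ x ∈ l, x ∈ W
  have hlen : ∀ l, Pl l → l.length ≤ W.card := by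
    rintro l ⟨hl, _, hs⟩
    have : l.Nodup := (List.nodup_append.1 hl).1
    rw [← List.toFinset_card_of_nodup this]
    exact card_le_card (fun x hx => hs x (by simpa using hx))
  have hmaxl : ∃ l, Pl l ∧ ∀ l', Pl l' → l'.length ≤ l.length := by
    have h0 : ∃ k, ∃ l, Pl l ∧ W.card - l.length = k := by
      refine ⟨_, [], ⟨?_, ?_, ?_⟩, rfl⟩
      · simp [h23.ne', h21.ne, h13.symm]
      · simp [h23.symm, h21]
      · simp
    classical
    obtain ⟨l, hl, hk⟩ := Nat.find_spec h0
    refine ⟨l, hl, fun l' hl' => ?_⟩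
    have := Nat.find_min' h0 ⟨l', hl', rfl⟩
    have := hlen l hl
    have := hlen l' hl'
    omega
  obtain ⟨l, ⟨hnd, hch, hlW⟩, hlmax⟩ := hmaxl
  have hpW : ∀ x ∈ l ++ [v3, v2, v1], x ∈ W := by
    intro x hx
    simp only [List.mem_append, List.mem_cons, List.not_mem_nil, or_false] at hx
    rcases hx with h | rfl | rfl | rfl
    · exact hlW x h
    all_goals assumption
  obtain ⟨p, hp⟩ : ∃ p, p = l ++ [v3, v2, v1] := ⟨_, rfl⟩
  obtain ⟨hd, tl, hpc⟩ : ∃ hd tl, p = hd :: tl := by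
    cases l with
    | nil => exact ⟨_, _, hp⟩
    | cons a l => exact ⟨_, _, hp⟩
  have hhd : ∀ w ∈ W, G.Adj hd w → w ∈ p := by
    intro w hw hadj
    by_contra hwp
    have := hlmax (w :: l) ⟨?_, ?_, ?_⟩
    · simp at this
    · rw [List.cons_append, List.nodup_cons, ← hp]
      exact ⟨hwp, hp ▸ hnd⟩
    · rw [List.cons_append, ← hp, hpc, List.isChain_cons_cons, ← hpc, hp]
      exact ⟨hadj.symm, hch⟩
    · intro x hx
      rcases List.mem_cons.1 hx with rfl | hx
      · exact hw
      · exact hlW x hx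
  rw [← hp] at hnd hch hpW
  have hhdW : hd ∈ W := hpW hd (by simp [hpc])
  -- shortest prefix
  have hex : ∃ x ∈ p.reverse, G.Adj hd x := by
    have : 0 < (nb G hd W).card := by rw [hreg hd hhdW]; omega
    obtain ⟨x, hx⟩ := card_pos.1 this
    rw [mem_nb] at hx
    exact ⟨x, by simpa using hhd x hx.1 hx.2, hx.2⟩
  obtain ⟨pre, y, post, hdec, hy, hpre⟩ := list_first (fun x => G.Adj hd x) _ hex
  obtain ⟨C, hC⟩ : ∃ C, C = post.reverse ++ [y] := ⟨_, rfl⟩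
  have hpC : p = C ++ pre.reverse := by
    rw [← List.reverse_reverse p, hdec, hC]; simp
  have hCnd : C.Nodup := by rw [hpC] at hnd; exact (List.nodup_append.1 hnd).1
  have hCch : C.IsChain G.Adj := by rw [hpC] at hch; exact hch.left_of_append
  have hCW : ∀ x ∈ C, x ∈ W := fun x hx => hpW x (by rw [hpC]; simp [hx])
  have hhdC : ∀ w ∈ W, G.Adj hd w → w ∈ C := by
    intro w hw hadj
    have h1 := hhd w hw hadj
    rw [hpC, List.mem_append] at h1
    rcases h1 with h1 | h1
    · exact h1
    · exact absurd hadj (hpre w (by simpa using h1))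
  have hCne : ∃ tl', C = hd :: tl' := by
    cases hCc : C with
    | nil => simp [hC] at hCc
    | cons a t =>
      rw [hpC, hCc, List.cons_append] at hpc
      exact ⟨t, by rw [(List.cons.inj hpc).1]⟩
  obtain ⟨tl', hCc⟩ := hCne
  by_cases hout : ∃ x ∈ C, ∃ w ∈ W, w ∉ C ∧ G.Adj x w
  · obtain ⟨pre', x, post', hdec', ⟨w, hwW, hwC, hxw⟩, hpre'⟩ :=
      list_first (fun x => ∃ w ∈ W, w ∉ C ∧ G.Adj x w) C hout
    rcases List.eq_nil_or_concat pre' with rfl | ⟨P, a, rfl⟩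
    · rw [hCc] at hdec'
      have : hd = x := (List.cons.inj hdec').1
      subst this
      exact hwC (hhdC w hwW hxw)
    · have hdC : C = P ++ a :: x :: post' := by rw [hdec']; simp
      have haC : a ∈ C := by rw [hdC]; simp
      have hxC : x ∈ C := by rw [hdC]; simp
      have hax : G.Adj a x := by
        have := hCch; rw [hdC] at this
        have := this.right_of_append
        exact (List.isChain_cons_cons.1 this).1
      obtain ⟨c, hc⟩ := hmin (W \ C.toFinset) (by
        refine ⟨sdiff_subset, fun h => ?_⟩
        have := h (hCW a haC)
        simp [haC] at this)
      have hwT : w ∈ W \ C.toFinset := by simp [hwW, hwC]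
      obtain ⟨c1, hc1, hc1e, hc1a⟩ := ext_col (v := a) (c w) hc (by simp [haC]) (hc.1 w hwT) (by
        intro u hu hau
        rw [mem_sdiff, List.mem_toFinset] at hu
        exact absurd ⟨u, hu.1, hu.2, hau⟩ (hpre' a (by simp)))
      have hnd' := hCnd
      rw [hdC] at hnd'
      have hnd2 : (P ++ post' ++ [a, x]).Nodup := by
        refine (List.Perm.nodup_iff ?_).1 hnd'
        have h := List.perm_append_comm (l₁ := [a, x]) (l₂ := post')
        simpa using h.append_left P
      have hndm : ∀ z, z ∈ P ++ post' → z ≠ a ∧ z ≠ x := by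
        intro z hz
        have := (List.nodup_append.1 hnd2).2.2 z hz
        exact ⟨this a (by simp), this x (by simp)⟩
      have hmemC : ∀ z, z ∈ C ↔ z ∈ P ∨ z = a ∨ z = x ∨ z ∈ post' := by
        intro z; rw [hdC]; simp
      have hxa : x ≠ a := hax.ne'
      obtain ⟨c2, hc2, hc2e⟩ := path_color hle (hCW x hxC) (P.reverse ++ post'.reverse)
        (insert a (W \ C.toFinset)) c1 hc1 (by
          have h1 := (List.nodup_append.1 hnd2).1
          refine (List.Perm.nodup_iff ?_).1 h1
          exact (List.reverse_perm P).symm.append (List.reverse_perm post').symm)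
        (by
          intro v hv
          have hv' : v ∈ P ++ post' := by simpa using hv
          have := hndm v hv'
          simp only [mem_insert, mem_sdiff, List.mem_toFinset, hmemC, this]
          simp only [List.mem_append] at hv'
          tauto)
        (by
          have h1 : P.reverse ++ post'.reverse ++ [x] = P.reverse ++ (x :: post').reverse := by simp
          rw [h1, List.isChain_append]
          have hch' := hCch
          rw [hdC] at hch'
          refine ⟨?_, ?_, ?_⟩
          · rw [List.isChain_reverse]
            exact (hch'.left_of_append).imp (fun _ _ h => h.symm)
          · rw [List.isChain_reverse]
            exact (hch'.right_of_append.tail).imp (fun _ _ h => h.symm)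
          · intro s hs t ht
            have hs' : s = hd := by
              cases P with
              | nil => simp at hs
              | cons b P =>
                rw [hCc] at hdC
                have := (List.cons.inj hdC).1
                simp at hs
                rw [this, hs]
            have ht' : t = y := by
              have h2 : C = (P ++ [a]) ++ (x :: post') := by rw [hdC]; simp
              have h3 : C.getLast? = (x :: post').getLast? := by
                rw [h2, List.getLast?_append]; simp [List.getLast?_cons]
              rw [List.head?_reverse, ← h3, hC] at ht
              simpa using ht.symm
            rw [hs', ht']; exact hy)
        (by simp [hxC, hxa])
        (by
          intro h
          exact (hndm x (by simpa using h)).2 rfl)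
        (by
          intro v hv
          rcases mem_insert.1 hv with rfl | hv
          · exact hCW _ haC
          · exact (mem_sdiff.1 hv).1)
        (by
          intro v hv
          apply hCW
          rw [hmemC]
          have : v ∈ P ++ post' := by simpa using hv
          rw [List.mem_append] at this
          tauto)
      obtain ⟨b, hb⟩ := ext1 (v := x) hc2 (by
        refine lt_of_lt_of_le (image_two (p := w) (q := a) ?_ ?_ ?_ ?_) (le_trans (card_le_card
          (nb_mono (T := W) ?_)) (hle x (hCW x hxC)))
        · rw [mem_nb]; refine ⟨?_, hxw⟩
          exact mem_union_left _ (mem_insert_of_mem hwT)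
        · rw [mem_nb]; refine ⟨?_, hax.symm⟩
          exact mem_union_left _ (mem_insert_self _ _)
        · rintro rfl; exact hwC haC
        · rw [hc2e w (mem_insert_of_mem hwT), hc2e a (mem_insert_self _ _), hc1a, hc1e w hwT]
        · intro v hv
          simp only [mem_union, mem_insert, mem_sdiff, List.mem_toFinset, List.mem_append,
            List.mem_reverse] at hv
          rcases hv with (rfl | hv) | hv | hv
          · exact hCW _ haC
          · exact hv.1
          · exact hCW _ (by rw [hmemC]; tauto)
          · exact hCW _ (by rw [hmemC]; tauto))
      refine hW ⟨_, hb.mono ?_⟩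
      intro v hv
      simp only [mem_union, mem_insert, mem_sdiff, List.mem_toFinset, List.mem_append,
            List.mem_reverse, hv, true_and]
      have := hmemC v
      tauto
  · push Not at hout
    have hWC : ∀ v ∈ W, v ∈ C := by
      by_contra! hcon
      obtain ⟨v, hvW, hvC⟩ := hcon
      obtain ⟨c1, hc1⟩ := hmin (W \ C.toFinset) (by
        refine ⟨sdiff_subset, fun h => ?_⟩
        have := h hhdW
        simp [hCc] at this)
      obtain ⟨c2, hc2⟩ := hmin (C.toFinset) (by
        refine ⟨fun x hx => hCW x (by simpa using hx), fun h => ?_⟩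
        exact hvC (by simpa using h hvW))
      refine hW ⟨fun v => if v ∈ C then c2 v else c1 v, ?_, ?_⟩
      · intro v hv
        by_cases h : v ∈ C
        · simp only [h, if_true]; exact hc2.1 v (by simpa using h)
        · simp only [h, if_false]; exact hc1.1 v (by simp [hv, h])
      · intro u hu v hv huv
        by_cases h : u ∈ C <;> by_cases h' : v ∈ C
        · simp only [h, h', if_true]; exact hc2.2 u (by simpa using h) v (by simpa using h') huv
        · exact absurd huv (hout u h v hv h')
        · exact absurd huv.symm (hout v h' u hu h)
        · simp only [h, h', if_false]; exact hc1.2 u (by simp [hu, h]) v (by simp [hv, h']) huv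
    have hWp : ∀ v ∈ W, v ∈ l ∨ v = v3 ∨ v = v2 ∨ v = v1 := by
      intro v hv
      have : v ∈ p := by rw [hpC]; simp [hWC v hv]
      rw [hp] at this
      simpa using this
    obtain ⟨vj, hvj, hvj1, hvj3⟩ : ∃ vj ∈ nb G v2 W, vj ≠ v1 ∧ vj ≠ v3 := by
      by_contra! hcon
      have : nb G v2 W ⊆ {v1, v3} := by
        intro x hx
        simp only [mem_insert, mem_singleton]
        by_cases h : x = v1
        · exact Or.inl h
        · exact Or.inr (hcon x hx h)
      have := card_le_card this
      rw [hreg v2 hv2] at this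
      have := card_le_two (a := v1) (b := v3)
      omega
    rw [mem_nb] at hvj
    have hvjl : vj ∈ l := by
      rcases hWp vj hvj.1 with h | h | h | h
      · exact h
      · exact absurd h hvj3
      · exact absurd h hvj.2.ne'
      · exact absurd h hvj1
    obtain ⟨α, β, hl⟩ := List.append_of_mem hvjl
    rw [hp] at hnd hch
    have hndl := List.nodup_append.1 hnd
    have hl1 : ∀ z ∈ l, z ≠ v1 ∧ z ≠ v2 ∧ z ≠ v3 := by
      intro z hz
      have := hndl.2.2 z hz
      exact ⟨this _ (by simp), this _ (by simp), this _ (by simp)⟩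
    have hlch := hch.left_of_append
    rw [hl] at hlch
    have hlnd := hndl.1
    rw [hl] at hlnd
    have hlnd2 := List.nodup_append.1 hlnd
    have hlnd3 := List.nodup_cons.1 hlnd2.2.1
    have hml : ∀ z, z ∈ l ↔ z ∈ α ∨ z = vj ∨ z ∈ β := by intro z; rw [hl]; simp
    have hvjs := hl1 vj hvjl
    obtain ⟨c1, hc1, hc1e⟩ := path_color hle (hlW vj hvjl) β.reverse {v1, v3} (fun _ => 0) (by
        refine ⟨fun _ _ => show 0 < r by omega, ?_⟩
        intro u hu v hv huv
        simp only [mem_insert, mem_singleton] at hu hv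
        rcases hu with rfl | rfl <;> rcases hv with rfl | rfl
        · exact absurd huv (G.loopless.irrefl _)
        · exact absurd huv hna
        · exact absurd huv.symm hna
        · exact absurd huv (G.loopless.irrefl _)) (by simpa using hlnd3.2) (by
        intro v hv
        have := hl1 v ((hml v).2 (by simp at hv; tauto))
        simp [this]) (by
        have : β.reverse ++ [vj] = (vj :: β).reverse := by simp
        rw [this, List.isChain_reverse]
        exact (hlch.right_of_append).imp (fun _ _ h => h.symm)) (by simp [hvjs])
        (by simpa using hlnd3.1) (by
          intro v hv; simp only [mem_insert, mem_singleton] at hv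
          rcases hv with rfl | rfl <;> assumption) (by
          intro v hv; exact hlW v ((hml v).2 (by simp at hv; tauto)))
    obtain ⟨c2, hc2, hc2e⟩ := path_color hle hv2 (α ++ [vj]) ({v1, v3} ∪ β.reverse.toFinset) c1 hc1
        (by
          have : α ++ vj :: β = (α ++ [vj]) ++ β := by simp
          rw [this] at hlnd
          exact (List.nodup_append.1 hlnd).1) (by
        intro v hv
        have h1 := hl1 v ((hml v).2 (by simp at hv; tauto))
        simp only [mem_union, mem_insert, mem_singleton, h1, List.mem_toFinset, List.mem_reverse,
          false_or]
        intro hvb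
        simp only [List.mem_append, List.mem_singleton] at hv
        rcases hv with hv | rfl
        · exact hlnd2.2.2 v hv v (by simp [hvb]) rfl
        · exact hlnd3.1 hvb) (by
        have h1 : α ++ [vj] ++ [v2] = (α ++ [vj]) ++ [v2] := by simp
        rw [List.isChain_append]
        refine ⟨?_, by simp, ?_⟩
        · have : α ++ vj :: β = (α ++ [vj]) ++ β := by simp
          rw [this] at hlch
          exact hlch.left_of_append
        · intro s hs t ht
          simp at hs ht
          rw [← hs, ← ht]; exact hvj.2.symm) (by
          simp only [mem_union, mem_insert, mem_singleton, List.mem_toFinset, List.mem_reverse,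
            h21.ne, h23.ne, false_or]
          intro h
          exact (hl1 v2 ((hml v2).2 (by tauto))).2.1 rfl) (by
          intro h
          exact (hl1 v2 ((hml v2).2 (by simp at h; tauto))).2.1 rfl) (by
          intro v hv
          simp only [mem_union, mem_insert, mem_singleton, List.mem_toFinset, List.mem_reverse] at hv
          rcases hv with (rfl | rfl) | hv
          · assumption
          · assumption
          · exact hlW v ((hml v).2 (by tauto))) (by
          intro v hv; exact hlW v ((hml v).2 (by simp at hv; tauto)))
    obtain ⟨b, hb⟩ := ext1 (v := v2) hc2 (by
        refine lt_of_lt_of_le (image_two (p := v1) (q := v3) ?_ ?_ h13 ?_) (le_trans (card_le_card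
          (nb_mono (T := W) ?_)) (hle v2 hv2))
        · simp [h21]
        · simp [h23]
        · rw [hc2e v1 (by simp), hc2e v3 (by simp), hc1e v1 (by simp), hc1e v3 (by simp)]
        · intro v hv
          simp only [mem_union, mem_insert, mem_singleton, List.mem_toFinset, List.mem_reverse,
            List.mem_append, List.mem_singleton] at hv
          rcases hv with ((rfl | rfl) | hv) | hv | rfl
          · assumption
          · assumption
          · exact hlW v ((hml v).2 (by tauto))
          · exact hlW v ((hml v).2 (by tauto))
          · exact hvj.1)
    refine hW ⟨_, hb.mono ?_⟩
    intro v hv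
    simp only [mem_union, mem_insert, mem_singleton, List.mem_toFinset, List.mem_reverse,
            List.mem_append, List.mem_singleton]
    have hm := hml v
    clear * - hv hm hWp
    rcases hWp v hv with h | h | h | h
    · rcases hm.1 h with h | h | h <;> simp [h]
    all_goals simp [h]

end HD

namespace HD
open Finset
set_option linter.unusedSectionVars false
variable {V : Type*} [Fintype V] [DecidableEq V] {G : SimpleGraph V}

structure Cls (d : ℕ) (G : SimpleGraph V) : Prop where
  le : ∀ v, dg G v ≤ d + 1
  ind : ∀ u v, dg G u = d + 1 → dg G v = d + 1 → ¬ G.Adj u v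

lemma Cls.low {d : ℕ} (h : Cls d G) {u v : V} (hu : ¬ dg G u ≤ d) (huv : G.Adj u v) :
    dg G v ≤ d := by
  by_contra hv
  have h1 := h.le u
  have h2 := h.le v
  exact h.ind u v (by omega) (by omega) huv

def VC (d : ℕ) (G : SimpleGraph V) : Prop := ∀ v, 0 < dg G v → ColOn G d (univ.erase v)

def Clq (G : SimpleGraph V) (S : Finset V) : Prop := ∀ u ∈ S, ∀ v ∈ S, u ≠ v → G.Adj u v

lemma dg_pos {u v : V} (h : G.Adj u v) : 0 < dg G u :=
  card_pos.2 ⟨v, by simp [h]⟩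

lemma add_nb_le {v : V} {A W : Finset V} (hA : ∀ x ∈ A, G.Adj v x) (hd : Disjoint A W) :
    A.card + (nb G v W).card ≤ dg G v := by
  rw [← card_union_of_disjoint]
  · apply card_le_card
    intro x hx
    rcases mem_union.1 hx with hx | hx
    · simp [hA x hx]
    · simp [(mem_nb.1 hx).2]
  · exact disjoint_of_subset_right (fun x hx => (mem_nb.1 hx).1) hd

lemma dlemma {d : ℕ} (hd : 4 ≤ d) (hG : Cls d G) (hN : ¬ ColOn G d univ) (hV : VC d G)
    {S : Finset V} (hS : Clq G S) (hc : S.card + 1 = d) {a b : V} (hab : a ≠ b)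
    (haS : ∀ s ∈ S, G.Adj a s) (hbS : ∀ s ∈ S, G.Adj b s) :
    G.Adj a b ∨ (dg G a = d + 1 ∧ dg G b = d + 1 ∧ d = 4) := by
  by_contra hcon
  push Not at hcon
  obtain ⟨hnab, hdeg⟩ := hcon
  apply hN
  have haS' : a ∉ S := fun h => (haS a h).ne rfl
  have hbS' : b ∉ S := fun h => (hbS b h).ne rfl
  have hne : S.Nonempty := by rw [← card_pos]; omega
  obtain ⟨s, hs⟩ := hne
  obtain ⟨W, hW⟩ : ∃ W : Finset V, W = univ \ (insert a (insert b S)) := ⟨_, rfl⟩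
  have hmW : ∀ v, v ∈ W ↔ v ≠ a ∧ v ≠ b ∧ v ∉ S := by intro v; simp [hW]
  obtain ⟨c, hcW⟩ : ColOn G d W := (hV s (dg_pos (haS s hs).symm)).mono (by
    intro v hv; rw [hmW] at hv
    simp only [mem_erase, mem_univ, and_true]; rintro rfl; exact hv.2.2 hs)
  have hdSW : Disjoint S W := by
    rw [disjoint_left]; intro v hv hv'; exact ((hmW v).1 hv').2.2 hv
  have h1 := add_nb_le haS hdSW
  have h2 := add_nb_le hbS hdSW
  have h3 := hG.le a
  have h4 := hG.le b
  have htot : (nb G a W).card + (nb G b W).card < d := by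
    by_cases h5 : dg G a = d + 1
    · by_cases h6 : dg G b = d + 1
      · have := hdeg h5 h6; omega
      · omega
    · omega
  obtain ⟨α, hα, hαn⟩ : ∃ α ∈ range d, α ∉ (nb G a W ∪ nb G b W).image c := by
    by_contra! h
    have h5 := card_le_card (show range d ⊆ _ from h)
    have h6 := card_image_le (s := nb G a W ∪ nb G b W) (f := c)
    have h7 := card_union_le (nb G a W) (nb G b W)
    rw [card_range] at h5; omega
  have hαd : α < d := by simpa using hα
  have haW : a ∉ W := by simp [hmW]
  have hbW : b ∉ insert a W := by simp [hmW, hab.symm]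
  obtain ⟨c1, hc1, hc1e, hc1a⟩ := ext_col (v := a) α hcW haW hαd (by
    intro w hw haw h
    exact hαn (mem_image.2 ⟨w, by simp [hw, haw], h⟩))
  obtain ⟨c2, hc2, hc2e, hc2b⟩ := ext_col (v := b) α hc1 hbW hαd (by
    intro w hw hbw h
    rcases mem_insert.1 hw with rfl | hw
    · exact hnab hbw.symm
    rw [hc1e w hw] at h
    exact hαn (mem_image.2 ⟨w, by simp [hw, hbw], h⟩))
  have hc2a : c2 a = α := by rw [hc2e a (by simp), hc1a]
  by_cases hhigh : ∃ s0 ∈ S, ¬ dg G s0 ≤ d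
  · obtain ⟨s0, hs0, hh⟩ := hhigh
    have hs0W : s0 ∉ insert b (insert a W) := by
      simp only [mem_insert, hmW, not_or]
      exact ⟨(hbS s0 hs0).ne', (haS s0 hs0).ne', fun h => h.2.2 hs0⟩
    have hcnt : (S.erase s0).card + (nb G s0 (insert b (insert a W))).card ≤ dg G s0 := by
      apply add_nb_le
      · intro x hx; exact hS s0 hs0 x (mem_erase.1 hx).2 (mem_erase.1 hx).1.symm
      · rw [disjoint_left]; intro x hx
        have := (mem_erase.1 hx).2
        simp only [mem_insert, hmW, not_or]
        exact ⟨(hbS x this).ne', (haS x this).ne', fun h => h.2.2 this⟩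
    rw [card_erase_of_mem hs0] at hcnt
    have := hG.le s0
    obtain ⟨c3, hc3, hc3e⟩ := ext1' (v := s0) hc2 hs0W (lt_of_le_of_lt card_image_le (by omega))
    obtain ⟨c4, hc4, -⟩ := ext_set hc3 (S.erase s0) (by
      rw [disjoint_right]; intro x hx
      have hxS := (mem_erase.1 hx).2
      simp only [mem_insert, hmW, not_or]
      exact ⟨(mem_erase.1 hx).1, (hbS x hxS).ne', (haS x hxS).ne', fun h => h.2.2 hxS⟩)
      (fun v hv => hG.low hh (hS s0 hs0 v (mem_erase.1 hv).2 (mem_erase.1 hv).1.symm))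
      (fun v hv => ⟨a, by simp, b, by simp, hab, (haS v (mem_erase.1 hv).2).symm,
        (hbS v (mem_erase.1 hv).2).symm, by
          rw [hc3e a (by simp), hc3e b (by simp), hc2a, hc2b]⟩)
    refine ⟨c4, hc4.mono ?_⟩
    intro v _
    simp only [mem_union, mem_insert, hmW, mem_erase]
    by_cases e1 : v = a <;> by_cases e2 : v = b <;> by_cases e3 : v ∈ S <;>
      by_cases e4 : v = s0 <;> simp [e1, e2, e3, e4]
  · push Not at hhigh
    obtain ⟨c4, hc4, -⟩ := ext_set hc2 S (by
      rw [disjoint_right]; intro x hxS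
      simp only [mem_insert, hmW, not_or]
      exact ⟨(hbS x hxS).ne', (haS x hxS).ne', fun h => h.2.2 hxS⟩) hhigh
      (fun v hv => ⟨a, by simp, b, by simp, hab, (haS v hv).symm,
        (hbS v hv).symm, by rw [hc2a, hc2b]⟩)
    refine ⟨c4, hc4.mono ?_⟩
    intro v _
    simp only [mem_union, mem_insert, hmW]
    by_cases e1 : v = a <;> by_cases e2 : v = b <;> by_cases e3 : v ∈ S <;> simp [e1, e2, e3]

def KM (d : ℕ) (G : SimpleGraph V) : Prop := ∃ (S : Finset V) (a b : V), Clq G S ∧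
  S.card + 1 = d ∧ a ≠ b ∧ (∀ s ∈ S, G.Adj a s) ∧ (∀ s ∈ S, G.Adj b s) ∧
  (G.Adj a b ∨ (dg G a = d + 1 ∧ dg G b = d + 1))

/-- all pairs of `T` other than `a b` are adjacent -/
def NC (G : SimpleGraph V) (T : Finset V) (a b : V) : Prop := ∀ p ∈ T, ∀ q ∈ T, p ≠ q →
  ¬ (p = a ∧ q = b) → ¬ (p = b ∧ q = a) → G.Adj p q

lemma KM_of {d : ℕ} {T : Finset V} {a b : V} (hT : T.card = d + 1) (ha : a ∈ T) (hb : b ∈ T)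
    (hab : a ≠ b) (h : NC G T a b)
    (h' : G.Adj a b ∨ (dg G a = d + 1 ∧ dg G b = d + 1)) (hd : 4 ≤ d) : KM d G := by
  refine ⟨(T.erase a).erase b, a, b, ?_, ?_, hab, ?_, ?_, h'⟩
  · intro p hp q hq hpq
    simp only [mem_erase] at hp hq
    exact h p hp.2.2 q hq.2.2 hpq (fun e => hp.2.1 e.1) (fun e => hp.1 e.1)
  · rw [card_erase_of_mem (by simp [hb, hab.symm]), card_erase_of_mem ha]; omega
  · intro s hs
    simp only [mem_erase] at hs
    exact h a ha s hs.2.2 hs.2.1.symm (fun e => hs.1 e.2) (fun e => hs.2.1 e.2)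
  · intro s hs
    simp only [mem_erase] at hs
    exact h b hb s hs.2.2 hs.1.symm (fun e => hs.1 e.2) (fun e => hs.2.1 e.2)

lemma DT {d : ℕ} (hd : 4 ≤ d) (hG : Cls d G) (hN : ¬ ColOn G d univ) (hV : VC d G)
    {T : Finset V} {a b : V} (hT : T.card = d + 1) (ha : a ∈ T) (hb : b ∈ T)
    (hab : a ≠ b) (h : NC G T a b) : KM d G := by
  refine KM_of hT ha hb hab h ?_ hd
  have := dlemma hd hG hN hV (S := (T.erase a).erase b) (a := a) (b := b) ?_ ?_ hab ?_ ?_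
  · tauto
  · intro p hp q hq hpq
    simp only [mem_erase] at hp hq
    exact h p hp.2.2 q hq.2.2 hpq (fun e => hp.2.1 e.1) (fun e => hp.1 e.1)
  · rw [card_erase_of_mem (by simp [hb, hab.symm]), card_erase_of_mem ha]; omega
  · intro s hs
    simp only [mem_erase] at hs
    exact h a ha s hs.2.2 hs.2.1.symm (fun e => hs.1 e.2) (fun e => hs.2.1 e.2)
  · intro s hs
    simp only [mem_erase] at hs
    exact h b hb s hs.2.2 hs.1.symm (fun e => hs.1 e.2) (fun e => hs.2.1 e.2)

/-- the converse presentation -/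
lemma KM_T {d : ℕ} (h : KM d G) : ∃ (T : Finset V) (a b : V), T.card = d + 1 ∧ a ∈ T ∧ b ∈ T ∧
    a ≠ b ∧ NC G T a b ∧ (G.Adj a b ∨ (dg G a = d + 1 ∧ dg G b = d + 1)) := by
  obtain ⟨S, a, b, hS, hc, hab, ha, hb, h'⟩ := h
  have haS' : a ∉ S := fun h => (ha a h).ne rfl
  have hbS' : b ∉ S := fun h => (hb b h).ne rfl
  refine ⟨insert a (insert b S), a, b, ?_, by simp, by simp, hab, ?_, h'⟩
  · rw [card_insert_of_notMem (by simp [hab, haS']), card_insert_of_notMem hbS']; omega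
  · intro p hp q hq hpq h1 h2
    simp only [mem_insert] at hp hq
    rcases hp with rfl | rfl | hp <;> rcases hq with rfl | rfl | hq
    · exact absurd rfl hpq
    · exact absurd ⟨rfl, rfl⟩ h1
    · exact ha _ hq
    · exact absurd ⟨rfl, rfl⟩ h2
    · exact absurd rfl hpq
    · exact hb _ hq
    · exact (ha _ hp).symm
    · exact (hb _ hp).symm
    · exact hS _ hp _ hq hpq

lemma dg_mono {H : SimpleGraph V} (h : H ≤ G) (v : V) : dg H v ≤ dg G v := by
  apply card_le_card
  intro w; simp only [mem_nb]; exact fun hw => ⟨hw.1, h hw.2⟩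

lemma KM_mono {d : ℕ} {H : SimpleGraph V} (h : H ≤ G) (hG : ∀ v, dg G v ≤ d + 1) (hk : KM d H) :
    KM d G := by
  obtain ⟨S, a, b, hS, hc, hab, ha, hb, h'⟩ := hk
  refine ⟨S, a, b, fun u hu v hv huv => h (hS u hu v hv huv), hc, hab, fun s hs => h (ha s hs),
    fun s hs => h (hb s hs), ?_⟩
  rcases h' with h' | h'
  · exact Or.inl (h h')
  · right
    have := dg_mono h a
    have := dg_mono h b
    have := hG a
    have := hG b
    omega

def delS (G : SimpleGraph V) (X : Finset V) : SimpleGraph V where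
  Adj u v := G.Adj u v ∧ u ∉ X ∧ v ∉ X
  symm := ⟨fun _ _ h => ⟨h.1.symm, h.2.2, h.2.1⟩⟩
  loopless := ⟨fun _ h => h.1.ne rfl⟩

lemma delS_le (X : Finset V) : delS G X ≤ G := fun _ _ h => h.1

lemma Cls.mono {d : ℕ} {H : SimpleGraph V} (hG : Cls d G) (h : H ≤ G) : Cls d H := by
  refine ⟨fun v => (dg_mono h v).trans (hG.le v), fun u v hu hv huv => ?_⟩
  have := dg_mono h u
  have := dg_mono h v
  have := hG.le u
  have := hG.le v
  exact hG.ind u v (by omega) (by omega) (h huv)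

/-- deleting the edges at a vertex whose removal does not help -/
lemma del_step {d : ℕ} {v : V} (hv : 0 < dg G v) (hN : ¬ ColOn G d (univ.erase v)) :
    ¬ ColOn (delS G {v}) d univ ∧ ∑ x, dg (delS G {v}) x < ∑ x, dg G x := by
  constructor
  · rintro ⟨c, hc⟩
    refine hN ⟨c, fun u _ => hc.1 u (mem_univ _), fun u hu w hw huw => ?_⟩
    refine hc.2 u (mem_univ _) w (mem_univ _) ⟨huw, ?_, ?_⟩
    · simpa using hu
    · simpa using hw
  · refine sum_lt_sum (fun x _ => dg_mono (delS_le _) x) ⟨v, mem_univ _, ?_⟩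
    have : dg (delS G {v}) v = 0 := by
      simp only [dg, card_eq_zero, eq_empty_iff_forall_notMem]
      intro w hw
      have := (mem_nb.1 hw).2.2.1
      simp at this
    omega

lemma low_or {d : ℕ} (hG : Cls d G) (v : V) : dg G v ≤ d ∨ dg G v = d + 1 := by
  have := hG.le v; omega

end HD

namespace HD
open Finset
set_option linter.unusedSectionVars false
variable {V : Type*} [Fintype V] [DecidableEq V] {G : SimpleGraph V}

noncomputable def ee (G : SimpleGraph V) (S : Finset V) : ℕ := ∑ v ∈ S, (nb G v S).card

lemma nb_erase_card {u v : V} {U : Finset V} (hv : v ∈ U) (h : G.Adj u v) :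
    (nb G u U).card = (nb G u (U.erase v)).card + 1 := by
  have : nb G u U = insert v (nb G u (U.erase v)) := by
    ext w; simp only [mem_nb, mem_insert, mem_erase]
    by_cases hw : w = v
    · subst hw; simp [hv, h]
    · simp [hw]
  rw [this, card_insert_of_notMem (by simp)]

lemma nb_erase_nadj {u v : V} {U : Finset V} (h : ¬ G.Adj u v) :
    nb G u (U.erase v) = nb G u U := by
  ext w; simp only [mem_nb, mem_erase]
  by_cases hw : w = v
  · subst hw; simp [h]
  · simp [hw]

lemma nb_insert_nadj {u v : V} {U : Finset V} (h : ¬ G.Adj u v) :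
    nb G u (insert v U) = nb G u U := by
  ext w; simp only [mem_nb, mem_insert]
  by_cases hw : w = v
  · subst hw; simp [h]
  · simp [hw]

lemma ee_erase {v : V} {U : Finset V} (hv : v ∈ U) :
    ee G U = ee G (U.erase v) + 2 * (nb G v U).card := by
  classical
  unfold ee
  rw [← add_sum_erase U _ hv]
  have h1 : ∀ u ∈ U.erase v, (nb G u U).card = (nb G u (U.erase v)).card +
      if G.Adj v u then 1 else 0 := by
    intro u _
    by_cases h : G.Adj v u
    · simp only [h, if_true]; exact nb_erase_card hv h.symm
    · simp only [h, if_false]; rw [nb_erase_nadj (fun e => h e.symm)]; rfl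
  rw [sum_congr rfl h1, sum_add_distrib]
  have h2 : ∑ u ∈ U.erase v, (if G.Adj v u then 1 else 0) = (nb G v U).card := by
    rw [← card_filter]
    congr 1
    ext w; simp only [mem_filter, mem_nb, mem_erase]
    constructor
    · rintro ⟨⟨_, h⟩, h'⟩; exact ⟨h, h'⟩
    · rintro ⟨h, h'⟩; exact ⟨⟨h'.ne', h⟩, h'⟩
  rw [h2]; omega

lemma ee_even : ∀ U : Finset V, Even (ee G U) := by
  intro U
  induction U using Finset.induction_on with
  | empty => simp [ee]
  | insert v U hv ih =>
    rw [ee_erase (mem_insert_self v U), erase_insert hv]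
    exact ih.add (even_two_mul _)

def Conn (G : SimpleGraph V) (Z : Finset V) : Prop := ∀ P ⊆ Z, P.Nonempty →
  (∀ u ∈ P, ∀ v ∈ Z, G.Adj u v → v ∈ P) → Z ⊆ P

def Closed (G : SimpleGraph V) (R U : Finset V) : Prop :=
  ∀ u ∈ R, ∀ v ∈ U, G.Adj u v → v ∈ R

lemma conn_insert {z p : V} {R : Finset V} (hR : Conn G R) (hp : p ∈ R) (hzp : G.Adj z p) :
    Conn G (insert z R) := by
  intro P hP hne hcl
  have hpP : p ∈ P := by
    by_cases h : (P ∩ R).Nonempty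
    · have := hR (P ∩ R) inter_subset_right h (fun u hu v hv huv => by
        rw [mem_inter] at hu ⊢
        exact ⟨hcl u hu.1 v (mem_insert_of_mem hv) huv, hv⟩)
      exact (mem_inter.1 (this hp)).1
    · obtain ⟨x, hx⟩ := hne
      rcases mem_insert.1 (hP hx) with rfl | hxR
      · exact hcl x hx p (mem_insert_of_mem hp) hzp
      · exact absurd ⟨x, mem_inter.2 ⟨hx, hxR⟩⟩ h
  have := hR (P ∩ R) inter_subset_right ⟨p, mem_inter.2 ⟨hpP, hp⟩⟩ (fun u hu v hv huv => by
        rw [mem_inter] at hu ⊢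
        exact ⟨hcl u hu.1 v (mem_insert_of_mem hv) huv, hv⟩)
  intro x hx
  rcases mem_insert.1 hx with rfl | hx
  · exact hcl p hpP x (mem_insert_self _ _) hzp.symm
  · exact (mem_inter.1 (this hx)).1

lemma exists_comp {x : V} {U : Finset V} (hx : x ∈ U) :
    ∃ Z ⊆ U, x ∈ Z ∧ Closed G Z U ∧ Conn G Z := by
  have key : ∀ n, ∀ Z ⊆ U, Z.card = n → x ∈ Z → Closed G Z U →
      ∃ Z ⊆ U, x ∈ Z ∧ Closed G Z U ∧ Conn G Z := by
    intro n
    induction n using Nat.strong_induction_on with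
    | _ n ih =>
      intro Z hZU hZn hxZ hcl
      by_cases hC : Conn G Z
      · exact ⟨Z, hZU, hxZ, hcl, hC⟩
      · unfold Conn at hC
        push Not at hC
        obtain ⟨P, hPZ, hne, hPc, hZP⟩ := hC
        by_cases hxP : x ∈ P
        · refine ih P.card ?_ P (hPZ.trans hZU) rfl hxP ?_
          · rw [← hZn]; exact card_lt_card ⟨hPZ, hZP⟩
          · intro u hu v hv huv
            exact hPc u hu v (hcl u (hPZ hu) v hv huv) huv
        · refine ih (Z \ P).card ?_ (Z \ P) (sdiff_subset.trans hZU) rfl (by simp [hxZ, hxP]) ?_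
          · rw [← hZn]
            obtain ⟨q, hq⟩ := hne
            refine card_lt_card ⟨sdiff_subset, fun h => ?_⟩
            have := h (hPZ hq)
            simp [hq] at this
          · intro u hu v hv huv
            rw [mem_sdiff] at hu ⊢
            have hvZ := hcl u hu.1 v hv huv
            exact ⟨hvZ, fun hvP => hu.2 (hPc v hvP u hu.1 huv.symm)⟩
  exact key _ U Subset.rfl rfl hx (fun _ _ v hv _ => hv)

structure GB (G : SimpleGraph V) (r : ℕ) (Z : Finset V) : Prop where
  reg : ∀ z ∈ Z, (nb G z Z).card = r
  conn : Conn G Z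
  ncol : ¬ ColOn G r Z
  cl : Clq G Z ∨ r = 2

lemma GB.conn_erase {r : ℕ} {Z : Finset V} (h : GB G r Z) {y : V} (hy : y ∈ Z) :
    Conn G (Z.erase y) := by
  classical
  rcases h.cl with hcl | rfl
  · intro P hP hne hPc v hv
    obtain ⟨p, hp⟩ := hne
    by_cases hpv : p = v
    · exact hpv ▸ hp
    · exact hPc p hp v hv (hcl p (mem_erase.1 (hP hp)).2 v (mem_erase.1 hv).2 hpv)
  · -- every nonempty closed part touches y
    have touch : ∀ P ⊆ Z.erase y, P.Nonempty → Closed G P (Z.erase y) → 0 < (nb G y P).card := by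
      intro P hP hne hPc
      by_contra h0
      have h0 : nb G y P = ∅ := by rw [← card_eq_zero]; omega
      have := h.conn P (hP.trans (erase_subset _ _)) hne (by
        intro u hu v hv huv
        by_cases hvy : v = y
        · subst hvy
          have : u ∈ nb G v P := by simp [hu, huv.symm]
          rw [h0] at this; simp at this
        · exact hPc u hu v (by simp [hv, hvy]) huv)
      have := hP (this hy)
      simp at this
    intro P hP hne hPc
    by_contra hZP
    have h1 := touch P hP hne hPc
    have h2 := touch (Z.erase y \ P) sdiff_subset (by
      rw [sdiff_nonempty]; exact hZP) (by
      intro u hu v hv huv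
      rw [mem_sdiff] at hu ⊢
      exact ⟨hv, fun hvP => hu.2 (hPc v hvP u hu.1 huv.symm)⟩)
    have h3 : (nb G y P).card + (nb G y (Z.erase y \ P)).card = 2 := by
      rw [← h.reg y hy, ← card_union_of_disjoint]
      · congr 1
        ext w; simp only [mem_union, mem_nb, mem_sdiff, mem_erase]
        constructor
        · rintro (⟨hw, ha⟩ | ⟨⟨⟨_, hw⟩, _⟩, ha⟩)
          · exact ⟨(mem_erase.1 (hP hw)).2, ha⟩
          · exact ⟨hw, ha⟩
        · rintro ⟨hw, ha⟩
          by_cases hwP : w ∈ P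
          · exact Or.inl ⟨hwP, ha⟩
          · exact Or.inr ⟨⟨⟨ha.ne', hw⟩, hwP⟩, ha⟩
      · rw [disjoint_left]; intro w hw hw'
        simp only [mem_nb, mem_sdiff] at hw hw'
        exact hw'.1.2 hw.1
    have h4 : ∀ v ∈ P, (nb G v P).card + (if G.Adj y v then 1 else 0) = 2 := by
      intro v hv
      have hvZ := (mem_erase.1 (hP hv))
      have h5 : nb G v P = nb G v (Z.erase y) := by
        ext w; simp only [mem_nb]
        exact ⟨fun hw => ⟨hP hw.1, hw.2⟩, fun hw => ⟨hPc v hv w hw.1 hw.2, hw.2⟩⟩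
      rw [h5, ← h.reg v hvZ.2]
      by_cases hyv : G.Adj y v
      · simp only [hyv, if_true]; rw [nb_erase_card hy hyv.symm]
      · simp only [hyv, if_false]; rw [nb_erase_nadj (fun e => hyv e.symm)]; rfl
    have h6 := sum_congr (rfl : P = P) h4
    rw [sum_add_distrib, sum_const] at h6
    have h7 : ∑ u ∈ P, (if G.Adj y u then 1 else 0) = (nb G y P).card := by
      rw [← card_filter]
      congr 1
    rw [h7] at h6
    have h8 := ee_even (G := G) P
    unfold ee at h8
    obtain ⟨m, hm⟩ := h8
    rw [hm] at h6
    simp only [smul_eq_mul] at h6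
    omega

lemma GB.low_edge {d r : ℕ} {Z : Finset V} (hG : Cls d G) (h : GB G r Z) (hr : 2 ≤ r) (e : V) :
    ∃ y ∈ Z, ∃ u ∈ Z, dg G y ≤ d ∧ dg G u ≤ d ∧ G.Adj u y ∧ y ≠ e := by
  classical
  have : ∃ p ∈ Z, ∃ q ∈ Z, dg G p ≤ d ∧ dg G q ≤ d ∧ G.Adj p q := by
    by_contra! hcon
    refine h.ncol ⟨fun v => if dg G v ≤ d then 0 else 1, ?_, ?_⟩
    · intro v _
      dsimp only
      split <;> omega
    · intro u hu v hv huv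
      by_cases hul : dg G u ≤ d
      · have hvl : ¬ dg G v ≤ d := fun hvl => hcon u hu v hv hul hvl huv
        simp [hul, hvl]
      · have hvl : dg G v ≤ d := hG.low hul huv
        simp [hul, hvl]
  obtain ⟨p, hp, q, hq, hpl, hql, hpq⟩ := this
  by_cases hpe : p = e
  · exact ⟨q, hq, p, hp, hql, hpl, hpq, fun hqe => hpq.ne (hpe.trans hqe.symm)⟩
  · exact ⟨p, hp, q, hq, hpl, hql, hpq.symm, hpe⟩

lemma GB.twins {r : ℕ} {Z : Finset V} (h : GB G r Z) {y z : V} (hy : y ∈ Z) (hz : z ∈ Z)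
    (hyz : G.Adj y z) (ht : ∀ v ∈ Z, v ≠ y → v ≠ z → (G.Adj y v ↔ G.Adj z v)) :
    Clq G Z := by
  rcases h.cl with hcl | rfl
  · exact hcl
  have h1 : ((nb G y Z).erase z).card = 1 := by
    rw [card_erase_of_mem (by simp [hz, hyz]), h.reg y hy]
  obtain ⟨t, ht1⟩ := card_eq_one.1 h1
  have htm : t ∈ (nb G y Z).erase z := by rw [ht1]; simp
  simp only [mem_erase, mem_nb] at htm
  obtain ⟨htz, htZ, hyt⟩ := htm
  have hzt : G.Adj z t := (ht t htZ hyt.ne' htz).1 hyt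
  have hT : Clq G {y, z, t} := by
    intro u hu v hv huv
    simp only [mem_insert, mem_singleton] at hu hv
    rcases hu with rfl | rfl | rfl <;> rcases hv with rfl | rfl | rfl <;>
      first | exact absurd rfl huv | assumption | (apply SimpleGraph.Adj.symm; assumption)
  have hsub : ({y, z, t} : Finset V) ⊆ Z := by
    intro v hv; simp only [mem_insert, mem_singleton] at hv
    rcases hv with rfl | rfl | rfl <;> assumption
  have h3 : ({y, z, t} : Finset V).card = 3 := by
    rw [card_eq_three]; exact ⟨y, z, t, hyz.ne, hyt.ne, htz.symm, rfl⟩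
  have := h.conn {y, z, t} hsub ⟨y, by simp⟩ (by
    intro u hu v hv huv
    have hs : (({y, z, t} : Finset V).erase u) ⊆ nb G u Z := by
      intro w hw
      rw [mem_erase] at hw
      rw [mem_nb]
      exact ⟨hsub hw.2, hT u hu w hw.2 hw.1.symm⟩
    have he := eq_of_subset_of_card_le hs (by
      rw [h.reg u (hsub hu), card_erase_of_mem hu, h3])
    have : v ∈ nb G u Z := by simp [hv, huv]
    rw [← he] at this
    exact (mem_erase.1 this).2)
  intro u hu v hv huv
  exact hT u (this hu) v (this hv) huv

lemma GB.clq_card {r : ℕ} {Z : Finset V} (h : GB G r Z) (hc : Clq G Z) {y : V} (hy : y ∈ Z) :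
    Z.card = r + 1 := by
  have : nb G y Z = Z.erase y := by
    ext w; simp only [mem_nb, mem_erase]
    exact ⟨fun hw => ⟨hw.2.ne', hw.1⟩, fun hw => ⟨hw.2, hc y hy w hw.2 hw.1.symm⟩⟩
  have h1 := h.reg y hy
  rw [this, card_erase_of_mem hy] at h1
  have : 0 < Z.card := card_pos.2 ⟨y, hy⟩
  omega

end HD

namespace HD
open Finset
set_option linter.unusedSectionVars false
variable {V : Type*} [Fintype V] [DecidableEq V] {G : SimpleGraph V}

structure St (G : SimpleGraph V) (r : Bool → ℕ) (x : V) (P : Bool → Finset V) : Prop where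
  nmem : ∀ b, x ∉ P b
  disj : ∀ b, Disjoint (P b) (P (!b))
  cov : ∀ v, v ≠ x → ∀ b, v ∈ P b ∨ v ∈ P (!b)
  col : ∀ b, ColOn G (r b) (P b)

def MS (G : SimpleGraph V) (r : Bool → ℕ) (x : V) (P : Bool → Finset V) : Prop :=
  St G r x P ∧ ∀ x' P', St G r x' P' →
    ee G (P true) + ee G (P false) ≤ ee G (P' true) + ee G (P' false)

lemma MS.le {r : Bool → ℕ} {x x' : V} {P P' : Bool → Finset V} (h : MS G r x P)
    (h' : St G r x' P') (b : Bool) : ee G (P b) + ee G (P !b) ≤ ee G (P' b) + ee G (P' !b) := by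
  have := h.2 x' P' h'
  cases b <;> simp <;> omega

/-- standing assumptions -/
structure Ctx (d : ℕ) (G : SimpleGraph V) (r : Bool → ℕ) : Prop where
  hd : 4 ≤ d
  cls : Cls d G
  hN : ¬ ColOn G d univ
  r2 : ∀ b, 2 ≤ r b
  rs : ∀ b, r b + r (!b) = d

variable {d : ℕ} {r : Bool → ℕ} {x : V} {P : Bool → Finset V} {b : Bool}

lemma comb {k1 k2 : ℕ} {A B : Finset V} (hA : ColOn G k1 A) (hB : ColOn G k2 B)
    (h : ∀ v, v ∈ A ∨ v ∈ B) : ColOn G (k1 + k2) univ := by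
  obtain ⟨c1, h1⟩ := hA
  obtain ⟨c2, h2⟩ := hB
  have hB' : ∀ v, v ∉ A → v ∈ B := fun v hv => (h v).resolve_left hv
  refine ⟨fun v => if v ∈ A then c1 v else k1 + c2 v, ?_, ?_⟩
  · intro v _
    by_cases hv : v ∈ A
    · have := h1.1 v hv
      simp only [hv, if_true]; omega
    · have := h2.1 v (hB' v hv)
      simp only [hv, if_false]; omega
  · intro u _ v _ huv
    by_cases hu : u ∈ A <;> by_cases hv : v ∈ A <;> simp only [hu, hv, if_true, if_false]
    · exact h1.2 u hu v hv huv
    · have := h1.1 u hu; omega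
    · have := h1.1 v hv; omega
    · have := h2.2 u (hB' u hu) v (hB' v hv) huv; omega

lemma St.ncol (hC : Ctx d G r) (h : St G r x P) (b : Bool) :
    ¬ ColOn G (r b) (insert x (P b)) := by
  intro hc
  apply hC.hN
  rw [← hC.rs b]
  refine comb hc (h.col (!b)) (fun v => ?_)
  by_cases hv : v = x
  · simp [hv]
  · rcases h.cov v hv b with h | h <;> simp [h]

lemma St.ge (hC : Ctx d G r) (h : St G r x P) (b : Bool) : r b ≤ (nb G x (P b)).card := by
  by_contra hlt
  obtain ⟨c, hc⟩ := h.col b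
  obtain ⟨a, ha⟩ := ext1 (v := x) hc (lt_of_le_of_lt card_image_le (by omega))
  exact h.ncol hC b ⟨_, ha⟩

lemma St.sum_le (h : St G r x P) (b : Bool) :
    (nb G x (P b)).card + (nb G x (P !b)).card ≤ dg G x := by
  apply add_nb_le
  · intro v hv; exact (mem_nb.1 hv).2
  · exact disjoint_of_subset_left (fun v hv => (mem_nb.1 hv).1) (h.disj b)

lemma St.low (hC : Ctx d G r) (h : St G r x P) (hx : dg G x ≤ d) (b : Bool) :
    (nb G x (P b)).card = r b := by
  have h1 := h.ge hC b
  have h2 := h.ge hC (!b)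
  have h3 := h.sum_le b
  have h4 := hC.rs b
  omega

def mv (P : Bool → Finset V) (b : Bool) (x w : V) : Bool → Finset V :=
  Function.update P b ((insert x (P b)).erase w)

@[simp] lemma mv_same {w : V} : mv P b x w b = (insert x (P b)).erase w := by simp [mv]
@[simp] lemma mv_not {w : V} : mv P b x w (!b) = P (!b) := by simp [mv]
lemma mv_not' {w : V} {b' : Bool} (h : b' ≠ b) : mv P b x w b' = P b' := by simp [mv, h]

lemma swap (hC : Ctx d G r) (h : MS G r x P) (hx : (nb G x (P b)).card = r b) {w : V}
    (hw : w ∈ P b) (hxw : G.Adj x w) :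
    (nb G w (insert x (P b))).card = r b ∧ MS G r w (mv P b x w) := by
  have hxP := h.1.nmem b
  have hwn : w ∉ P (!b) := disjoint_left.1 (h.1.disj b) hw
  have hr := hC.r2 b
  have hst : St G r w (mv P b x w) := by
    have key : ∀ b', b' = b ∨ b' = !b := by intro b'; cases b <;> cases b' <;> simp
    have hd1 : Disjoint (mv P b x w b) (mv P b x w (!b)) := by
      simp only [mv_same, mv_not]
      rw [disjoint_left]
      intro v hv
      rw [mem_erase, mem_insert] at hv
      rcases hv.2 with rfl | hv
      · exact h.1.nmem _
      · exact disjoint_left.1 (h.1.disj b) hv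
    have hc1 : ∀ v, v ≠ w → v ∈ mv P b x w b ∨ v ∈ mv P b x w (!b) := by
      intro v hv
      simp only [mv_same, mv_not, mem_erase, mem_insert]
      by_cases hvx : v = x
      · subst hvx; exact Or.inl ⟨hv, Or.inl rfl⟩
      · rcases h.1.cov v hvx b with h | h
        · exact Or.inl ⟨hv, Or.inr h⟩
        · exact Or.inr h
    refine ⟨?_, ?_, ?_, ?_⟩
    · intro b'
      rcases key b' with rfl | rfl
      · simp
      · simpa using hwn
    · intro b'
      rcases key b' with rfl | rfl
      · exact hd1
      · rw [Bool.not_not]; exact hd1.symm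
    · intro v hv b'
      rcases key b' with rfl | rfl
      · exact hc1 v hv
      · rw [Bool.not_not]; exact (hc1 v hv).symm
    · intro b'
      rcases key b' with rfl | rfl
      · obtain ⟨c, hc⟩ := h.1.col b'
        obtain ⟨a, ha⟩ := ext1 (v := x) (W := (P b').erase w) (hc.mono (erase_subset _ _))
          (lt_of_le_of_lt card_image_le (by
            have := nb_erase_card (U := P b') hw hxw
            omega))
        rw [mv_same, erase_insert_of_ne hxw.ne]
        exact ⟨_, ha⟩
      · rw [mv_not]; exact h.1.col _
  have hUx : (insert x (P b)).erase x = P b := erase_insert hxP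
  have e1 := ee_erase (G := G) (mem_insert_self x (P b))
  have e2 := ee_erase (G := G) (v := w) (U := insert x (P b)) (mem_insert_of_mem hw)
  rw [hUx] at e1
  have e3 : nb G x (insert x (P b)) = nb G x (P b) := nb_insert_nadj (G.loopless.irrefl x)
  rw [e3] at e1
  have e4 := h.le hst b
  rw [mv_same, mv_not] at e4
  have e5 := hst.ge hC b
  rw [mv_same, nb_erase_nadj (G.loopless.irrefl w)] at e5
  refine ⟨by omega, hst, fun x' P' h' => ?_⟩
  have e6 := h.le h' b
  have e7 : ee G (mv P b x w b) + ee G (mv P b x w !b) ≤ ee G (P' b) + ee G (P' !b) := by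
    rw [mv_same, mv_not]; omega
  cases b <;> simp at e7 ⊢ <;> omega

lemma mv_mv {z v : V} (hz : z ∈ insert x (P b)) : mv (mv P b x z) b z v = mv P b x v := by
  unfold mv
  simp [insert_erase hz]

lemma mv_self (hx : x ∉ P b) : mv P b x x = P := by
  unfold mv
  rw [erase_insert hx]; simp

lemma walk (hC : Ctx d G r) (h : MS G r x P) (hx : (nb G x (P b)).card = r b) {Z : Finset V}
    (hxZ : x ∈ Z) (hZ : Z ⊆ insert x (P b)) (hcn : Conn G Z) :
    ∀ z ∈ Z, (nb G z (insert x (P b))).card = r b ∧ MS G r z (mv P b x z) := by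
  classical
  have e3 : nb G x (insert x (P b)) = nb G x (P b) := nb_insert_nadj (G.loopless.irrefl x)
  have := hcn (Z.filter fun z => (nb G z (insert x (P b))).card = r b ∧ MS G r z (mv P b x z))
    (filter_subset _ _) ⟨x, by
      rw [mem_filter]; refine ⟨hxZ, by rw [e3, hx], ?_⟩
      rw [mv_self (h.1.nmem b)]; exact h⟩ (by
    intro u hu v hv huv
    rw [mem_filter] at hu ⊢
    refine ⟨hv, ?_⟩
    obtain ⟨huZ, hur, hum⟩ := hu
    have hins : insert u (mv P b x u b) = insert x (P b) := by
      rw [mv_same, insert_erase (hZ huZ)]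
    have := swap (b := b) hC hum (by
      rw [mv_same, nb_erase_nadj (G.loopless.irrefl u), hur]) (w := v) (by
      rw [mv_same, mem_erase]; exact ⟨huv.ne', hZ hv⟩) huv
    rw [hins, mv_mv (hZ huZ)] at this
    exact this)
  intro z hz
  exact (mem_filter.1 (this hz)).2

lemma comp (hC : Ctx d G r) (h : MS G r x P) (hx : (nb G x (P b)).card = r b) :
    ∃ Z ⊆ insert x (P b), x ∈ Z ∧ Closed G Z (insert x (P b)) ∧ GB G (r b) Z := by
  obtain ⟨Z, hZU, hxZ, hcl, hcn⟩ := exists_comp (G := G) (mem_insert_self x (P b))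
  have hw := walk hC h hx hxZ hZU hcn
  have hreg : ∀ z ∈ Z, (nb G z Z).card = r b := by
    intro z hz
    rw [← (hw z hz).1]
    congr 1
    ext w; simp only [mem_nb]
    exact ⟨fun e => ⟨hZU e.1, e.2⟩, fun e => ⟨hcl z hz w e.1 e.2, e.2⟩⟩
  have hncol : ¬ ColOn G (r b) Z := by
    rintro ⟨c1, h1⟩
    obtain ⟨c2, h2⟩ := h.1.col b
    apply h.1.ncol hC b
    have hP : ∀ v ∈ insert x (P b), v ∉ Z → v ∈ P b := by
      intro v hv hvZ
      rcases mem_insert.1 hv with rfl | hv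
      · exact absurd hxZ hvZ
      · exact hv
    refine ⟨fun v => if v ∈ Z then c1 v else c2 v, ?_, ?_⟩
    · intro v hv
      by_cases hvZ : v ∈ Z
      · simp only [hvZ, if_true]; exact h1.1 v hvZ
      · simp only [hvZ, if_false]; exact h2.1 v (hP v hv hvZ)
    · intro u hu v hv huv
      by_cases huZ : u ∈ Z <;> by_cases hvZ : v ∈ Z <;> simp only [huZ, hvZ, if_true, if_false]
      · exact h1.2 u huZ v hvZ huv
      · exact absurd (hcl u huZ v hv huv) hvZ
      · exact absurd (hcl v hvZ u hu huv.symm) huZ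
      · exact h2.2 u (hP u hu huZ) v (hP v hv hvZ) huv
  refine ⟨Z, hZU, hxZ, hcl, hreg, hcn, hncol, ?_⟩
  by_cases hr : r b = 2
  · exact Or.inr hr
  left
  have hr2 := hC.r2 b
  obtain ⟨K, hKZ, hKc, hK⟩ := brooks (r := r b) (by omega) Z (fun v hv => (hreg v hv).le) hncol
  have := hcn K hKZ (by rw [← card_pos]; omega) (by
    intro u hu v hv huv
    have hs : K.erase u ⊆ nb G u Z := by
      intro w hw
      rw [mem_erase] at hw
      rw [mem_nb]
      exact ⟨hKZ hw.2, hK u hu w hw.2 hw.1.symm⟩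
    have he := eq_of_subset_of_card_le hs (by
      rw [hreg u (hKZ hu), card_erase_of_mem hu, hKc]; omega)
    have : v ∈ nb G u Z := by simp [hv, huv]
    rw [← he] at this
    exact (mem_erase.1 this).2)
  intro u hu v hv huv
  exact hK u (this hu) v (this hv) huv

/-- re-entry -/
lemma re (hC : Ctx d G r) {z : V} (h : MS G r z P) (hz : dg G z ≤ d) {Z : Finset V} {y : V}
    (hyZ : y ∈ Z) (hRP : Z.erase y ⊆ P b) (hRc : Closed G (Z.erase y) (P b))
    (hGB : GB G (r b) Z) {p : V} (hp : p ∈ Z.erase y) (hzp : G.Adj z p) :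
    (∀ v ∈ Z.erase y, (G.Adj z v ↔ G.Adj y v)) ∧ (nb G z (P b) ⊆ Z.erase y) ∧
    ∀ v ∈ Z.erase y, MS G r v (mv P b z v) := by
  have hx := h.1.low hC hz b
  have hcn := conn_insert (hGB.conn_erase hyZ) hp hzp
  have hzP := h.1.nmem b
  have hw := walk hC h hx (mem_insert_self z (Z.erase y)) (insert_subset_insert _ hRP) hcn
  have h1 : ∀ v ∈ Z.erase y, (G.Adj z v ↔ G.Adj y v) := by
    intro v hv
    have e1 := (hw v (mem_insert_of_mem hv)).1
    have e2 := hGB.reg v (mem_erase.1 hv).2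
    have e3 : nb G v (P b) = nb G v (Z.erase y) := by
      ext w; simp only [mem_nb]
      exact ⟨fun e => ⟨hRc v hv w e.1 e.2, e.2⟩, fun e => ⟨hRP e.1, e.2⟩⟩
    constructor
    · intro hzv
      by_contra hyv
      rw [nb_erase_card (mem_insert_self z (P b)) hzv.symm, erase_insert hzP, e3,
        nb_erase_nadj (fun e => hyv e.symm)] at e1
      omega
    · intro hyv
      by_contra hzv
      rw [nb_insert_nadj (fun e => hzv e.symm), e3] at e1
      rw [nb_erase_card hyZ hyv.symm] at e2
      omega
  refine ⟨h1, ?_, fun v hv => (hw v (mem_insert_of_mem hv)).2⟩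
  have e1 : nb G z (Z.erase y) = nb G y (Z.erase y) := by
    ext v; simp only [mem_nb]
    exact ⟨fun e => ⟨e.1, (h1 v e.1).1 e.2⟩, fun e => ⟨e.1, (h1 v e.1).2 e.2⟩⟩
  have e2 := eq_of_subset_of_card_le (nb_mono (G := G) (v := z) hRP) (by
    rw [hx, e1, nb_erase_nadj (G.loopless.irrefl y), hGB.reg y hyZ])
  rw [← e2]
  intro v hv; exact (mem_nb.1 hv).1

/-- initial minimal state -/
lemma exists_MS (hC : Ctx d G r) (hV : VC d G) : ∃ x P, MS G r x P ∧ dg G x ≤ d := by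
  classical
  -- some vertex of positive degree
  have hpos : ∃ v, 0 < dg G v := by
    by_contra! h
    have hd := hC.hd
    refine hC.hN ⟨fun _ => 0, fun _ _ => show 0 < d by omega, fun u _ v _ huv => ?_⟩
    have := dg_pos huv
    have := h u
    omega
  obtain ⟨v, hv⟩ := hpos
  obtain ⟨c, hc⟩ := hV v hv
  have hst : ∃ k, ∃ x P, St G r x P ∧ ee G (P true) + ee G (P false) = k := by
    refine ⟨_, v, fun b => (univ.erase v).filter (fun w => decide (c w < r true) = b), ⟨?_, ?_, ?_, ?_⟩, rfl⟩
    · intro b; simp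
    · intro b
      rw [disjoint_left]; intro w hw hw'
      simp only [mem_filter] at hw hw'
      rw [hw.2] at hw'
      cases b <;> simp at hw'
    · intro w hw b
      simp only [mem_filter, mem_erase, mem_univ, and_true, hw, ne_eq, not_false_eq_true, true_and]
      cases b <;> cases decide (c w < r true) <;> simp
    · intro b
      have hrs := hC.rs true
      cases b
      · refine ⟨fun w => c w - r true, ?_, ?_⟩
        · intro w hw
          simp only [mem_filter, decide_eq_false_iff_not] at hw
          have := hc.1 w hw.1
          simp at hrs
          dsimp only
          omega
        · intro u hu w hw huw
          simp only [mem_filter, decide_eq_false_iff_not] at hu hw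
          have := hc.2 u hu.1 w hw.1 huw
          dsimp only
          omega
      · refine ⟨c, ?_, ?_⟩
        · intro w hw
          simp only [mem_filter, decide_eq_true_eq] at hw
          exact hw.2
        · intro u hu w hw huw
          simp only [mem_filter] at hu hw
          exact hc.2 u hu.1 w hw.1 huw
  obtain ⟨x, P, hxP, hk⟩ := Nat.find_spec hst
  have hM : MS G r x P := ⟨hxP, fun x' P' h' => by
    rw [hk]; exact Nat.find_min' hst ⟨x', P', h', rfl⟩⟩
  by_cases hx : dg G x ≤ d
  · exact ⟨x, P, hM, hx⟩
  have : ∃ b, (nb G x (P b)).card = r b := by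
    by_contra! hcon
    have h1 := hxP.ge hC true
    have h2 := hxP.ge hC false
    have h3 := hxP.sum_le true
    have h4 := hC.rs true
    have h5 := hC.cls.le x
    have h6 := hcon true
    have h7 := hcon false
    simp only [Bool.not_true] at h3 h4
    omega
  obtain ⟨b, hb⟩ := this
  have hr := hC.r2 b
  obtain ⟨w, hw⟩ := card_pos.1 (show 0 < (nb G x (P b)).card by omega)
  rw [mem_nb] at hw
  exact ⟨w, _, (swap hC hM hb hw.1 hw.2).2, hC.cls.low hx hw.2⟩

end HD

namespace HD
open Finset
set_option linter.unusedSectionVars false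
variable {V : Type*} [Fintype V] [DecidableEq V] {G : SimpleGraph V}

structure Res (d : ℕ) (G : SimpleGraph V) (r : Bool → ℕ) (b : Bool) (Z : Finset V) (y u : V)
    (P : Bool → Finset V) : Prop where
  sub : Z.erase y ⊆ P b
  clo : Closed G (Z.erase y) (P b)
  gb : GB G (r b) Z
  ymem : y ∈ Z
  ylow : dg G y ≤ d
  umem : u ∈ Z
  ulow : dg G u ≤ d
  adj : G.Adj u y

def F1 (d : ℕ) (G : SimpleGraph V) (Z Z' : Finset V) (y : V) : Prop :=
  ∀ u ∈ Z, dg G u ≤ d → G.Adj u y → ∀ w ∈ Z', w ≠ y → G.Adj u w →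
    (∀ v, G.Adj u v → v ∈ Z ∨ v ∈ Z') ∧ ∀ v ∈ Z', v ≠ y → (G.Adj u v ↔ G.Adj y v)

structure Hist (d : ℕ) (G : SimpleGraph V) (r : Bool → ℕ) (n : ℕ) (Z : ℕ → Finset V)
    (y u : ℕ → V) (P : Bool → Finset V) : Prop where
  ms : MS G r (y n) P
  res : ∀ j ≤ n, Res d G r j.bodd (Z j) (y j) (u j) P
  nxt : ∀ j < n, y j ∈ Z (j + 1) ∧ y (j + 1) ≠ y j ∧ F1 d G (Z j) (Z (j + 1)) (y j)
  dis : ∀ i j, i < j → j ≤ n → Disjoint ((Z i).erase (y i)) ((Z j).erase (y j))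

variable {d : ℕ} {r : Bool → ℕ} {x : V} {P : Bool → Finset V} {b : Bool}

lemma exitl (hC : Ctx d G r) (h : MS G r x P) (hx : dg G x ≤ d) {Z : Finset V}
    (hZ : Z ⊆ insert x (P b)) (hxZ : x ∈ Z) (hcl : Closed G Z (insert x (P b)))
    (hGB : GB G (r b) Z) (e : V) :
    ∃ y u, y ≠ e ∧ MS G r y (mv P b x y) ∧ Res d G r b Z y u (mv P b x y) := by
  obtain ⟨y, hy, u, hu, hyl, hul, huy, hye⟩ := hGB.low_edge hC.cls (hC.r2 b) e
  refine ⟨y, u, hye, (walk hC h (h.1.low hC hx b) hxZ hZ hGB.conn y hy).2, ?_, ?_, hGB, hy, hyl,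
    hu, hul, huy⟩
  · rw [mv_same]; exact erase_subset_erase _ hZ
  · rw [mv_same]
    intro s hs t ht hst
    rw [mem_erase] at hs ht ⊢
    exact ⟨ht.1, hcl s hs.2 t ht.2 hst⟩

lemma hist_zero (hC : Ctx d G r) (hV : VC d G) : ∃ Z y u P, Hist d G r 0 Z y u P := by
  obtain ⟨x, P, hM, hx⟩ := exists_MS hC hV
  obtain ⟨Z, hZ, hxZ, hcl, hGB⟩ := comp (b := false) hC hM (hM.1.low hC hx _)
  obtain ⟨y, u, -, hM', hR⟩ := exitl hC hM hx hZ hxZ hcl hGB x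
  refine ⟨fun _ => Z, fun _ => y, fun _ => u, _, hM', ?_, ?_, ?_⟩
  · intro j hj
    obtain rfl : j = 0 := by omega
    exact hR
  · intro j hj; omega
  · intro i j h1 h2; omega

lemma hist_bound {n : ℕ} {Z : ℕ → Finset V} {y u : ℕ → V} (h : Hist d G r n Z y u P) :
    n + 1 ≤ Fintype.card V := by
  have hm : ∀ j ≤ n, u j ∈ (Z j).erase (y j) := fun j hj =>
    mem_erase.2 ⟨(h.res j hj).adj.ne, (h.res j hj).umem⟩
  have hlt : ∀ i j, i < j → j ≤ n → u i ≠ u j := by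
    intro i j hij hj he
    have := disjoint_left.1 (h.dis i j hij hj) (hm i (by omega))
    exact this (he ▸ hm j hj)
  have := card_le_card_of_injOn (s := range (n + 1)) (t := (univ : Finset V)) u (by simp) (by
    intro i hi j hj he
    simp only [coe_range, Set.mem_Iio] at hi hj
    by_contra hne
    rcases Nat.lt_or_gt_of_ne hne with h1 | h1
    · exact hlt i j h1 (by omega) he
    · exact hlt j i h1 (by omega) he.symm)
  simpa using this

/-- extension when there is no revisit -/
lemma hist_step (hC : Ctx d G r) {n : ℕ} {Z : ℕ → Finset V} {y u : ℕ → V}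
    (h : Hist d G r n Z y u P)
    (hno : ∀ j ≤ n, j.bodd = !n.bodd → ∀ p ∈ (Z j).erase (y j), ¬ G.Adj (y n) p) :
    ∃ Z y u P, Hist d G r (n + 1) Z y u P := by
  obtain ⟨z, hz⟩ : ∃ z, z = y n := ⟨_, rfl⟩
  obtain ⟨b, hb⟩ : ∃ b, b = !n.bodd := ⟨_, rfl⟩
  have hM := h.ms
  rw [← hz] at hM hno
  rw [← hb] at hno
  have hzl : dg G z ≤ d := hz ▸ (h.res n le_rfl).ylow
  obtain ⟨Z', hZ', hzZ', hcl', hGB'⟩ := comp (b := b) hC hM (hM.1.low hC hzl _)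
  obtain ⟨y', u', hy'z, hM', hR'⟩ := exitl hC hM hzl hZ' hzZ' hcl' hGB' z
  have hdisj : ∀ j ≤ n, j.bodd = b → Disjoint ((Z j).erase (y j)) Z' := by
    intro j hj hjb
    rw [disjoint_iff_inter_eq_empty]
    by_contra hne
    have hres := h.res j hj
    rw [hjb] at hres
    have := hGB'.conn ((Z j).erase (y j) ∩ Z') inter_subset_right
      (nonempty_iff_ne_empty.2 hne) (by
        intro s hs t ht hst
        rw [mem_inter] at hs ⊢
        refine ⟨?_, ht⟩
        rcases mem_insert.1 (hZ' ht) with htz | htP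
        · subst htz; exact absurd hst.symm (hno j hj hjb s hs.1)
        · exact hres.clo s hs.1 t htP hst)
    have := hres.sub (mem_inter.1 (this hzZ')).1
    exact hM.1.nmem b this
  have hF1 : F1 d G (Z n) Z' z := by
    intro s hs hsl hsz w hw hwz hsw
    have hres := h.res n le_rfl
    rw [← hz] at hres
    have hZn : Z n ⊆ insert z (P n.bodd) := by
      intro t ht
      by_cases htz : t = z
      · simp [htz]
      · exact mem_insert_of_mem (hres.sub (mem_erase.2 ⟨htz, ht⟩))
    have hMs := (walk hC hM (hM.1.low hC hzl _) hres.ymem hZn hres.gb.conn s hs).2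
    have hPb : mv P n.bodd z s b = P b := by rw [hb, mv_not]
    have hsub : Z'.erase z ⊆ P b := by
      intro t ht
      rw [mem_erase] at ht
      rcases mem_insert.1 (hZ' ht.2) with h | h
      · exact absurd h ht.1
      · exact h
    have hre := re (b := b) hC hMs hsl hzZ' (by rw [hPb]; exact hsub) (by
      rw [hPb]
      intro p hp q hq hpq
      refine mem_erase.2 ⟨?_, hcl' p (mem_erase.1 hp).2 q (mem_insert_of_mem hq) hpq⟩
      rintro rfl; exact hM.1.nmem b hq) hGB' (mem_erase.2 ⟨hwz, hw⟩) hsw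
    refine ⟨?_, fun v hv hvz => hre.1 v (mem_erase.2 ⟨hvz, hv⟩)⟩
    intro v hsv
    by_cases hvz : v = z
    · left; rw [hvz]; exact hres.ymem
    rcases hM.1.cov v hvz b with hv | hv
    · right
      have := hre.2.1 (mem_nb.2 ⟨by rw [hPb]; exact hv, hsv⟩)
      exact (mem_erase.1 this).2
    · left
      rw [hb, Bool.not_not] at hv
      exact (mem_erase.1 (hres.clo s (mem_erase.2 ⟨hsz.ne, hs⟩) v hv hsv)).2
  have hbs : (n + 1).bodd = b := by rw [Nat.bodd_succ, hb]
  have hle : ∀ j ≤ n, j ≠ n + 1 := fun j hj => by omega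
  have hresnew : ∀ j ≤ n, Res d G r j.bodd (Z j) (y j) (u j) (mv P b z y') := by
    intro j hj
    have hres := h.res j hj
    refine ⟨?_, ?_, hres.gb, hres.ymem, hres.ylow, hres.umem, hres.ulow, hres.adj⟩
    · by_cases hjb : j.bodd = b
      · rw [hjb, mv_same]
        intro t ht
        refine mem_erase.2 ⟨?_, mem_insert_of_mem (hjb ▸ hres.sub ht)⟩
        rintro rfl
        exact disjoint_left.1 (hdisj j hj hjb) ht hR'.ymem
      · rw [mv_not' hjb]; exact hres.sub
    · by_cases hjb : j.bodd = b
      · rw [hjb, mv_same]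
        intro s hs t ht hst
        rcases mem_insert.1 (mem_erase.1 ht).2 with htz | htP
        · subst htz; exact absurd hst.symm (hno j hj hjb s hs)
        · exact hres.clo s hs t (hjb ▸ htP) hst
      · rw [mv_not' hjb]; exact hres.clo
  refine ⟨Function.update Z (n + 1) Z', Function.update y (n + 1) y', Function.update u (n + 1) u',
    mv P b z y', ?_, ?_, ?_, ?_⟩
  · rw [Function.update_self]; exact hM'
  · intro j hj
    rcases Nat.lt_or_ge n j with hj' | hj'
    · obtain rfl : j = n + 1 := by omega
      rw [Function.update_self, Function.update_self, Function.update_self, hbs]; exact hR'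
    · rw [Function.update_of_ne (hle j hj'), Function.update_of_ne (hle j hj'),
        Function.update_of_ne (hle j hj')]
      exact hresnew j hj'
  · intro j hj
    rw [Function.update_of_ne (hle j (by omega)), Function.update_of_ne (hle j (by omega))]
    rcases Nat.lt_or_ge j n with hj' | hj'
    · rw [Function.update_of_ne (hle (j + 1) (by omega)), Function.update_of_ne (hle (j + 1) (by omega))]
      exact h.nxt j hj'
    · obtain rfl : j = n := by omega
      rw [Function.update_self, Function.update_self, ← hz]
      exact ⟨hzZ', hy'z, hF1⟩
  · intro i j hij hj
    rw [Function.update_of_ne (hle i (by omega)), Function.update_of_ne (hle i (by omega))]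
    rcases Nat.lt_or_ge n j with hj' | hj'
    · obtain rfl : j = n + 1 := by omega
      rw [Function.update_self, Function.update_self]
      by_cases hib : i.bodd = b
      · exact disjoint_of_subset_right (erase_subset _ _) (hdisj i (by omega) hib)
      · have hib' : i.bodd = !b := by cases b <;> simpa using hib
        have h1 := (hresnew i (by omega)).sub
        rw [hib'] at h1
        exact (disjoint_of_subset_left hR'.sub (disjoint_of_subset_right h1 (hM'.1.disj b))).symm
    · rw [Function.update_of_ne (hle j hj'), Function.update_of_ne (hle j hj')]
      exact h.dis i j hij hj'

lemma hist_max (hC : Ctx d G r) (hV : VC d G) : ∃ n Z y u P, Hist d G r n Z y u P ∧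
    ∃ j ≤ n, j.bodd = (!n.bodd) ∧ ∃ p ∈ (Z j).erase (y j), G.Adj (y n) p := by
  by_contra! hcon
  have : ∀ n, ∃ Z y u P, Hist d G r n Z y u P := by
    intro n
    induction n with
    | zero => exact hist_zero hC hV
    | succ n ih =>
      obtain ⟨Z, y, u, P, h⟩ := ih
      exact hist_step hC h (hcon n Z y u P h)
  obtain ⟨Z, y, u, P, h⟩ := this (Fintype.card V)
  have := hist_bound h
  omega

lemma mozhan (hC : Ctx d G r) (hV : VC d G) : ∃ (A B : Finset V) (y u : V) (b : Bool),
    GB G (r b) A ∧ GB G (r (!b)) B ∧ Clq G B ∧ y ∈ A ∧ y ∈ B ∧ (∀ v ∈ A, v ∈ B → v = y) ∧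
    dg G y ≤ d ∧ u ∈ A ∧ dg G u ≤ d ∧ G.Adj u y ∧
    (∀ u ∈ A, dg G u ≤ d → G.Adj u y → ∀ v ∈ B, G.Adj u v) ∧
    (∀ w ∈ B, dg G w ≤ d → w ≠ y → ∀ v ∈ A, v ≠ y → (G.Adj w v ↔ G.Adj y v)) := by
  obtain ⟨n, Z, y, u, P, h, j, hjn, hjb, p, hp, hzp⟩ := hist_max hC hV
  have hjn' : j < n := by
    rcases Nat.lt_or_ge j n with h | h
    · exact h
    · obtain rfl : j = n := by omega
      cases hb : j.bodd <;> simp [hb] at hjb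
  have hM := h.ms
  have hzl := (h.res n le_rfl).ylow
  have hRj := h.res j hjn
  obtain ⟨hre1, hre2, hre3⟩ := re (b := j.bodd) hC hM hzl hRj.ymem hRj.sub hRj.clo hRj.gb hp hzp
  have hRj1 := h.res (j + 1) (by omega)
  rw [Nat.bodd_succ] at hRj1
  obtain ⟨hn1, hn2, hF⟩ := h.nxt j hjn'
  have hyR : y j ∈ (Z (j + 1)).erase (y (j + 1)) := mem_erase.2 ⟨hn2.symm, hn1⟩
  have key : ∀ s ∈ Z j, dg G s ≤ d → G.Adj s (y j) →
      (∀ v ∈ (Z (j + 1)).erase (y (j + 1)), (G.Adj s v ↔ G.Adj (y (j + 1)) v)) ∧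
      (∀ v, G.Adj s v → v ∈ Z j ∨ v ∈ Z (j + 1)) ∧
      ∀ v ∈ Z (j + 1), v ≠ y j → (G.Adj s v ↔ G.Adj (y j) v) := by
    intro s hs hsl hsy
    have hsR : s ∈ (Z j).erase (y j) := mem_erase.2 ⟨hsy.ne, hs⟩
    have hMs := hre3 s hsR
    have hPb : mv P j.bodd (y n) s (!j.bodd) = P (!j.bodd) := mv_not
    obtain ⟨g1, g2, g3⟩ := re (b := !j.bodd) hC hMs hsl hRj1.ymem (by rw [hPb]; exact hRj1.sub)
      (by rw [hPb]; exact hRj1.clo) hRj1.gb hyR hsy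
    have hcard := hRj1.gb.reg _ hRj1.ymem
    have hr := hC.r2 (!j.bodd)
    obtain ⟨w, hw, hwy⟩ : ∃ w ∈ nb G (y (j + 1)) (Z (j + 1)), w ≠ y j :=
      exists_mem_ne (by omega) _
    rw [mem_nb] at hw
    have hsw : G.Adj s w := (g1 w (mem_erase.2 ⟨hw.2.ne', hw.1⟩)).2 hw.2
    exact ⟨g1, hF s hs hsl hsy w hw.1 hwy hsw⟩
  have hu1 : u j ∈ (Z j).erase (y j) := mem_erase.2 ⟨hRj.adj.ne, hRj.umem⟩
  have hzu : G.Adj (y n) (u j) := (hre1 _ hu1).2 hRj.adj.symm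
  have hn : n = j + 1 := by
    by_contra hne
    have hnx := h.nxt (j + 1) (by omega)
    have hy2 : y (j + 1) ∈ (Z (j + 2)).erase (y (j + 2)) := mem_erase.2 ⟨hnx.2.1.symm, hnx.1⟩
    have hy2P := (h.res (j + 2) (by omega)).sub hy2
    rcases (key _ hRj.umem hRj.ulow hRj.adj).2.1 _ hzu.symm with hz | hz
    · by_cases he : y n = y j
      · exact hM.1.nmem _ (he ▸ hRj1.sub hyR)
      · exact hM.1.nmem _ (hRj.sub (mem_erase.2 ⟨he, hz⟩))
    · by_cases he : y n = y (j + 1)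
      · rw [← he] at hy2P
        exact hM.1.nmem _ hy2P
      · exact hM.1.nmem _ (hRj1.sub (mem_erase.2 ⟨he, hz⟩))
  subst hn
  obtain ⟨k1, k2, k3⟩ := key _ hRj.umem hRj.ulow hRj.adj
  have hzy : G.Adj (y (j + 1)) (y j) := (k1 _ hyR).1 hRj.adj
  have hB : Clq G (Z (j + 1)) := by
    refine hRj1.gb.twins hn1 hRj1.ymem hzy.symm (fun v hv hvy hvz => ?_)
    rw [← k3 v hv hvy, k1 v (mem_erase.2 ⟨hvz, hv⟩)]
  refine ⟨Z j, Z (j + 1), y j, u j, j.bodd, hRj.gb, hRj1.gb, hB, hRj.ymem, hn1, ?_, hRj.ylow,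
    hRj.umem, hRj.ulow, hRj.adj, ?_, ?_⟩
  · intro v hvA hvB
    by_contra hvy
    have hvR : v ∈ (Z j).erase (y j) := mem_erase.2 ⟨hvy, hvA⟩
    by_cases hvz : v = y (j + 1)
    · exact hM.1.nmem _ (hvz ▸ hRj.sub hvR)
    · exact disjoint_left.1 (h.dis j (j + 1) (by omega) le_rfl) hvR (mem_erase.2 ⟨hvz, hvB⟩)
  · intro s hs hsl hsy v hv
    obtain ⟨g1, g2, g3⟩ := key s hs hsl hsy
    by_cases hvy : v = y j
    · rw [hvy]; exact hsy
    · exact (g3 v hv hvy).2 (hB _ hn1 v hv (fun e => hvy e.symm))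
  · intro w hw hwl hwy
    have hwu : G.Adj (u j) w := (k3 w hw hwy).2 (hB _ hn1 w hw (fun e => hwy e.symm))
    have hZn : Z (j + 1) ⊆ insert (y (j + 1)) (P (!j.bodd)) := by
      intro t ht
      by_cases htz : t = y (j + 1)
      · simp [htz]
      · exact mem_insert_of_mem (hRj1.sub (mem_erase.2 ⟨htz, ht⟩))
    have hMw := (walk hC hM (hM.1.low hC hzl _) hRj1.ymem hZn hRj1.gb.conn w hw).2
    have hPb : mv P (!j.bodd) (y (j + 1)) w j.bodd = P j.bodd :=
      mv_not' (by cases j.bodd <;> simp)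
    obtain ⟨g1, -, -⟩ := re (b := j.bodd) hC hMw hwl hRj.ymem (by rw [hPb]; exact hRj.sub)
      (by rw [hPb]; exact hRj.clo) hRj.gb hu1 hwu.symm
    intro v hv hvy
    exact g1 v (mem_erase.2 ⟨hvy, hv⟩)

end HD

namespace HD
open Finset
set_option linter.unusedSectionVars false
variable {V : Type*} [Fintype V] [DecidableEq V] {G : SimpleGraph V}

def G1 (G : SimpleGraph V) (X : Finset V) (p q : V) (hpq : p ≠ q) : SimpleGraph V where
  Adj s t := (G.Adj s t ∧ s ∉ X ∧ t ∉ X) ∨ (s = p ∧ t = q) ∨ (s = q ∧ t = p)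
  symm := ⟨by
    rintro s t (h | h | h)
    · exact Or.inl ⟨h.1.symm, h.2.2, h.2.1⟩
    · exact Or.inr (Or.inr ⟨h.2, h.1⟩)
    · exact Or.inr (Or.inl ⟨h.2, h.1⟩)⟩
  loopless := ⟨by
    rintro s (h | h | h)
    · exact h.1.ne rfl
    · exact hpq (h.1.symm.trans h.2)
    · exact hpq (h.2.symm.trans h.1)⟩

variable {d : ℕ}

lemma plemma (hd : 4 ≤ d) (hG : Cls d G) (hN : ¬ ColOn G d univ) (hV : VC d G)
    (IH : ∀ H : SimpleGraph V, ∑ v, dg H v < ∑ v, dg G v → Cls d H → ¬ ColOn H d univ → KM d H)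
    {B : Finset V} {u u2 u' b0 : V} (hB : Clq G B) (hBc : B.card + 1 = d) (huB : u ∉ B)
    (hu2B : u2 ∉ B) (hu'B : u' ∉ B) (huu2 : u ≠ u2) (hu2u' : u2 ≠ u')
    (huu' : G.Adj u u') (hucomp : ∀ v ∈ B, G.Adj u v) (hul : dg G u ≤ d)
    (hb0 : b0 ∈ B) (hb0h : dg G b0 = d + 1) (hu2h : dg G u2 = d + 1)
    (hu2c : ∀ v ∈ B, v ≠ b0 → G.Adj u2 v) : KM d G := by
  obtain ⟨X, hX⟩ : ∃ X, X = insert u B := ⟨_, rfl⟩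
  have hmX : ∀ v, v ∈ X ↔ v = u ∨ v ∈ B := by intro v; simp [hX]
  obtain ⟨H, hH⟩ : ∃ H, H = G1 G X u2 u' hu2u' := ⟨_, rfl⟩
  have hHadj : ∀ s t, H.Adj s t ↔ (G.Adj s t ∧ s ∉ X ∧ t ∉ X) ∨ (s = u2 ∧ t = u') ∨
      (s = u' ∧ t = u2) := by intro s t; rw [hH]; rfl
  have hu2X : u2 ∉ X := by rw [hmX]; push Not; exact ⟨huu2.symm, hu2B⟩
  have hu'X : u' ∉ X := by rw [hmX]; push Not; exact ⟨huu'.ne', hu'B⟩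
  -- neighbours of u
  have hun : ∀ v, G.Adj u v → v ∉ X → v = u' := by
    intro v huv hvX
    by_contra hne
    have := add_nb_le (G := G) (v := u) (A := insert v (insert u' B)) (W := ∅) (by
      intro t ht
      simp only [mem_insert] at ht
      rcases ht with rfl | rfl | ht
      · exact huv
      · exact huu'
      · exact hucomp t ht) (disjoint_empty_right _)
    rw [card_insert_of_notMem (by
      simp only [mem_insert, not_or]
      refine ⟨hne, fun h => hvX ((hmX v).2 (Or.inr h))⟩), card_insert_of_notMem hu'B] at this
    omega
  have hHN : ¬ ColOn H d univ := by
    rintro ⟨c, hc⟩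
    apply hN
    have hcW : PC G d (univ \ X) c := by
      refine ⟨fun v _ => hc.1 v (mem_univ _), fun s hs t ht hst => ?_⟩
      rw [mem_sdiff] at hs ht
      exact hc.2 s (mem_univ _) t (mem_univ _) ((hHadj s t).2 (Or.inl ⟨hst, hs.2, ht.2⟩))
    have hne : c u2 ≠ c u' := hc.2 u2 (mem_univ _) u' (mem_univ _)
      ((hHadj _ _).2 (Or.inr (Or.inl ⟨rfl, rfl⟩)))
    obtain ⟨c1, hc1, hc1e, hc1u⟩ := ext_col (v := u) (c u2) hcW (by simp [hmX])
      (hc.1 u2 (mem_univ _)) (by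
        intro w hw huw
        rw [hun w huw (mem_sdiff.1 hw).2]; exact hne.symm)
    have hmem : ∀ v, v ∈ insert u (univ \ X) ↔ v ∉ B := by
      intro v
      simp only [mem_insert, mem_sdiff, mem_univ, true_and, hmX, not_or]
      by_cases h : v = u
      · subst h; simp [huB]
      · simp [h]
    have hcnt := add_nb_le (G := G) (v := b0) (A := B.erase b0) (W := insert u (univ \ X)) (by
      intro t ht; rw [mem_erase] at ht; exact hB b0 hb0 t ht.2 ht.1.symm) (by
      rw [disjoint_left]; intro t ht; rw [hmem]; simpa using (mem_erase.1 ht).2)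
    rw [card_erase_of_mem hb0] at hcnt
    obtain ⟨c2, hc2, hc2e⟩ := ext1' (v := b0) hc1 (by rw [hmem]; simpa using hb0)
      (lt_of_le_of_lt card_image_le (by omega))
    have hu2m : u2 ∈ insert u (univ \ X) := by rw [hmem]; exact hu2B
    have hum : u ∈ insert u (univ \ X) := mem_insert_self _ _
    obtain ⟨c3, hc3, -⟩ := ext_set hc2 (B.erase b0) (by
      rw [disjoint_right]; intro t ht
      rw [mem_erase] at ht
      rw [mem_insert, hmem]
      push Not; exact ht) (by
      intro v hv
      rw [mem_erase] at hv
      exact hG.low (u := b0) (by omega) (hB b0 hb0 v hv.2 hv.1.symm)) (by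
      intro v hv
      rw [mem_erase] at hv
      refine ⟨u, mem_insert_of_mem hum, u2, mem_insert_of_mem hu2m, huu2, (hucomp v hv.2).symm,
        (hu2c v hv.2 hv.1).symm, ?_⟩
      rw [hc2e _ hum, hc2e _ hu2m, hc1u, hc1e u2 (by simp [hu2X])])
    refine ⟨c3, hc3.mono ?_⟩
    intro v _
    rw [mem_union, mem_insert, hmem, mem_erase]
    by_cases h : v ∈ B <;> by_cases h' : v = b0 <;> simp [h, h']
  have hu2low : dg H u2 ≤ 4 := by
    have hsub : nb H u2 univ ⊆ insert u' (nb G u2 univ \ (B.erase b0)) := by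
      intro t ht
      rw [mem_nb, hHadj] at ht
      rw [mem_insert, mem_sdiff, mem_nb]
      rcases ht.2 with h | h | h
      · refine Or.inr ⟨⟨mem_univ _, h.1⟩, fun h' => h.2.2 ((hmX t).2 (Or.inr (mem_erase.1 h').2))⟩
      · exact Or.inl h.2
      · exact absurd h.1 hu2u'
    have h1 := card_le_card hsub
    have h2 := card_insert_le u' (nb G u2 univ \ (B.erase b0))
    have h3 : B.erase b0 ⊆ nb G u2 univ := by
      intro t ht; rw [mem_erase] at ht; simp [hu2c t ht.2 ht.1]
    rw [card_sdiff_of_subset h3, card_erase_of_mem hb0] at h2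
    unfold dg at hu2h ⊢
    omega
  have hdgle : ∀ v, dg H v ≤ dg G v := by
    intro v
    by_cases hv2 : v = u2
    · subst hv2; omega
    by_cases hv' : v = u'
    · subst hv'
      have hsub : nb H v univ ⊆ insert u2 ((nb G v univ).erase u) := by
        intro t ht
        rw [mem_nb, hHadj] at ht
        rw [mem_insert, mem_erase, mem_nb]
        rcases ht.2 with h | h | h
        · refine Or.inr ⟨?_, mem_univ _, h.1⟩
          rintro rfl; exact h.2.2 ((hmX t).2 (Or.inl rfl))
        · exact absurd h.1.symm hu2u'
        · exact Or.inl h.2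
      have h1 := card_le_card hsub
      have h2 := card_insert_le u2 ((nb G v univ).erase u)
      have h3 : u ∈ nb G v univ := by simp [huu'.symm]
      have h4 := card_pos.2 ⟨u, h3⟩
      rw [card_erase_of_mem h3] at h2
      unfold dg
      omega
    · apply card_le_card
      intro t ht
      rw [mem_nb, hHadj] at ht
      rw [mem_nb]
      rcases ht.2 with h | h | h
      · exact ⟨mem_univ _, h.1⟩
      · exact absurd h.1 hv2
      · exact absurd h.1 hv'
  have hHc : Cls d H := by
    refine ⟨fun v => (hdgle v).trans (hG.le v), fun s t hs ht hst => ?_⟩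
    have e1 := hdgle s
    have e2 := hdgle t
    have e3 := hG.le s
    have e4 := hG.le t
    rcases (hHadj s t).1 hst with h | h | h
    · exact hG.ind s t (by omega) (by omega) h.1
    · rw [h.1] at hs; omega
    · rw [h.2] at ht; omega
  have hsum : ∑ v, dg H v < ∑ v, dg G v := by
    refine sum_lt_sum (fun v _ => hdgle v) ⟨u, mem_univ _, ?_⟩
    have h0 : dg H u = 0 := by
      unfold dg
      rw [card_eq_zero, eq_empty_iff_forall_notMem]
      intro t ht
      rw [mem_nb, hHadj] at ht
      rcases ht.2 with h | h | h
      · exact h.2.1 ((hmX u).2 (Or.inl rfl))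
      · exact huu2 h.1
      · exact huu'.ne h.1
    have := dg_pos huu'
    omega
  obtain ⟨T, a, b, hT, ha, hb, hab, hNC, hor⟩ := KM_T (IH H hsum hHc hHN)
  have hGH : ∀ s t, H.Adj s t → ¬ (s = u2 ∧ t = u') → ¬ (s = u' ∧ t = u2) → G.Adj s t := by
    intro s t h h1 h2
    rcases (hHadj s t).1 h with h | h | h
    · exact h.1
    · exact absurd h h1
    · exact absurd h h2
  by_cases hadj : H.Adj a b
  · have hcl : ∀ p ∈ T, ∀ q ∈ T, p ≠ q → H.Adj p q := by
      intro p hp q hq hpq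
      by_cases h1 : p = a ∧ q = b
      · rw [h1.1, h1.2]; exact hadj
      by_cases h2 : p = b ∧ q = a
      · rw [h2.1, h2.2]; exact hadj.symm
      exact hNC p hp q hq hpq h1 h2
    by_cases hboth : u2 ∈ T ∧ u' ∈ T
    · exact DT hd hG hN hV hT hboth.1 hboth.2 hu2u' (fun p hp q hq hpq h1 h2 =>
        hGH p q (hcl p hp q hq hpq) h1 h2)
    · refine DT hd hG hN hV hT ha hb hab (fun p hp q hq hpq h1 h2 =>
        hGH p q (hcl p hp q hq hpq) ?_ ?_)
      · rintro ⟨rfl, rfl⟩; exact hboth ⟨hp, hq⟩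
      · rintro ⟨rfl, rfl⟩; exact hboth ⟨hq, hp⟩
  · have hhi := hor.resolve_left hadj
    have hau2 : a ≠ u2 := by rintro rfl; omega
    have hbu2 : b ≠ u2 := by rintro rfl; omega
    have e1 := hdgle a
    have e2 := hdgle b
    have e3 := hG.le a
    have e4 := hG.le b
    have hboth : u2 ∉ T := by
      intro hu2
      have h1 := hNC u2 hu2 a ha hau2.symm (fun e => hau2 e.1.symm) (fun e => hbu2 e.1.symm)
      have h2 := hNC u2 hu2 b hb hbu2.symm (fun e => hau2 e.1.symm) (fun e => hbu2 e.1.symm)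
      by_cases hau' : a = u'
      · have : G.Adj u2 b := hGH _ _ h2 (fun e => hab (hau'.trans e.2.symm)) (fun e => hu2u' e.1)
        exact hG.ind u2 b hu2h (by omega) this
      · have : G.Adj u2 a := hGH _ _ h1 (fun e => hau' e.2) (fun e => hu2u' e.1)
        exact hG.ind u2 a hu2h (by omega) this
    refine DT hd hG hN hV hT ha hb hab (fun p hp q hq hpq h1 h2 =>
        hGH p q (hNC p hp q hq hpq h1 h2) ?_ ?_)
    · rintro ⟨rfl, rfl⟩; exact hboth hp
    · rintro ⟨rfl, rfl⟩; exact hboth hq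

lemma phi (hd : 4 ≤ d) : ∀ (m : ℕ) (G : SimpleGraph V), ∑ v, dg G v = m → Cls d G →
    ¬ ColOn G d univ → KM d G := by
  intro m
  induction m using Nat.strong_induction_on with
  | _ m ih =>
  intro G hm hG hN
  have IH : ∀ H : SimpleGraph V, ∑ v, dg H v < ∑ v, dg G v → Cls d H → ¬ ColOn H d univ →
      KM d H := fun H hH => ih _ (hm ▸ hH) H rfl
  by_cases hV : VC d G
  swap
  · unfold VC at hV
    push Not at hV
    obtain ⟨v, hv, hn⟩ := hV
    obtain ⟨h1, h2⟩ := del_step hv hn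
    exact KM_mono (delS_le _) hG.le (IH _ h2 (hG.mono (delS_le _)) h1)
  obtain ⟨r, hC⟩ : ∃ r, Ctx d G r := by
    refine ⟨fun b => if b then 2 else d - 2, hd, hG, hN, ?_, ?_⟩
    · intro b; cases b <;> simp; omega
    · intro b; cases b <;> simp <;> omega
  obtain ⟨A, B, y, u, b, hA, hB, hBc, hyA, hyB, hAB, hyl, huA, hul, huy, hlow, hlow2⟩ :=
    mozhan hC hV
  have hrs := hC.rs b
  have hBcard := hB.clq_card hBc hyB
  have hNcard := hA.reg y hyA
  have hNB : ∀ v ∈ nb G y A, v ∉ B := by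
    intro v hv hvB
    rw [mem_nb] at hv
    exact hv.2.ne' (hAB v hv.1 hvB)
  -- nonadjacent pairs between N and B are high-high
  have hcross : ∀ s ∈ nb G y A, ∀ t ∈ B, ¬ G.Adj s t → dg G s = d + 1 ∧ dg G t = d + 1 := by
    intro s hs t ht hst
    rw [mem_nb] at hs
    have hty : t ≠ y := by rintro rfl; exact hst hs.2.symm
    constructor
    · by_contra h
      exact hst (hlow s hs.1 (by have := hG.le s; omega) hs.2.symm t ht)
    · by_contra h
      exact hst ((hlow2 t ht (by have := hG.le t; omega) hty s hs.1 hs.2.ne').2 hs.2).symm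
  have huN : u ∈ nb G y A := mem_nb.2 ⟨huA, huy.symm⟩
  by_cases hcl : Clq G (nb G y A)
  · have hTc : (nb G y A ∪ B).card = d + 1 := by
      rw [card_union_of_disjoint (disjoint_left.2 hNB), hNcard, hBcard]; omega
    by_cases hall : ∀ s ∈ nb G y A, ∀ t ∈ B, G.Adj s t
    · refine KM_of (a := u) (b := y) hTc (mem_union_left _ huN) (mem_union_right _ hyB) huy.ne ?_
        (Or.inl huy) hd
      intro p hp q hq hpq _ _
      rcases mem_union.1 hp with hp | hp <;> rcases mem_union.1 hq with hq | hq
      · exact hcl p hp q hq hpq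
      · exact hall p hp q hq
      · exact (hall q hq p hp).symm
      · exact hBc p hp q hq hpq
    · push Not at hall
      obtain ⟨a, ha, c, hc, hac⟩ := hall
      obtain ⟨hah, hch⟩ := hcross a ha c hc hac
      have huniq : ∀ s ∈ nb G y A, ∀ t ∈ B, ¬ (s = a ∧ t = c) → G.Adj s t := by
        intro s hs t ht hne
        by_contra hst
        obtain ⟨h1, h2⟩ := hcross s hs t ht hst
        apply hne
        constructor
        · by_contra h; exact hG.ind s a h1 hah (hcl s hs a ha h)
        · by_contra h; exact hG.ind t c h2 hch (hBc t ht c hc h)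
      refine KM_of (a := a) (b := c) hTc (mem_union_left _ ha) (mem_union_right _ hc)
        (fun h => hNB a ha (h ▸ hc)) ?_ (Or.inr ⟨hah, hch⟩) hd
      intro p hp q hq hpq h1 h2
      rcases mem_union.1 hp with hp | hp <;> rcases mem_union.1 hq with hq | hq
      · exact hcl p hp q hq hpq
      · exact huniq p hp q hq h1
      · exact (huniq q hq p hp (fun e => h2 ⟨e.2, e.1⟩)).symm
      · exact hBc p hp q hq hpq
  · have hr2 : r b = 2 := by
      refine hA.cl.resolve_left (fun h => hcl ?_)
      intro s hs t ht hst
      exact h s (mem_nb.1 hs).1 t (mem_nb.1 ht).1 hst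
    rw [hr2] at hNcard hrs
    obtain ⟨u2, hu2⟩ := card_eq_one.1 (show ((nb G y A).erase u).card = 1 by
      rw [card_erase_of_mem huN, hNcard])
    have hu2m : u2 ∈ (nb G y A).erase u := by rw [hu2]; simp
    obtain ⟨hu2u, hu2N⟩ := mem_erase.1 hu2m
    have hNeq : ∀ v ∈ nb G y A, v = u ∨ v = u2 := by
      intro v hv
      by_cases h : v = u
      · exact Or.inl h
      · right
        have : v ∈ (nb G y A).erase u := mem_erase.2 ⟨h, hv⟩
        rw [hu2] at this; simpa using this
    have hnuu2 : ¬ G.Adj u u2 := by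
      intro hadj
      apply hcl
      intro s hs t ht hst
      rcases hNeq s hs with rfl | rfl <;> rcases hNeq t ht with rfl | rfl
      · exact absurd rfl hst
      · exact hadj
      · exact hadj.symm
      · exact absurd rfl hst
    have hBd : B.card + 1 = d := by omega
    have hucomp := hlow u huA hul huy
    by_cases hcomp : ∀ v ∈ B, G.Adj u2 v
    · have := dlemma hd hG hN hV hBc hBd hu2u.symm hucomp hcomp
      rcases this with h | h
      · exact absurd h hnuu2
      · omega
    · push Not at hcomp
      obtain ⟨b0, hb0, hnb0⟩ := hcomp
      obtain ⟨hu2h, hb0h⟩ := hcross u2 hu2N b0 hb0 hnb0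
      have hyu : y ∈ nb G u A := mem_nb.2 ⟨hyA, huy⟩
      have hcu := hA.reg u huA
      rw [hr2] at hcu
      obtain ⟨u', hu', hu'y⟩ := exists_mem_ne (s := nb G u A) (by omega) y
      rw [mem_nb] at hu'
      refine plemma hd hG hN hV IH (B := B) (u := u) (u2 := u2) (u' := u') (b0 := b0) hBc hBd
        (hNB u huN) (hNB u2 hu2N) (fun h => hu'y (hAB u' hu'.1 h)) hu2u.symm ?_ hu'.2 hucomp hul hb0
        hb0h hu2h ?_
      · rintro rfl; exact hnuu2 hu'.2
      · intro v hv hvb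
        by_contra hnv
        obtain ⟨-, h2⟩ := hcross u2 hu2N v hv hnv
        exact hG.ind v b0 h2 hb0h (hBc v hv b0 hb0 hvb)

end HD

namespace HD
open Finset
set_option linter.unusedSectionVars false
variable {V : Type*} [Fintype V] [DecidableEq V] {G : SimpleGraph V}

lemma clq_ncol {d : ℕ} {T : Finset V} (hT : Clq G T) (hc : d < T.card) : ¬ ColOn G d T := by
  rintro ⟨c, h1, h2⟩
  have := card_le_card_of_injOn (s := T) (t := range d) c (fun v hv => by simpa using h1 v hv) (by
    intro u hu v hv he
    by_contra hne
    exact h2 u hu v hv (hT u hu v hv hne) he)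
  simp at this; omega

lemma ColOn.anti {d : ℕ} {H : SimpleGraph V} {W : Finset V} (h : H ≤ G) (hc : ColOn G d W) :
    ColOn H d W := by
  obtain ⟨c, h1, h2⟩ := hc
  exact ⟨c, h1, fun u hu v hv huv => h2 u hu v hv (h huv)⟩

def Gs (G : SimpleGraph V) (X : Finset V) (a b : V) : SimpleGraph V where
  Adj s t := s ≠ t ∧ s ∉ X ∧ t ∉ X ∧ (G.Adj s t ∨ (s = a ∧ G.Adj b t) ∨ (t = a ∧ G.Adj b s))
  symm := ⟨by
    rintro s t ⟨h0, h1, h2, h3⟩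
    refine ⟨h0.symm, h2, h1, ?_⟩
    rcases h3 with h | h | h
    · exact Or.inl h.symm
    · exact Or.inr (Or.inr h)
    · exact Or.inr (Or.inl h)⟩
  loopless := ⟨fun _ h => h.1 rfl⟩

lemma thmB : ∀ (m : ℕ) (G : SimpleGraph V), ∑ v, dg G v = m → Cls 4 G → ¬ ColOn G 4 univ →
    ∃ W : Finset V, ¬ ColOn G 4 W ∧ W.card ≤ 2 * (W.filter (fun v => dg G v = 5)).card + 5 := by
  intro m
  induction m using Nat.strong_induction_on with
  | _ m ih =>
  intro G hm hG hN
  by_cases hV : VC 4 G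
  swap
  · unfold VC at hV
    push Not at hV
    obtain ⟨v, hv, hn⟩ := hV
    obtain ⟨h1, h2⟩ := del_step hv hn
    obtain ⟨W, hW, hWc⟩ := ih _ (hm ▸ h2) _ rfl (hG.mono (delS_le _)) h1
    refine ⟨W, fun h => hW (h.anti (delS_le _)), hWc.trans ?_⟩
    have : (W.filter (fun x => dg (delS G {v}) x = 5)) ⊆ W.filter (fun x => dg G x = 5) := by
      intro x hx
      rw [mem_filter] at hx ⊢
      have e1 := dg_mono (delS_le (G := G) {v}) x
      have e2 := hG.le x
      exact ⟨hx.1, by omega⟩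
    have := card_le_card this
    omega
  by_cases hK : ∃ T : Finset V, T.card = 5 ∧ Clq G T
  · obtain ⟨T, hT, hTc⟩ := hK
    exact ⟨T, clq_ncol hTc (by omega), by omega⟩
  obtain ⟨S, a, b, hS, hSc, hab, haS, hbS, hor⟩ := phi (d := 4) le_rfl _ G rfl hG hN
  have haS' : a ∉ S := fun h => (haS a h).ne rfl
  have hbS' : b ∉ S := fun h => (hbS b h).ne rfl
  have hnab : ¬ G.Adj a b := by
    intro h
    apply hK
    refine ⟨insert a (insert b S), ?_, ?_⟩
    · rw [card_insert_of_notMem (by simp [hab, haS']), card_insert_of_notMem hbS']; omega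
    · intro p hp q hq hpq
      simp only [mem_insert] at hp hq
      rcases hp with rfl | rfl | hp <;> rcases hq with rfl | rfl | hq
      · exact absurd rfl hpq
      · exact h
      · exact haS _ hq
      · exact h.symm
      · exact absurd rfl hpq
      · exact hbS _ hq
      · exact (haS _ hp).symm
      · exact (hbS _ hp).symm
      · exact hS _ hp _ hq hpq
  obtain ⟨hah, hbh⟩ := hor.resolve_left hnab
  have hSl : ∀ s ∈ S, dg G s ≤ 4 := fun s hs => hG.low (u := a) (by omega) (haS s hs)
  obtain ⟨X, hX⟩ : ∃ X, X = insert b S := ⟨_, rfl⟩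
  have hmX : ∀ v, v ∈ X ↔ v = b ∨ v ∈ S := by intro v; simp [hX]
  have hXc : X.card = 4 := by rw [hX, card_insert_of_notMem hbS']; omega
  have haX : a ∉ X := by rw [hmX]; push Not; exact ⟨hab, haS'⟩
  have hbX : b ∈ X := (hmX b).2 (Or.inl rfl)
  obtain ⟨H, hH⟩ : ∃ H, H = Gs G X a b := ⟨_, rfl⟩
  have hHadj : ∀ s t, H.Adj s t ↔ s ≠ t ∧ s ∉ X ∧ t ∉ X ∧
      (G.Adj s t ∨ (s = a ∧ G.Adj b t) ∨ (t = a ∧ G.Adj b s)) := by intro s t; rw [hH]; rfl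
  have hHX : ∀ x ∈ X, dg H x = 0 := by
    intro x hx
    unfold dg
    rw [card_eq_zero, eq_empty_iff_forall_notMem]
    intro t ht
    rw [mem_nb, hHadj] at ht
    exact ht.2.2.1 hx
  have hHa : dg H a ≤ 4 := by
    have hsub : nb H a univ ⊆ (nb G a univ \ S) ∪ (nb G b univ \ S) := by
      intro t ht
      rw [mem_nb, hHadj] at ht
      have htS : t ∉ S := fun h => ht.2.2.2.1 ((hmX t).2 (Or.inr h))
      simp only [mem_union, mem_sdiff, mem_nb, mem_univ, true_and, htS, not_false_eq_true, and_true]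
      rcases ht.2.2.2.2 with h | h | h
      · exact Or.inl h
      · exact Or.inr h.2
      · exact absurd h.1.symm ht.2.1
    have h1 := card_le_card hsub
    have h2 := card_union_le (nb G a univ \ S) (nb G b univ \ S)
    have h3 : S ⊆ nb G a univ := by intro t ht; simp [haS t ht]
    have h4 : S ⊆ nb G b univ := by intro t ht; simp [hbS t ht]
    rw [card_sdiff_of_subset h3, card_sdiff_of_subset h4] at h2
    unfold dg at hah hbh ⊢
    omega
  have hdgle : ∀ v, dg H v ≤ dg G v := by
    intro v
    by_cases hva : v = a
    · subst hva; omega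
    by_cases hvb : G.Adj b v
    · have hsub : nb H v univ ⊆ insert a ((nb G v univ).erase b) := by
        intro t ht
        rw [mem_nb, hHadj] at ht
        rw [mem_insert, mem_erase, mem_nb]
        rcases ht.2.2.2.2 with h | h | h
        · refine Or.inr ⟨?_, mem_univ _, h⟩
          rintro rfl; exact ht.2.2.2.1 hbX
        · exact absurd h.1 hva
        · exact Or.inl h.1
      have h1 := card_le_card hsub
      have h2 := card_insert_le a ((nb G v univ).erase b)
      have h3 : b ∈ nb G v univ := by simp [hvb.symm]
      have h4 := card_pos.2 ⟨b, h3⟩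
      rw [card_erase_of_mem h3] at h2
      unfold dg
      omega
    · apply card_le_card
      intro t ht
      rw [mem_nb, hHadj] at ht
      rw [mem_nb]
      rcases ht.2.2.2.2 with h | h | h
      · exact ⟨mem_univ _, h⟩
      · exact absurd h.1 hva
      · exact absurd h.2 hvb
  have hHc : Cls 4 H := by
    refine ⟨fun v => (hdgle v).trans (hG.le v), fun s t hs ht hst => ?_⟩
    have e1 := hdgle s
    have e2 := hdgle t
    have e3 := hG.le s
    have e4 := hG.le t
    rcases ((hHadj s t).1 hst).2.2.2 with h | h | h
    · exact hG.ind s t (by omega) (by omega) h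
    · rw [h.1] at hs; omega
    · rw [h.1] at ht; omega
  have hsum : ∑ v, dg H v < ∑ v, dg G v := by
    refine sum_lt_sum (fun v _ => hdgle v) ⟨b, mem_univ _, ?_⟩
    rw [hHX b hbX]; omega
  have hHN : ¬ ColOn H 4 univ := by
    rintro ⟨c, hc⟩
    apply hN
    have hcW : PC G 4 (univ \ X) c := by
      refine ⟨fun v _ => hc.1 v (mem_univ _), fun s hs t ht hst => ?_⟩
      rw [mem_sdiff] at hs ht
      exact hc.2 s (mem_univ _) t (mem_univ _) ((hHadj s t).2 ⟨hst.ne, hs.2, ht.2, Or.inl hst⟩)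
    have haW : a ∈ univ \ X := by simp [haX]
    obtain ⟨c1, hc1, hc1e, hc1b⟩ := ext_col (v := b) (c a) hcW (by simp [hbX])
      (hc.1 a (mem_univ _)) (by
        intro w hw hbw
        have hwa : w ≠ a := by rintro rfl; exact hnab hbw.symm
        exact hc.2 w (mem_univ _) a (mem_univ _) ((hHadj w a).2 ⟨hwa, (mem_sdiff.1 hw).2, haX,
          Or.inr (Or.inr ⟨rfl, hbw⟩)⟩))
    obtain ⟨c2, hc2, -⟩ := ext_set hc1 S (by
      rw [disjoint_right]; intro t ht
      simp only [mem_insert, mem_sdiff, mem_univ, true_and, hmX, not_or, not_and, not_not]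
      refine ⟨?_, fun _ => ht⟩
      rintro rfl; exact hbS' ht) hSl (fun v hv => ⟨a, mem_insert_of_mem haW, b,
        mem_insert_self _ _, hab, (haS v hv).symm, (hbS v hv).symm, by rw [hc1b, hc1e a haW]⟩)
    refine ⟨c2, hc2.mono ?_⟩
    intro v _
    simp only [mem_union, mem_insert, mem_sdiff, mem_univ, true_and, hmX, not_or]
    by_cases h1 : v = b <;> by_cases h2 : v ∈ S <;> simp [h1, h2]
  obtain ⟨W, hW, hWc⟩ := ih _ (hm ▸ hsum) H rfl hHc hHN
  have hW0 : ¬ ColOn H 4 (W \ X) := by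
    rintro ⟨c, h1, h2⟩
    refine hW ⟨fun v => if v ∈ X then 0 else c v, ?_, ?_⟩
    · intro v hv
      by_cases hvX : v ∈ X
      · simp [hvX]
      · simp only [hvX, if_false]; exact h1 v (by simp [hv, hvX])
    · intro s hs t ht hst
      have h3 := (hHadj s t).1 hst
      simp only [h3.2.1, h3.2.2.1, if_false]
      exact h2 s (by simp [hs, h3.2.1]) t (by simp [ht, h3.2.2.1]) hst
  have hhi : W.filter (fun v => dg H v = 5) ⊆ (W \ X).filter (fun v => dg G v = 5) := by
    intro v hv
    rw [mem_filter] at hv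
    rw [mem_filter, mem_sdiff]
    have e1 := hdgle v
    have e2 := hG.le v
    refine ⟨⟨hv.1, fun h => ?_⟩, by omega⟩
    have := hHX v h
    omega
  have hWle : (W \ X).card ≤ W.card := card_le_card sdiff_subset
  by_cases haW : a ∈ W
  · refine ⟨(W \ X) ∪ X, ?_, ?_⟩
    · rintro ⟨c, h1, h2⟩
      have hmem : ∀ v, v ∈ X → v ∈ (W \ X) ∪ X := fun v hv => mem_union_right _ hv
      have hSm : ∀ s ∈ S, s ∈ (W \ X) ∪ X := fun s hs => hmem s ((hmX s).2 (Or.inr hs))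
      have ham : a ∈ (W \ X) ∪ X := mem_union_left _ (by simp [haW, haX])
      have hbm := hmem b hbX
      have hcab : c a = c b := by
        by_contra hne
        have hinj : Set.InjOn c (S : Set V) := by
          intro s hs t ht he
          by_contra hst
          exact h2 s (hSm s hs) t (hSm t ht) (hS s hs t ht hst) he
        have hi : (S.image c).card = S.card := card_image_of_injOn hinj
        have hsub : insert (c a) (insert (c b) (S.image c)) ⊆ range 4 := by
          intro k hk
          simp only [mem_insert, mem_image] at hk
          rw [Finset.mem_range]
          rcases hk with rfl | rfl | ⟨s, hs, rfl⟩
          · exact h1 a ham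
          · exact h1 b hbm
          · exact h1 s (hSm s hs)
        have hca : c a ∉ S.image c := by
          intro h; obtain ⟨s, hs, he⟩ := mem_image.1 h
          exact h2 a ham s (hSm s hs) (haS s hs) he.symm
        have hcb : c b ∉ S.image c := by
          intro h; obtain ⟨s, hs, he⟩ := mem_image.1 h
          exact h2 b hbm s (hSm s hs) (hbS s hs) he.symm
        have := card_le_card hsub
        rw [card_insert_of_notMem (by simp only [mem_insert, not_or]; exact ⟨hne, hca⟩),
          card_insert_of_notMem hcb, hi, card_range] at this
        omega
      refine hW0 ⟨c, fun v hv => h1 v (mem_union_left _ hv), ?_⟩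
      intro s hs t ht hst
      have hs' : s ∈ (W \ X) ∪ X := mem_union_left _ hs
      have ht' : t ∈ (W \ X) ∪ X := mem_union_left _ ht
      rcases ((hHadj s t).1 hst).2.2.2 with h | h | h
      · exact h2 s hs' t ht' h
      · rw [h.1, hcab]; exact h2 b hbm t ht' h.2
      · rw [h.1, hcab]; exact (h2 b hbm s hs' h.2).symm
    · have h1 := card_union_le (W \ X) X
      have hsub : insert a (insert b (W.filter (fun v => dg H v = 5))) ⊆
          ((W \ X) ∪ X).filter (fun v => dg G v = 5) := by
        intro v hv
        rcases mem_insert.1 hv with rfl | hv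
        · rw [mem_filter]; exact ⟨mem_union_left _ (by simp [haW, haX]), hah⟩
        rcases mem_insert.1 hv with rfl | hv
        · rw [mem_filter]; exact ⟨mem_union_right _ hbX, hbh⟩
        · have := hhi hv
          rw [mem_filter] at this ⊢
          exact ⟨mem_union_left _ this.1, this.2⟩
      have h2 := card_le_card hsub
      rw [card_insert_of_notMem (by
        simp only [mem_insert, mem_filter, not_or]
        exact ⟨hab, fun h => by omega⟩), card_insert_of_notMem (by
        simp only [mem_filter]
        have := hHX b hbX
        exact fun h => by omega)] at h2
      omega
  · refine ⟨W \ X, ?_, ?_⟩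
    · rintro ⟨c, h1, h2⟩
      refine hW0 ⟨c, h1, fun s hs t ht hst => ?_⟩
      rcases ((hHadj s t).1 hst).2.2.2 with h | h | h
      · exact h2 s hs t ht h
      · exact absurd (h.1 ▸ (mem_sdiff.1 hs).1) haW
      · exact absurd (h.1 ▸ (mem_sdiff.1 ht).1) haW
    · have := card_le_card hhi
      omega

lemma dg_eq (G : SimpleGraph V) [DecidableRel G.Adj] (v : V) : dg G v = G.degree v := by
  unfold dg
  rw [← SimpleGraph.card_neighborFinset_eq_degree]
  congr 1
  ext w; simp

lemma colOn_iff {d : ℕ} (hd : 0 < d) : ColOn G d univ ↔ G.Colorable d := by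
  constructor
  · rintro ⟨c, h1, h2⟩
    refine ⟨SimpleGraph.Coloring.mk (fun v => (⟨c v, h1 v (mem_univ _)⟩ : Fin d)) ?_⟩
    intro u v huv he
    exact h2 u (mem_univ _) v (mem_univ _) huv (by simpa using he)
  · rintro ⟨C⟩
    refine ⟨fun v => (C v : ℕ), fun v _ => (C v).2, fun u _ v _ huv he => ?_⟩
    exact C.valid huv (Fin.ext he)

end HD

theorem lower_bound_high_degree {V : Type*} [Fintype V] [DecidableEq V]
    (G : SimpleGraph V) [DecidableRel G.Adj] (d : ℕ) (hd : 4 ≤ d)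
    (hcrit : IsCritical G (d + 1))
    (hdeg : ∀ v, G.degree v = d ∨ G.degree v = d + 1)
    (hind : ∀ u v, G.degree u = d + 1 → G.degree v = d + 1 → ¬ G.Adj u v)
    (h : ℕ) (hh : h = (Finset.univ.filter (fun v => G.degree v = d + 1)).card)
    (hpos : 0 < h) :
    (⌈(((d : ℚ) - 2) * (Fintype.card V : ℚ) - ((d : ℚ) + 1) * ((d : ℚ) - 2)) /
        (d : ℚ)⌉ : ℤ) ≤ (h : ℤ) := by
  classical
  obtain ⟨hchi, hsub⟩ := hcrit
  have hN : ¬ HD.ColOn G d Finset.univ := by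
    intro hc
    rw [HD.colOn_iff (by omega), ← SimpleGraph.chromaticNumber_le_iff_colorable, hchi] at hc
    have : d + 1 ≤ d := by exact_mod_cast hc
    omega
  have hC : HD.Cls d G := by
    refine ⟨fun v => ?_, fun u v hu hv => ?_⟩
    · rw [HD.dg_eq]; rcases hdeg v with h | h <;> omega
    · rw [HD.dg_eq] at hu hv; exact hind u v hu hv
  have hE : ∀ v, HD.ColOn G d (Finset.univ.erase v) := by
    intro v
    have hne : HD.delS G {v} ≠ G := by
      intro he
      have h1 : 0 < G.degree v := by rcases hdeg v with h | h <;> omega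
      obtain ⟨w, hw⟩ := (G.degree_pos_iff_exists_adj v).1 h1
      rw [← he] at hw
      exact hw.2.1 (by simp)
    have h1 := hsub _ (HD.delS_le {v}) hne
    rw [Nat.add_sub_cancel, SimpleGraph.chromaticNumber_le_iff_colorable,
      ← HD.colOn_iff (by omega)] at h1
    obtain ⟨c, h2, h3⟩ := h1
    refine ⟨c, fun w _ => h2 w (Finset.mem_univ _), fun u hu w hw huw => ?_⟩
    refine h3 u (Finset.mem_univ _) w (Finset.mem_univ _) ⟨huw, ?_, ?_⟩
    · simpa using hu
    · simpa using hw
  have hW : ∀ W : Finset V, ¬ HD.ColOn G d W → W = Finset.univ := by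
    intro W hn
    by_contra hne
    obtain ⟨v, hv⟩ : ∃ v, v ∉ W := by
      by_contra! hall
      exact hne (Finset.eq_univ_iff_forall.2 hall)
    apply hn
    refine (hE v).mono fun w hw => ?_
    rw [Finset.mem_erase]
    exact ⟨fun he => hv (he ▸ hw), Finset.mem_univ _⟩
  have hdq : (0 : ℚ) < d := by exact_mod_cast (by omega : 0 < d)
  rw [Int.ceil_le, div_le_iff₀ hdq]
  by_cases h4 : d = 4
  · subst h4
    obtain ⟨W, h1, h2⟩ := HD.thmB _ G rfl hC hN
    have := hW W h1
    subst this
    have h3 : (Finset.univ.filter (fun v => HD.dg G v = 5)).card = h := by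
      rw [hh]; congr 1; ext v; simp [HD.dg_eq]
    rw [h3, Finset.card_univ] at h2
    have h5 : (Fintype.card V : ℚ) ≤ 2 * h + 5 := by exact_mod_cast h2
    push_cast
    linarith
  · obtain ⟨S, a, b, hS, hc, hab, ha, hb, -⟩ := HD.phi hd _ G rfl hC hN
    have hadj : G.Adj a b := by
      rcases HD.dlemma hd hC hN (fun v _ => hE v) hS hc hab ha hb with h | h
      · exact h
      · exact absurd h.2.2 h4
    have haS : a ∉ S := fun h => (ha a h).ne rfl
    have hbS : b ∉ S := fun h => (hb b h).ne rfl
    have hcard : (insert a (insert b S)).card = d + 1 := by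
      rw [Finset.card_insert_of_notMem (by simp [hab, haS]), Finset.card_insert_of_notMem hbS]
      omega
    have hT : HD.Clq G (insert a (insert b S)) := by
      intro u hu v hv hne
      simp only [Finset.mem_insert] at hu hv
      rcases hu with rfl | rfl | hu <;> rcases hv with rfl | rfl | hv
      · exact absurd rfl hne
      · exact hadj
      · exact ha _ hv
      · exact hadj.symm
      · exact absurd rfl hne
      · exact hb _ hv
      · exact (ha _ hu).symm
      · exact (hb _ hu).symm
      · exact hS _ hu _ hv hne
    have h6 := hW _ (HD.clq_ncol (d := d) hT (by omega))
    rw [h6, Finset.card_univ] at hcard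
    rw [hcard]
    push_cast
    have : (0 : ℚ) ≤ (h : ℚ) * d := by positivity
    linarith
end
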